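/- arXiv:1512.00419 — 2 statements merged into one kernel-verified Lean document; each statement's English description precedes it below -/
import Mathlib

section
/- (Non-commutative Grothendieck inequality.) Let A and B be C*-algebras and let M : A × B → ℂ be a bilinear map such that |M(x, y)| ≤ ‖x‖·‖y‖ for all x ∈ A, y ∈ B. Then for every integer N ≥ 1 and all finite sequences x₁,…,x_N ∈ A and y₁,…,y_N ∈ B satisfying ‖Σᵢ xᵢxᵢ*‖ + ‖Σᵢ xᵢ*xᵢ‖ ≤ 2 and ‖Σᵢ yᵢyᵢ*‖ + ‖Σᵢ yᵢ*yᵢ‖ ≤ 2, it holds that |Σᵢ M(xᵢ, yᵢ)| ≤ 2. -/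
section ncPart1
open scoped ComplexConjugate InnerProductSpace

section cs
variable {A : Type*} [CStarAlgebra A] [PartialOrder A] [StarOrderedRing A]

theorem nc_cs {ι : Type*} [Fintype ι] (a b : ι → A) :
    ‖∑ i, star (a i) * b i‖ ^ 2 ≤ ‖∑ i, star (a i) * a i‖ * ‖∑ i, star (b i) * b i‖ := by
  let X : WithCStarModule A (ι → A) := (WithCStarModule.equiv A (ι → A)).symm (fun i => star (b i))
  let Y : WithCStarModule A (ι → A) := (WithCStarModule.equiv A (ι → A)).symm (fun i => star (a i))
  have h := CStarModule.norm_inner_le (A := A) (WithCStarModule A (ι → A)) (x := X) (y := Y)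
  have hX := WithCStarModule.pi_norm_sq (A := A) X
  have hY := WithCStarModule.pi_norm_sq (A := A) Y
  rw [WithCStarModule.pi_inner] at h
  simp only [WithCStarModule.inner_def] at h hX hY
  simp [X, Y] at h hX hY
  rw [← hX, ← hY, ← mul_pow, mul_comm]
  exact pow_le_pow_left₀ (norm_nonneg _) h 2

theorem nc_mono {a b : A} (ha : 0 ≤ a) (hab : a ≤ b) : ‖a‖ ≤ ‖b‖ :=
  CStarAlgebra.norm_le_norm_of_nonneg_of_le ha hab

theorem nc_sum_nonneg {ι : Type*} [Fintype ι] (a : ι → A) : 0 ≤ ∑ i, star (a i) * a i :=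
  Finset.sum_nonneg fun _ _ => star_mul_self_nonneg _

theorem nc_sum_nonneg' {ι : Type*} [Fintype ι] (a : ι → A) : 0 ≤ ∑ i, a i * star (a i) :=
  Finset.sum_nonneg fun _ _ => mul_star_self_nonneg _

end cs

structure NCSigns (ι Ω : Type*) [Fintype ι] [DecidableEq ι] [Fintype Ω] where
  z : ι → Ω → ℂ
  ne : Nonempty Ω
  uni : ∀ i w, conj (z i w) * z i w = 1
  ortho : ∀ i j, ∑ w, conj (z i w) * z j w = if i = j then (Fintype.card Ω : ℂ) else 0
  four : ∀ a b c d, ∑ w, conj (z a w) * z b w * (conj (z c w) * z d w) =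
    (if a = b ∧ c = d then (Fintype.card Ω : ℂ) else 0) +
    (if a = d ∧ b = c then (Fintype.card Ω : ℂ) else 0) -
    (if a = b ∧ b = c ∧ c = d then (Fintype.card Ω : ℂ) else 0)

namespace NCSigns
variable {ι Ω : Type*} [Fintype ι] [DecidableEq ι] [Fintype Ω]

/-- conjugate signs -/
noncomputable def cj (S : NCSigns ι Ω) : NCSigns ι Ω where
  z i w := conj (S.z i w)
  ne := S.ne
  uni i w := by rw [← map_mul, S.uni, map_one]
  ortho i j := by
    have := congrArg conj (S.ortho i j)
    simp only [map_sum, map_mul] at this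
    rw [this]; split_ifs <;> simp
  four a b c d := by
    have := congrArg conj (S.four a b c d)
    simp only [map_sum, map_mul, map_sub, map_add, apply_ite conj, map_zero, map_natCast] at this
    rw [this]

@[simp] theorem cj_z (S : NCSigns ι Ω) (i : ι) (w : Ω) : S.cj.z i w = conj (S.z i w) := rfl

theorem norm_z (S : NCSigns ι Ω) (i : ι) (w : Ω) : ‖S.z i w‖ = 1 := by
  have := congrArg norm (S.uni i w)
  simp at this
  nlinarith [norm_nonneg (S.z i w)]

theorem card_pos (S : NCSigns ι Ω) : 0 < (Fintype.card Ω : ℝ) := by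
  have := S.ne
  exact_mod_cast Fintype.card_pos

end NCSigns

theorem ncStd_aux {ι : Type*} [Fintype ι] [DecidableEq ι] (f : (ι → ZMod 3) →+ ZMod 3) (P : Prop)
    [Decidable P] (h1 : P → ∀ w, f w = 0) (h2 : ¬ P → ∃ w, f w ≠ 0) :
    ∑ w, (ZMod.stdAddChar (f w) : ℂ) = if P then (Fintype.card (ι → ZMod 3) : ℂ) else 0 := by
  let ψ : AddChar (ι → ZMod 3) ℂ := ZMod.stdAddChar.compAddMonoidHom f
  split_ifs with h
  · simp [h1 h]
  · obtain ⟨w, hw⟩ := h2 h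
    have : ψ ≠ 0 := by
      intro h0
      have h3 : ψ w = 1 := by rw [h0]; rfl
      have h4 : (ZMod.stdAddChar (f w) : ℂ) = 1 := h3
      rw [← AddChar.map_zero_eq_one (ZMod.stdAddChar (N := 3))] at h4
      exact hw (ZMod.injective_stdAddChar h4)
    exact AddChar.sum_eq_zero_iff_ne_zero.2 this

noncomputable def ncStd (ι : Type*) [Fintype ι] [DecidableEq ι] : NCSigns ι (ι → ZMod 3) where
  z i w := ZMod.stdAddChar (w i)
  ne := inferInstance
  uni i w := by
    rw [← AddChar.map_neg_eq_conj, ← AddChar.map_add_eq_mul]; simp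
  ortho i j := by
    let f : (ι → ZMod 3) →+ ZMod 3 :=
      - Pi.evalAddMonoidHom (fun _ => ZMod 3) i + Pi.evalAddMonoidHom (fun _ => ZMod 3) j
    have := ncStd_aux f (i = j) (by rintro rfl w; simp [f]) (by
      intro h; exact ⟨Pi.single i 1, by simp [f, Pi.single_apply, Ne.symm h]⟩)
    rw [← this]
    simp [f, AddChar.map_add_eq_mul, ← AddChar.map_neg_eq_conj]
  four a b c d := by
    let f : (ι → ZMod 3) →+ ZMod 3 :=
      - Pi.evalAddMonoidHom (fun _ => ZMod 3) a + Pi.evalAddMonoidHom (fun _ => ZMod 3) b +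
      (- Pi.evalAddMonoidHom (fun _ => ZMod 3) c + Pi.evalAddMonoidHom (fun _ => ZMod 3) d)
    have := ncStd_aux f ((a = b ∧ c = d) ∨ (a = d ∧ b = c)) (by
        rintro (⟨rfl, rfl⟩ | ⟨rfl, rfl⟩) w <;> simp [f]) (by
      intro h
      push Not at h
      by_contra! h0
      by_cases hab : a = b
      · subst hab
        have h1 := h0 (Pi.single c 1)
        have h2 := h.1 rfl
        simp [f, Pi.single_apply, Ne.symm h2] at h1
      · have h1 := h0 (Pi.single a 1)
        by_cases had : a = d
        · subst had
          have h2 := h.2 rfl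
          have h3 := h0 (Pi.single b 1)
          simp [f, Pi.single_apply, hab, Ne.symm h2] at h3
        · simp only [f, AddMonoidHom.add_apply, AddMonoidHom.neg_apply, Pi.evalAddMonoidHom_apply,
            Pi.single_apply, if_true, Ne.symm hab, Ne.symm had, if_false] at h1
          split_ifs at h1 <;> revert h1 <;> decide)
    have e : ∀ w, conj (ZMod.stdAddChar (w a) : ℂ) * ZMod.stdAddChar (w b) *
        (conj (ZMod.stdAddChar (w c) : ℂ) * ZMod.stdAddChar (w d)) = ZMod.stdAddChar (f w) := by
      intro w
      simp [f, AddChar.map_add_eq_mul, ← AddChar.map_neg_eq_conj]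
    simp only [e]
    rw [this]
    by_cases h1 : a = b <;> by_cases h2 : c = d <;> by_cases h3 : a = d <;> by_cases h4 : b = c <;>
      simp_all

end ncPart1

section ncPart2
open scoped ComplexConjugate InnerProductSpace

namespace NCSigns
variable {ι Ω : Type*} [Fintype ι] [DecidableEq ι] [Fintype Ω]
variable {A : Type*} [CStarAlgebra A] 

noncomputable def mix (S : NCSigns ι Ω) (x : ι → A) (w : Ω) : A := ∑ i, S.z i w • x i
noncomputable def coef (S : NCSigns ι Ω) (F : Ω → A) (i : ι) : A :=
  (Fintype.card Ω : ℂ)⁻¹ • ∑ w, conj (S.z i w) • F w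

theorem star_mix (S : NCSigns ι Ω) (x : ι → A) (w : Ω) :
    star (S.mix x w) = S.cj.mix (fun i => star (x i)) w := by
  simp [mix, star_sum, star_smul]

theorem star_coef (S : NCSigns ι Ω) (F : Ω → A) (i : ι) :
    star (S.coef F i) = S.cj.coef (fun i => star (F i)) i := by
  simp [coef, star_sum, star_smul]

theorem card_ne (S : NCSigns ι Ω) : (Fintype.card Ω : ℂ) ≠ 0 := by
  exact_mod_cast S.card_pos.ne'

theorem coef_mix (S : NCSigns ι Ω) (x : ι → A) (i : ι) : S.coef (S.mix x) i = x i := by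
  simp only [coef, mix, Finset.smul_sum, smul_smul]
  rw [Finset.sum_comm]
  simp only [← Finset.sum_smul, mul_assoc, ← Finset.mul_sum, S.ortho]
  simp [S.card_ne]

theorem sum_conj_smul (S : NCSigns ι Ω) (F : Ω → A) (i : ι) :
    ∑ w, conj (S.z i w) • F w = (Fintype.card Ω : ℂ) • S.coef F i := by
  simp [coef, smul_smul, S.card_ne]

theorem second (S : NCSigns ι Ω) (x : ι → A) :
    ∑ w, star (S.mix x w) * S.mix x w = (Fintype.card Ω : ℝ) • ∑ i, star (x i) * x i := by
  have h : ∀ w, star (S.mix x w) * S.mix x w =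
      ∑ i, ∑ j, (conj (S.z i w) * S.z j w) • (star (x i) * x j) := by
    intro w
    simp only [star_mix]; simp only [mix, Finset.sum_mul_sum, smul_mul_smul_comm, cj_z]
  simp only [h]
  rw [Finset.sum_comm]
  have : ∀ i, ∑ w, ∑ j, (conj (S.z i w) * S.z j w) • (star (x i) * x j) =
      (Fintype.card Ω : ℂ) • (star (x i) * x i) := by
    intro i
    rw [Finset.sum_comm]
    simp only [← Finset.sum_smul, S.ortho]
    simp
  simp only [this, ← Finset.smul_sum]
  norm_cast

theorem second' (S : NCSigns ι Ω) (x : ι → A) :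
    ∑ w, S.mix x w * star (S.mix x w) = (Fintype.card Ω : ℝ) • ∑ i, x i * star (x i) := by
  have := S.cj.second (fun i => star (x i))
  simp only [← star_mix, star_star] at this
  exact this

theorem cross (S : NCSigns ι Ω) (x : ι → A) (F : Ω → A) :
    ∑ w, star (S.mix x w) * F w = (Fintype.card Ω : ℝ) • ∑ i, star (x i) * S.coef F i := by
  simp only [star_mix]; simp only [mix, Finset.sum_mul, cj_z]
  rw [Finset.sum_comm]
  have : ∀ i, ∑ w, conj (S.z i w) • star (x i) * F w = (Fintype.card Ω : ℂ) • (star (x i) * S.coef F i) := by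
    intro i
    rw [← mul_smul_comm, ← sum_conj_smul, Finset.mul_sum]
    simp
  simp only [this, ← Finset.smul_sum]
  norm_cast

variable [PartialOrder A] [StarOrderedRing A]

theorem bessel (S : NCSigns ι Ω) (F : Ω → A) :
    (Fintype.card Ω : ℝ) • ∑ i, star (S.coef F i) * S.coef F i ≤ ∑ w, star (F w) * F w := by
  have h := nc_sum_nonneg (fun w => F w - S.mix (S.coef F) w)
  have h1 := S.cross (S.coef F) F
  have h2 := congrArg star h1
  have h3 := S.second (S.coef F)
  simp only [star_sub, sub_mul, mul_sub, Finset.sum_sub_distrib] at h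
  simp only [star_sum, star_mul, star_star, star_smul, star_trivial] at h2
  rw [h1, h2, h3, sub_self, sub_zero] at h
  exact sub_nonneg.1 h

theorem bessel_norm (S : NCSigns ι Ω) (F : Ω → A) :
    (Fintype.card Ω : ℝ) * ‖∑ i, star (S.coef F i) * S.coef F i‖ ≤ ‖∑ w, star (F w) * F w‖ := by
  have := nc_mono (by exact smul_nonneg (Nat.cast_nonneg _) (nc_sum_nonneg _)) (S.bessel F)
  simpa [norm_smul] using this

theorem bessel_norm' (S : NCSigns ι Ω) (F : Ω → A) :
    (Fintype.card Ω : ℝ) * ‖∑ i, S.coef F i * star (S.coef F i)‖ ≤ ‖∑ w, F w * star (F w)‖ := by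
  have := S.cj.bessel_norm (fun w => star (F w))
  simpa only [← star_coef, star_star] using this

theorem fourth (S : NCSigns ι Ω) (x : ι → A) :
    ∑ w, star (S.mix x w) * S.mix x w * (star (S.mix x w) * S.mix x w) = (Fintype.card Ω : ℝ) •
      ((∑ i, star (x i) * x i) * (∑ i, star (x i) * x i)
        + ∑ i, star (x i) * (∑ j, x j * star (x j)) * x i
        - ∑ i, star (x i) * x i * (star (x i) * x i)) := by
  have h : ∀ w, star (S.mix x w) * S.mix x w * (star (S.mix x w) * S.mix x w) =
      ∑ a, ∑ b, ∑ c, ∑ d, (conj (S.z a w) * S.z b w * (conj (S.z c w) * S.z d w)) •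
        (star (x a) * x b * (star (x c) * x d)) := by
    intro w
    have hw : star (S.mix x w) * S.mix x w =
        ∑ i, ∑ j, (conj (S.z i w) * S.z j w) • (star (x i) * x j) := by
      simp only [star_mix]; simp only [mix, Finset.sum_mul_sum, smul_mul_smul_comm, cj_z]
    rw [hw]
    simp only [Finset.sum_mul]
    simp only [Finset.mul_sum, smul_mul_smul_comm]
  simp only [h]
  rw [Finset.sum_comm]
  have h1 : ∀ a, ∑ w, ∑ b, ∑ c, ∑ d, (conj (S.z a w) * S.z b w * (conj (S.z c w) * S.z d w)) •
        (star (x a) * x b * (star (x c) * x d)) = ∑ b, ∑ c, ∑ d,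
        (∑ w, conj (S.z a w) * S.z b w * (conj (S.z c w) * S.z d w)) •
        (star (x a) * x b * (star (x c) * x d)) := by
    intro a
    rw [Finset.sum_comm]
    refine Finset.sum_congr rfl fun b _ => ?_
    rw [Finset.sum_comm]
    refine Finset.sum_congr rfl fun c _ => ?_
    rw [Finset.sum_comm]
    refine Finset.sum_congr rfl fun d _ => ?_
    rw [Finset.sum_smul]
  have h2 : ∀ a b c d, (∑ w, conj (S.z a w) * S.z b w * (conj (S.z c w) * S.z d w)) •
        (star (x a) * x b * (star (x c) * x d)) = (Fintype.card Ω : ℝ) •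
        ((if a = b then if c = d then (star (x a) * x b * (star (x c) * x d)) else 0 else 0) +
         (if a = d then if b = c then (star (x a) * x b * (star (x c) * x d)) else 0 else 0) -
         (if a = b then if b = c then if c = d then
           (star (x a) * x b * (star (x c) * x d)) else 0 else 0 else 0)) := by
    intro a b c d
    rw [S.four, sub_smul, add_smul, smul_sub, smul_add]
    simp only [ite_and, ite_smul, smul_ite, zero_smul, smul_zero]
    norm_cast
  simp only [h1, h2, ← Finset.smul_sum]
  congr 1
  simp only [Finset.sum_sub_distrib, Finset.sum_add_distrib]
  congr 1
  · congr 1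
    · simp [Finset.sum_mul_sum]
    · simp [Finset.mul_sum, Finset.sum_mul, mul_assoc]
  · simp

theorem fourth_norm (S : NCSigns ι Ω) (x : ι → A) :
    ‖∑ w, star (S.mix x w) * S.mix x w * (star (S.mix x w) * S.mix x w)‖ ≤ (Fintype.card Ω : ℝ) *
      (‖∑ i, star (x i) * x i‖ * (‖∑ i, x i * star (x i)‖ + ‖∑ i, star (x i) * x i‖)) := by
  set P := ∑ i, star (x i) * x i with hP
  set Q := ∑ i, x i * star (x i) with hQ
  have h0 : 0 ≤ ∑ w, star (S.mix x w) * S.mix x w * (star (S.mix x w) * S.mix x w) := by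
    refine Finset.sum_nonneg fun w _ => ?_
    have := star_mul_self_nonneg (star (S.mix x w) * S.mix x w)
    simpa using this
  have h1 : ∑ w, star (S.mix x w) * S.mix x w * (star (S.mix x w) * S.mix x w) ≤
     (Fintype.card Ω : ℝ) • (P * P + ∑ i, star (x i) * Q * x i) := by
    rw [fourth]
    refine smul_le_smul_of_nonneg_left ?_ (Nat.cast_nonneg _)
    refine sub_le_self _ (Finset.sum_nonneg fun i _ => ?_)
    have := star_mul_self_nonneg (star (x i) * x i)
    simpa using this
  refine (nc_mono h0 h1).trans ?_
  rw [norm_smul, Real.norm_of_nonneg (Nat.cast_nonneg _)]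
  refine mul_le_mul_of_nonneg_left ?_ (Nat.cast_nonneg _)
  have hQ0 : 0 ≤ Q := nc_sum_nonneg' x
  have h2 : ‖∑ i, star (x i) * Q * x i‖ ≤ ‖Q‖ * ‖P‖ := by
    have : ∑ i, star (x i) * Q * x i ≤ ‖Q‖ • P := by
      rw [hP, Finset.smul_sum]
      exact Finset.sum_le_sum fun i _ => CStarAlgebra.star_left_conjugate_le_norm_smul
    have := nc_mono (Finset.sum_nonneg fun i _ => star_left_conjugate_nonneg hQ0 _) this
    simpa [norm_smul] using this
  calc _ ≤ ‖P * P‖ + _ := norm_add_le _ _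
    _ ≤ ‖P‖ * ‖P‖ + ‖Q‖ * ‖P‖ := add_le_add (norm_mul_le _ _) h2
    _ = _ := by ring

theorem fourth_norm' (S : NCSigns ι Ω) (x : ι → A) :
    ‖∑ w, S.mix x w * star (S.mix x w) * (S.mix x w * star (S.mix x w))‖ ≤ (Fintype.card Ω : ℝ) *
      (‖∑ i, x i * star (x i)‖ * (‖∑ i, x i * star (x i)‖ + ‖∑ i, star (x i) * x i‖)) := by
  have := S.cj.fourth_norm (fun i => star (x i))
  simp only [← star_mix, star_star] at this
  rwa [add_comm ‖∑ i, x i * star (x i)‖]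

end NCSigns

end ncPart2

section ncPart3
open scoped ComplexConjugate InnerProductSpace

section phi
variable {A : Type*} [CStarAlgebra A]

theorem nc_star_exp (L : A) (hL : IsSelfAdjoint L) (c : ℂ) :
    star (NormedSpace.exp (c • L)) = NormedSpace.exp (conj c • L) := by
  rw [NormedSpace.star_exp, star_smul, hL.star_eq]; rfl

theorem nc_exp_mul (L : A) (c d : ℂ) :
    NormedSpace.exp (c • L) * NormedSpace.exp (d • L) = NormedSpace.exp ((c + d) • L) := by
  letI := NormedAlgebra.restrictScalars ℚ ℂ A
  rw [add_smul, NormedSpace.exp_add_of_commute]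
  exact ((Commute.refl L).smul_left c).smul_right d

theorem nc_exp_norm (L : A) (hL : IsSelfAdjoint L) : ∃ C : ℝ, 0 ≤ C ∧ ∀ (c : ℂ), |c.re| ≤ 1 / 2 →
    ‖NormedSpace.exp (c • L)‖ ≤ C := by
  have hc : Continuous (fun t : ℝ => NormedSpace.exp ((t : ℂ) • L)) := by
    have : Continuous (fun t : ℂ => NormedSpace.exp (t • L)) :=
      continuous_iff_continuousAt.2 fun t => (hasDerivAt_exp_smul_const L t).continuousAt
    exact this.comp Complex.continuous_ofReal
  obtain ⟨C, hC⟩ := (isCompact_Icc (a := (-1:ℝ)) (b := 1)).exists_bound_of_continuousOn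
    hc.continuousOn
  refine ⟨1 + |C|, by positivity, fun c h => ?_⟩
  have h1 : ‖star (NormedSpace.exp (c • L)) * NormedSpace.exp (c • L)‖ ≤ |C| := by
    rw [nc_star_exp L hL, nc_exp_mul]
    have e : conj c + c = ((2 * c.re : ℝ) : ℂ) := by
      rw [add_comm, Complex.add_conj]
    rw [e]
    refine (hC _ ?_).trans (le_abs_self _)
    rw [abs_le] at h
    constructor <;> linarith [h.1, h.2]
  rw [CStarRing.norm_star_mul_self] at h1
  nlinarith [norm_nonneg (NormedSpace.exp (c • L)), abs_nonneg C]

variable [PartialOrder A] [StarOrderedRing A]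

noncomputable def ncL (δ : ℝ) (X : A) : A := CFC.log (star X * X + algebraMap ℝ A δ)
noncomputable def ncPhi (δ : ℝ) (X : A) (z : ℂ) : A :=
  X * NormedSpace.exp (((z - 1) / 2) • ncL δ X)

theorem ncL_sa (δ : ℝ) (X : A) : IsSelfAdjoint (ncL δ X) := IsSelfAdjoint.log

theorem ncL_exp {δ : ℝ} (hδ : 0 < δ) (X : A) :
    NormedSpace.exp (ncL δ X) = star X * X + algebraMap ℝ A δ := by
  apply CFC.exp_log
  refine IsStrictlyPositive.nonneg_add (star_mul_self_nonneg X) ?_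
  rw [IsStrictlyPositive.iff_of_unital]
  refine ⟨?_, ?_⟩
  · rw [Algebra.algebraMap_eq_smul_one]; exact smul_nonneg hδ.le zero_le_one
  · exact (isUnit_iff_ne_zero.2 hδ.ne').map (algebraMap ℝ A)

theorem ncL_comm (δ : ℝ) (X : A) (c : ℂ) :
    Commute (star X * X) (NormedSpace.exp (c • ncL δ X)) := by
  have h : Commute (ncL δ X) (star X * X) := by
    refine Commute.cfc ?_ ?_ _
    · exact (Commute.refl _).add_left (Algebra.commutes _ _)
    · have : star (star X * X + algebraMap ℝ A δ) = star X * X + algebraMap ℝ A δ := by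
        simp [star_add, ← algebraMap_star_comm]
      rw [this]
      exact (Commute.refl _).add_left (Algebra.commutes _ _)
  letI := NormedAlgebra.restrictScalars ℚ ℂ A
  exact (h.symm.smul_right c).exp_right

theorem ncPhi_one (δ : ℝ) (X : A) : ncPhi δ X 1 = X := by simp [ncPhi]

theorem ncPhi_diff (δ : ℝ) (X : A) : Differentiable ℂ (ncPhi δ X) := by
  have h1 : Differentiable ℂ (fun u : ℂ => NormedSpace.exp (u • ncL δ X)) :=
    fun t => (hasDerivAt_exp_smul_const _ t).differentiableAt
  have h2 : Differentiable ℂ (fun z : ℂ => (z - 1) / 2) := by fun_prop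
  exact (differentiable_const X).mul (h1.comp h2)

theorem ncPhi_bdd (δ : ℝ) (X : A) : ∃ C, ∀ z : ℂ, 0 ≤ z.re → z.re ≤ 2 → ‖ncPhi δ X z‖ ≤ C := by
  obtain ⟨C, hC0, hC⟩ := nc_exp_norm _ (ncL_sa δ X)
  refine ⟨‖X‖ * C, fun z h0 h2 => ?_⟩
  refine (norm_mul_le _ _).trans (mul_le_mul_of_nonneg_left ?_ (norm_nonneg _))
  refine hC _ ?_
  have : ((z - 1) / 2).re = (z.re - 1) / 2 := by simp
  rw [this, abs_le]; constructor <;> linarith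

theorem nc_EE (δ : ℝ) (X : A) (z : ℂ) :
    star (NormedSpace.exp (((z - 1) / 2) • ncL δ X)) * NormedSpace.exp (((z - 1) / 2) • ncL δ X)
     = NormedSpace.exp (((z.re - 1 : ℝ) : ℂ) • ncL δ X) := by
  rw [nc_star_exp _ (ncL_sa δ X), nc_exp_mul]
  congr 2
  apply Complex.ext <;> simp [map_div₀, Complex.conj_ofNat] <;> ring

theorem nc_EE' (δ : ℝ) (X : A) (z : ℂ) :
    NormedSpace.exp (((z - 1) / 2) • ncL δ X) * star (NormedSpace.exp (((z - 1) / 2) • ncL δ X))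
     = NormedSpace.exp (((z.re - 1 : ℝ) : ℂ) • ncL δ X) := by
  rw [nc_star_exp _ (ncL_sa δ X), nc_exp_mul]
  congr 2
  apply Complex.ext <;> simp [map_div₀, Complex.conj_ofNat] <;> ring

theorem ncPhi_star_mul (δ : ℝ) (X : A) (z : ℂ) :
    star (ncPhi δ X z) * ncPhi δ X z =
      star X * X * NormedSpace.exp (((z.re - 1 : ℝ) : ℂ) • ncL δ X) := by
  rw [← nc_EE, ncPhi, star_mul]
  have h := ncL_comm δ X (conj ((z - 1) / 2))
  rw [← nc_star_exp _ (ncL_sa δ X)] at h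
  rw [← mul_assoc (star X * X), h.eq]
  simp only [mul_assoc]

theorem ncPhi_two {δ : ℝ} (hδ : 0 < δ) (X : A) (z : ℂ) (hz : z.re = 2) :
    star (ncPhi δ X z) * ncPhi δ X z = star X * X * (star X * X) + δ • (star X * X) := by
  rw [ncPhi_star_mul, hz]
  have : (((2:ℝ) - 1 : ℝ) : ℂ) = 1 := by norm_num
  rw [this, one_smul, ncL_exp hδ, mul_add, Algebra.smul_def, ← Algebra.commutes]

theorem ncPhi_two' {δ : ℝ} (hδ : 0 < δ) (X : A) (z : ℂ) (hz : z.re = 2) :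
    ncPhi δ X z * star (ncPhi δ X z) = X * star X * (X * star X) + δ • (X * star X) := by
  rw [ncPhi, star_mul, mul_assoc, ← mul_assoc _ _ (star X), nc_EE', hz]
  have : (((2:ℝ) - 1 : ℝ) : ℂ) = 1 := by norm_num
  rw [this, one_smul, ncL_exp hδ, add_mul, mul_add, ← Algebra.smul_def, mul_smul_comm]
  simp only [mul_assoc]

theorem nc_norm_le_one {a : A} (h0 : 0 ≤ a) (h : a ≤ 1) : ‖a‖ ≤ 1 :=
  (CStarAlgebra.norm_le_one_iff_of_nonneg a h0).2 h

theorem ncPhi_zero {δ : ℝ} (hδ : 0 < δ) (X : A) (z : ℂ) (hz : z.re = 0) :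
    ‖ncPhi δ X z‖ ≤ 1 := by
  have h1 := ncPhi_star_mul δ X z
  rw [hz] at h1
  set G := NormedSpace.exp (((0 - 1 : ℝ) : ℂ) • ncL δ X) with hG
  have h2 : (star X * X + algebraMap ℝ A δ) * G = 1 := by
    rw [← ncL_exp hδ, hG]
    nth_rw 1 [← one_smul ℂ (ncL δ X)]
    rw [nc_exp_mul]
    simp
  have hG0 : 0 ≤ G := by
    have := nc_EE δ X 0
    simp only [Complex.zero_re] at this
    rw [hG, ← this]; exact star_mul_self_nonneg _
  have h3 : star X * X * G ≤ 1 := by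
    rw [← h2, add_mul]
    refine le_add_of_nonneg_right ?_
    rw [← Algebra.smul_def]
    exact smul_nonneg hδ.le hG0
  have h4 : ‖star (ncPhi δ X z) * ncPhi δ X z‖ ≤ 1 := by
    refine nc_norm_le_one (star_mul_self_nonneg _) (h1 ▸ h3)
  rw [CStarRing.norm_star_mul_self] at h4
  nlinarith [norm_nonneg (ncPhi δ X z)]

theorem nc_three (f : ℂ → ℂ) (hd : Differentiable ℂ f) (C a b : ℝ)
    (hC : ∀ z : ℂ, 0 ≤ z.re → z.re ≤ 2 → ‖f z‖ ≤ C)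
    (ha : ∀ z : ℂ, z.re = 0 → ‖f z‖ ≤ a) (hb : ∀ z : ℂ, z.re = 2 → ‖f z‖ ≤ b) :
    ‖f 1‖ ^ 2 ≤ a * b := by
  have ha0 : 0 ≤ a := (norm_nonneg _).trans (ha 0 rfl)
  have hb0 : 0 ≤ b := (norm_nonneg _).trans (hb 2 rfl)
  have := Complex.HadamardThreeLines.norm_le_interp_of_mem_verticalClosedStrip' (f := f) (z := 1)
    (a := a) (b := b) (l := 0) (u := 2) (by norm_num)
    (by simp [Complex.HadamardThreeLines.verticalClosedStrip]) hd.diffContOnCl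
    (by
      refine ⟨C, ?_⟩
      rintro _ ⟨z, hz, rfl⟩
      exact hC z hz.1 hz.2) (fun z hz => ha z hz) (fun z hz => hb z hz)
  have e : (1 - ((1:ℂ).re - 0) / (2 - 0) : ℝ) = 1 / 2 := by norm_num
  have e' : (((1:ℂ).re - 0) / (2 - 0) : ℝ) = 1 / 2 := by norm_num
  rw [e, e', ← Real.sqrt_eq_rpow, ← Real.sqrt_eq_rpow] at this
  calc _ ≤ (√a * √b) ^ 2 := pow_le_pow_left₀ (norm_nonneg _) this 2
    _ = a * b := by rw [mul_pow, Real.sq_sqrt ha0, Real.sq_sqrt hb0]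

end phi

end ncPart3

section ncPart4
open scoped ComplexConjugate InnerProductSpace
open Topology Filter

theorem nc_inf_trick (P : ℝ → Prop) (C : ℝ) (hC : 0 ≤ C) (h0 : ∃ κ, 0 ≤ κ ∧ P κ)
    (hcl : ∀ κ, (∀ ε > 0, P (κ + ε)) → P κ) (hm : ∀ κ κ', P κ → κ ≤ κ' → P κ')
    (hs : ∀ κ, 0 ≤ κ → P κ → P (C * √κ)) : P (C ^ 2) := by
  let s : Set ℝ := {κ | 0 ≤ κ ∧ P κ}
  have hne : s.Nonempty := h0
  have hb : BddBelow s := ⟨0, fun κ h => h.1⟩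
  have hk0 : 0 ≤ sInf s := le_csInf hne fun κ h => h.1
  have hP : P (sInf s) := by
    refine hcl _ fun ε hε => ?_
    obtain ⟨κ, hκ, hlt⟩ := exists_lt_of_csInf_lt hne (lt_add_of_pos_right (sInf s) hε)
    exact hm _ _ hκ.2 hlt.le
  have h1 : sInf s ≤ C * √(sInf s) := csInf_le hb ⟨by positivity, hs _ hk0 hP⟩
  refine hm _ _ hP ?_
  by_contra! hlt
  have h2 : C < √(sInf s) := by
    rw [← Real.sqrt_sq hC]; exact Real.sqrt_lt_sqrt (by positivity) hlt
  have h3 : 0 < √(sInf s) := hC.trans_lt h2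
  have h4 := Real.mul_self_sqrt hk0
  nlinarith

theorem nc_delta (u C κ K p : ℝ) 
    (h : ∀ δ > 0, u ≤ C * √(κ * (K + δ * p))) : u ≤ C * √(κ * K) := by
  have hc : Tendsto (fun δ : ℝ => C * √(κ * (K + δ * p))) (𝓝[>] 0) (𝓝 (C * √(κ * (K + 0 * p)))) := by
    have : Continuous (fun δ : ℝ => C * √(κ * (K + δ * p))) := by fun_prop
    exact (this.tendsto 0).mono_left nhdsWithin_le_nhds
  have := ge_of_tendsto hc (by filter_upwards [self_mem_nhdsWithin] with δ hδ using h δ hδ)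
  simpa using this

section lemA
variable {ι Ω : Type*} [Fintype ι] [DecidableEq ι] [Fintype Ω]
variable {A : Type*} [CStarAlgebra A]

noncomputable def ncp {ι : Type*} [Fintype ι] (x : ι → A) : ℝ :=
  ‖∑ i, x i * star (x i)‖ + ‖∑ i, star (x i) * x i‖

theorem ncp_nonneg {ι : Type*} [Fintype ι] (x : ι → A) : 0 ≤ ncp x := by unfold ncp; positivity

theorem ncp_smul {ι : Type*} [Fintype ι] (c : ℝ) (x : ι → A) : ncp (fun i => c • x i) = c ^ 2 * ncp x := by
  simp [ncp, smul_mul_smul_comm, ← Finset.smul_sum, norm_smul]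
  rw [← sq_abs c]; ring

theorem ncp_le {ι : Type*} [Fintype ι] (x : ι → A) : ncp x ≤ 2 * ∑ i, ‖x i‖ ^ 2 := by
  have h1 : ‖∑ i, x i * star (x i)‖ ≤ ∑ i, ‖x i‖ ^ 2 := by
    refine (norm_sum_le _ _).trans (Finset.sum_le_sum fun i _ => ?_)
    rw [CStarRing.norm_self_mul_star, sq]
  have h2 : ‖∑ i, star (x i) * x i‖ ≤ ∑ i, ‖x i‖ ^ 2 := by
    refine (norm_sum_le _ _).trans (Finset.sum_le_sum fun i _ => ?_)
    rw [CStarRing.norm_star_mul_self, sq]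
  unfold ncp; linarith

variable [PartialOrder A] [StarOrderedRing A]

theorem nc_le_ncp {ι : Type*} [Fintype ι] (x : ι → A) (i : ι) : ‖x i‖ ^ 2 ≤ ncp x := by
  rw [sq, ← CStarRing.norm_star_mul_self]
  have := nc_mono (star_mul_self_nonneg (x i)) (Finset.single_le_sum (f := fun i => star (x i) * x i)
    (fun j _ => star_mul_self_nonneg _) (Finset.mem_univ i))
  unfold ncp
  linarith [norm_nonneg (∑ i, x i * star (x i))]

theorem ncp_coef (S : NCSigns ι Ω) (F : Ω → A) :
    (Fintype.card Ω : ℝ) * ncp (S.coef F) ≤ ncp F := by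
  have := S.bessel_norm F
  have := S.bessel_norm' F
  unfold ncp; linarith

theorem ncp_phi (S : NCSigns ι Ω) (x : ι → A) {δ : ℝ} (hδ : 0 < δ) (z : ℂ) (hz : z.re = 2) :
    ncp (fun w => ncPhi δ (S.mix x w) z) ≤ (Fintype.card Ω : ℝ) * (ncp x ^ 2 + δ * ncp x) := by
  have h1 := S.fourth_norm x
  have h2 := S.fourth_norm' x
  have h3 := congrArg norm (S.second x)
  have h4 := congrArg norm (S.second' x)
  simp only [norm_smul, Real.norm_of_nonneg (Nat.cast_nonneg (Fintype.card Ω))] at h3 h4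
  simp only [ncp, ncPhi_two hδ _ z hz, ncPhi_two' hδ _ z hz, Finset.sum_add_distrib, ← Finset.smul_sum]
  have h5 := norm_add_le (∑ w, S.mix x w * star (S.mix x w) * (S.mix x w * star (S.mix x w)))
    (δ • ∑ w, S.mix x w * star (S.mix x w))
  have h6 := norm_add_le (∑ w, star (S.mix x w) * S.mix x w * (star (S.mix x w) * S.mix x w))
    (δ • ∑ w, star (S.mix x w) * S.mix x w)
  simp only [norm_smul, Real.norm_of_nonneg hδ.le, h3, h4] at h5 h6
  nlinarith

theorem nc_lemA (S : NCSigns ι Ω) (I : Submodule ℂ A) (hI : ∀ x ∈ I, ∀ a, x * a ∈ I)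
    (f : ι → A →L[ℂ] ℂ) (C : ℝ) (hC0 : 0 ≤ C)
    (hF : ∀ F : Ω → A, (∀ w, F w ∈ I) → (∀ w, ‖F w‖ ≤ 1) →
      ‖∑ w, ∑ i, conj (S.z i w) * f i (F w)‖ ≤ Fintype.card Ω * C)
    (x : ι → A) (hx : ∀ i, x i ∈ I) : ‖∑ i, f i (x i)‖ ^ 2 ≤ C ^ 2 * ncp x := by
  let P : ℝ → Prop := fun κ => ∀ x : ι → A, (∀ i, x i ∈ I) → ‖∑ i, f i (x i)‖ ^ 2 ≤ κ * ncp x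
  refine nc_inf_trick P C hC0 ⟨(∑ i, ‖f i‖) ^ 2, by positivity, ?_⟩ ?_ ?_ ?_ x hx
  · intro x hx
    have h1 : ‖∑ i, f i (x i)‖ ≤ (∑ i, ‖f i‖) * √(ncp x) := by
      rw [Finset.sum_mul]
      refine (norm_sum_le _ _).trans (Finset.sum_le_sum fun i _ => ?_)
      refine ((f i).le_opNorm _).trans (mul_le_mul_of_nonneg_left ?_ (norm_nonneg _))
      exact Real.le_sqrt_of_sq_le (nc_le_ncp x i)
    calc _ ≤ ((∑ i, ‖f i‖) * √(ncp x)) ^ 2 := pow_le_pow_left₀ (norm_nonneg _) h1 2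
      _ = _ := by rw [mul_pow, Real.sq_sqrt (ncp_nonneg x)]
  · intro κ h x hx
    have hc : Tendsto (fun ε : ℝ => (κ + ε) * ncp x) (𝓝[>] 0) (𝓝 ((κ + 0) * ncp x)) := by
      have : Continuous (fun ε : ℝ => (κ + ε) * ncp x) := by fun_prop
      exact (this.tendsto 0).mono_left nhdsWithin_le_nhds
    have := ge_of_tendsto hc (by filter_upwards [self_mem_nhdsWithin] with δ hδ using h δ hδ x hx)
    simpa using this
  · intro κ κ' h hk x hx
    exact (h x hx).trans (mul_le_mul_of_nonneg_right hk (ncp_nonneg x))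
  · intro κ hκ h x hx
    have hn := S.card_pos
    have hn' := S.card_ne
    have key : ∀ δ > 0, ‖∑ i, f i (x i)‖ ^ 2 ≤ C * √(κ * (ncp x ^ 2 + δ * ncp x)) := by
      intro δ hδ
      have hmix : ∀ w, S.mix x w ∈ I := fun w => I.sum_mem fun i _ => I.smul_mem _ (hx i)
      have hphi : ∀ z w, ncPhi δ (S.mix x w) z ∈ I := fun z w => hI _ (hmix w) _
      let H : ℂ → ℂ := fun z => ∑ i, f i (S.coef (fun w => ncPhi δ (S.mix x w) z) i)
      have hHe : ∀ z, H z = (Fintype.card Ω : ℂ)⁻¹ *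
          ∑ w, ∑ i, conj (S.z i w) * f i (ncPhi δ (S.mix x w) z) := by
        intro z
        simp only [H, NCSigns.coef, map_smul, map_sum, smul_eq_mul, ← Finset.mul_sum]
        rw [Finset.sum_comm]
      have hH1 : H 1 = ∑ i, f i (x i) := by
        simp only [H, ncPhi_one]
        exact Finset.sum_congr rfl fun i _ => by rw [S.coef_mix]
      choose K hK using fun w => ncPhi_bdd δ (S.mix x w)
      rw [← hH1]
      refine nc_three H ?_ ((Fintype.card Ω : ℝ)⁻¹ * ∑ w, ∑ i, 1 * (‖f i‖ * K w)) C _ ?_ ?_ ?_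
      · have : H = fun z => (Fintype.card Ω : ℂ)⁻¹ *
          ∑ w, ∑ i, conj (S.z i w) * f i (ncPhi δ (S.mix x w) z) := funext hHe
        rw [this]
        have hd : ∀ w, Differentiable ℂ (ncPhi δ (S.mix x w)) := fun w => ncPhi_diff _ _
        fun_prop
      · intro z h0 h2
        rw [hHe, norm_mul, norm_inv, Complex.norm_natCast]
        refine mul_le_mul_of_nonneg_left ?_ (by positivity)
        refine (norm_sum_le _ _).trans (Finset.sum_le_sum fun w _ => ?_)
        refine (norm_sum_le _ _).trans (Finset.sum_le_sum fun i _ => ?_)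
        rw [norm_mul, RCLike.norm_conj, S.norm_z]
        refine mul_le_mul_of_nonneg_left ?_ zero_le_one
        exact ((f i).le_opNorm _).trans (mul_le_mul_of_nonneg_left (hK w z h0 h2) (norm_nonneg _))
      · intro z hz
        rw [hHe, norm_mul, norm_inv, Complex.norm_natCast]
        have := hF (fun w => ncPhi δ (S.mix x w) z) (hphi z) (fun w => ncPhi_zero hδ _ z hz)
        rw [inv_mul_le_iff₀ hn]; exact this
      · intro z hz
        refine Real.le_sqrt_of_sq_le ?_
        refine (h _ (fun i => I.smul_mem _ (I.sum_mem fun w _ => I.smul_mem _ (hphi z w)))).trans ?_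
        refine mul_le_mul_of_nonneg_left ?_ hκ
        have h1 := ncp_coef S (fun w => ncPhi δ (S.mix x w) z)
        have h2 := ncp_phi S x hδ z hz
        exact le_of_mul_le_mul_left (h1.trans h2) hn
    have := nc_delta _ _ _ _ _ key
    rwa [Real.sqrt_mul hκ, Real.sqrt_sq (ncp_nonneg x), ← mul_assoc] at this

end lemA

end ncPart4

section ncPart5
open scoped ComplexConjugate InnerProductSpace
open Topology Filter

section normlem
variable {B : Type*} [CStarAlgebra B] [PartialOrder B] [StarOrderedRing B]

theorem nc_sq_le {c : B} (h0 : 0 ≤ c) (h1 : c ≤ 1) : c * c ≤ c := by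
  have hs := (IsSelfAdjoint.of_nonneg h0).star_eq
  have h2 := star_left_conjugate_nonneg (sub_nonneg.2 h1) c
  have h3 := star_left_conjugate_nonneg h0 (1 - c)
  rw [star_sub, star_one, hs] at h3
  rw [hs] at h2
  have h4 : c - c * c = c * (1 - c) * c + (1 - c) * c * (1 - c) := by noncomm_ring
  exact sub_nonneg.1 (h4 ▸ add_nonneg h2 h3)

theorem nc_star_le_one {v : B} (hv : ‖v‖ ≤ 1) : star v * v ≤ 1 := by
  refine (CStarAlgebra.norm_le_one_iff_of_nonneg _ (star_mul_self_nonneg v)).1 ?_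
  rw [CStarRing.norm_star_mul_self]
  nlinarith [norm_nonneg v]

theorem nc_conj_le {v b : B} (hv : ‖v‖ ≤ 1) : star (v * b) * (v * b) ≤ star b * b := by
  have := star_left_conjugate_le_conjugate (nc_star_le_one hv) b
  simpa [mul_assoc] using this

theorem nc_one_sub_sq {c : B} (h0 : 0 ≤ c) (h1 : c ≤ 1) : (1 - c) * (1 - c) + c ≤ 1 := by
  have h := nc_sq_le h0 h1
  have : (1 - c) * (1 - c) + c = 1 - (c - c * c) := by noncomm_ring
  rw [this]
  exact sub_le_self _ (sub_nonneg.2 h)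

theorem nc_normlem {y v a b c c' : B} (hy : ‖y‖ ≤ 1) (hv : ‖v‖ ≤ 1) (h0 : 0 ≤ c) (h1 : c ≤ 1)
    (h0' : 0 ≤ c') (h1' : c' ≤ 1) (hb : star b * b ≤ c) (ha : a * star a ≤ c') :
    ‖(1 - c') * y * (1 - c) + a * v * b‖ ≤ 1 := by
  have hs := (IsSelfAdjoint.of_nonneg h0).star_eq
  have hs' := (IsSelfAdjoint.of_nonneg h0').star_eq
  have h := nc_cs (![1 - c', star a]) (![y * (1 - c), v * b])
  simp only [Fin.sum_univ_two, Matrix.cons_val_zero, Matrix.cons_val_one, star_star, star_sub,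
    star_one, hs'] at h
  have e : (1 - c') * (y * (1 - c)) + a * (v * b) = (1 - c') * y * (1 - c) + a * v * b := by
    simp only [mul_assoc]
  rw [e] at h
  have n1 : ‖(1 - c') * (1 - c') + a * star a‖ ≤ 1 := by
    refine nc_norm_le_one (add_nonneg ?_ (mul_star_self_nonneg a)) ?_
    · have := star_mul_self_nonneg (1 - c')
      rwa [star_sub, star_one, hs'] at this
    · exact (by gcongr : _ ≤ (1 - c') * (1 - c') + c').trans (nc_one_sub_sq h0' h1')
  have n2 : ‖star (y * (1 - c)) * (y * (1 - c)) + star (v * b) * (v * b)‖ ≤ 1 := by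
    refine nc_norm_le_one (add_nonneg (star_mul_self_nonneg _) (star_mul_self_nonneg _)) ?_
    have h5 := nc_conj_le (b := 1 - c) hy
    rw [star_sub 1 c, star_one, hs] at h5
    exact (add_le_add h5 ((nc_conj_le hv).trans hb)).trans (nc_one_sub_sq h0 h1)
  have : ‖(1 - c') * y * (1 - c) + a * v * b‖ ^ 2 ≤ 1 :=
    h.trans (mul_le_one₀ n1 (norm_nonneg _) n2)
  nlinarith [norm_nonneg ((1 - c') * y * (1 - c) + a * v * b)]

end normlem

section dom
variable {A : Type*} [CStarAlgebra A] [PartialOrder A] [StarOrderedRing A]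
variable {B : Type*} [CStarAlgebra B] [PartialOrder B] [StarOrderedRing B]

def ncUB {ι : Type*} [Fintype ι] (y : ι → B) (t : ℝ) : Prop :=
  ∀ ζ : ι → ℂ, (∀ i, ‖ζ i‖ = 1) → ‖∑ i, ζ i • y i‖ ≤ t

structure NCData (I : Submodule ℂ A) (J : Submodule ℂ B) (M : A →L[ℂ] B →L[ℂ] ℂ) : Prop where
  hI : ∀ x ∈ I, ∀ a, x * a ∈ I
  hJ : ∀ x ∈ J, ∀ a, x * a ∈ J
  hJ' : ∀ x ∈ J, ∀ a, a * x ∈ J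
  hM : ∀ x ∈ I, ∀ y ∈ J, ‖M x y‖ ≤ ‖x‖ * ‖y‖

variable {I : Submodule ℂ A} {J : Submodule ℂ B} {M : A →L[ℂ] B →L[ℂ] ℂ}

theorem nc_step1 (D : NCData I J M) {ι : Type*} [Fintype ι] (x : ι → A) (y : ι → B)
    (hx : ∀ i, x i ∈ I) (hy : ∀ i, y i ∈ J) {t : ℝ} (ht : 0 ≤ t) (hyt : ncUB y t) :
    ‖∑ i, M (x i) (y i)‖ ^ 2 ≤ t ^ 2 * ncp x := by
  classical
  refine nc_lemA (ncStd ι) I D.hI (fun i => M.flip (y i)) t ht ?_ x hx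
  intro F hF hF1
  refine (norm_sum_le _ _).trans ?_
  have : ∀ w, ‖∑ i, conj ((ncStd ι).z i w) * (M.flip (y i)) (F w)‖ ≤ t := by
    intro w
    have e : ∑ i, conj ((ncStd ι).z i w) * (M.flip (y i)) (F w) =
        M (F w) (∑ i, conj ((ncStd ι).z i w) • y i) := by simp
    rw [e]
    refine (D.hM _ (hF w) _ (J.sum_mem fun i _ => J.smul_mem _ (hy i))).trans ?_
    have h1 := hyt (fun i => conj ((ncStd ι).z i w)) (fun i => by
      rw [RCLike.norm_conj]; exact (ncStd ι).norm_z i w)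
    calc _ ≤ 1 * t := mul_le_mul (hF1 w) h1 (norm_nonneg _) zero_le_one
      _ = t := one_mul t
  calc _ ≤ ∑ w : ι → ZMod 3, t := Finset.sum_le_sum fun w _ => this w
    _ = _ := by simp

def ncV (I : Submodule ℂ A) (J : Submodule ℂ B) (M : A →L[ℂ] B →L[ℂ] ℂ) : Set ℝ :=
  {r | ∃ (N : ℕ) (x : Fin N → A) (y : Fin N → B), (∀ i, x i ∈ I) ∧ (∀ i, y i ∈ J) ∧
    ∑ i, ‖x i‖ ^ 2 ≤ 1 ∧ ncUB y 1 ∧ r = (∑ i, M (x i) (y i)).re}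

theorem ncV_le (D : NCData I J M) {r : ℝ} (hr : r ∈ ncV I J M) : r ≤ √2 := by
  obtain ⟨N, x, y, hx, hy, h1, h2, rfl⟩ := hr
  refine (Complex.re_le_norm _).trans (Real.le_sqrt_of_sq_le ?_)
  have := nc_step1 D x y hx hy zero_le_one h2
  have := ncp_le x
  linarith

theorem ncV_zero : (0:ℝ) ∈ ncV I J M :=
  ⟨0, fun _ => 0, fun _ => 0, by simp, by simp, by simp, fun ζ _ => by simp, by simp⟩

theorem ncV_bdd (D : NCData I J M) : BddAbove (ncV I J M) := ⟨√2, fun _ hr => ncV_le D hr⟩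

theorem ncS_nonneg (D : NCData I J M) : 0 ≤ sSup (ncV I J M) := le_csSup (ncV_bdd D) ncV_zero
theorem ncS_le (D : NCData I J M) : sSup (ncV I J M) ≤ √2 :=
  csSup_le ⟨0, ncV_zero⟩ fun _ hr => ncV_le D hr

theorem ncS_hom (D : NCData I J M) {N : ℕ} (x : Fin N → A) (y : Fin N → B)
    (hx : ∀ i, x i ∈ I) (hy : ∀ i, y i ∈ J) (h1 : ∑ i, ‖x i‖ ^ 2 ≤ 1) {t : ℝ} (ht : 0 ≤ t)
    (hyt : ncUB y t) : (∑ i, M (x i) (y i)).re ≤ sSup (ncV I J M) * t := by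
  rcases ht.eq_or_lt with rfl | ht
  · have := nc_step1 D x y hx hy le_rfl hyt
    have h2 : ‖∑ i, M (x i) (y i)‖ = 0 := by
      have : ‖∑ i, M (x i) (y i)‖ ^ 2 ≤ 0 := by simpa using this
      exact pow_eq_zero_iff (two_ne_zero) |>.1 (le_antisymm this (by positivity))
    have := Complex.re_le_norm (∑ i, M (x i) (y i))
    linarith
  · have : (∑ i, M (x i) (((t⁻¹ : ℝ) : ℂ) • y i)).re ≤ sSup (ncV I J M) := by
      refine le_csSup (ncV_bdd D) ⟨N, x, _, hx, fun i => J.smul_mem _ (hy i), h1, ?_, rfl⟩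
      intro ζ hζ
      have h3 := hyt ζ hζ
      have e : ∑ i, ζ i • ((t⁻¹ : ℝ) : ℂ) • y i = ((t⁻¹ : ℝ) : ℂ) • ∑ i, ζ i • y i := by
        rw [Finset.smul_sum]; exact Finset.sum_congr rfl fun i _ => smul_comm _ _ _
      rw [e, norm_smul, Complex.norm_real, Real.norm_of_nonneg (by positivity), inv_mul_le_iff₀ ht]
      simpa using h3
    simp only [map_smul, smul_eq_mul, ← Finset.mul_sum, Complex.re_ofReal_mul] at this
    rw [inv_mul_le_iff₀ ht] at this
    linarith

theorem nc_dom1 (D : NCData I J M) {N : ℕ} (x : Fin N → A) (y : Fin N → B)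
    (hx : ∀ i, x i ∈ I) (hy : ∀ i, y i ∈ J) (h1 : ∑ i, ‖x i‖ ^ 2 ≤ 1) 
    (hyt : ncUB y 1) {ε : ℝ} (hε : sSup (ncV I J M) ≤ ε + (∑ i, M (x i) (y i)).re)
    (x0 : A) (hx0 : x0 ∈ I) (hx1 : ‖x0‖ ≤ 1)
    {v a b c c' : B} (hw : a * v * b ∈ J) (hv : ‖v‖ ≤ 1) (h0 : 0 ≤ c) (h1c : c ≤ 1)
    (h0' : 0 ≤ c') (h1' : c' ≤ 1) (hb : star b * b ≤ c) (ha : a * star a ≤ c') :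
    (M x0 (a * v * b)).re ^ 2 ≤ 2 * sSup (ncV I J M) *
      (ε + (∑ i, M (x i) (c' * y i + y i * c - c' * y i * c)).re) := by
  set s := sSup (ncV I J M) with hs
  have hs0 : 0 ≤ s := ncS_nonneg D
  set P := (∑ i, M (x i) ((1 - c') * y i * (1 - c))).re with hP
  set Q := (M x0 (a * v * b)).re with hQ
  have main : ∀ α β : ℝ, α ^ 2 + β ^ 2 = 1 → α * P + β * Q ≤ s := by
    intro α β hαβ
    refine le_csSup (ncV_bdd D) ⟨N + 1, Fin.cons ((β : ℂ) • x0) (fun i => (α : ℂ) • x i),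
      Fin.cons (a * v * b) (fun i => (1 - c') * y i * (1 - c)), ?_, ?_, ?_, ?_, ?_⟩
    · exact Fin.cases (I.smul_mem _ hx0) (fun i => I.smul_mem _ (hx i))
    · exact Fin.cases hw (fun i => D.hJ _ (D.hJ' _ (hy i) _) _)
    · rw [Fin.sum_univ_succ]
      simp only [Fin.cons_zero, Fin.cons_succ, norm_smul, Complex.norm_real, mul_pow,
        ← Finset.mul_sum, Real.norm_eq_abs, sq_abs]
      have : ‖x0‖ ^ 2 ≤ 1 := by nlinarith [norm_nonneg x0]
      nlinarith [sq_nonneg α, sq_nonneg β]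
    · intro ζ hζ
      rw [Fin.sum_univ_succ]
      simp only [Fin.cons_zero, Fin.cons_succ]
      have h3 := hyt (fun i => ζ i.succ) (fun i => hζ _)
      have h4 : ‖ζ 0 • v‖ ≤ 1 := by rw [norm_smul, hζ, one_mul]; exact hv
      have h5 := nc_normlem h3 h4 h0 h1c h0' h1' hb ha
      convert h5 using 2
      rw [add_comm]
      simp only [Finset.mul_sum, Finset.sum_mul, mul_smul_comm, smul_mul_assoc]
    · rw [Fin.sum_univ_succ]
      simp only [Fin.cons_zero, Fin.cons_succ, map_smul, ContinuousLinearMap.smul_apply, smul_eq_mul,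
        ← Finset.mul_sum, Complex.add_re, Complex.re_ofReal_mul]
      rw [← hP, ← hQ]; ring
  have hPQ : P ^ 2 + Q ^ 2 ≤ s ^ 2 := by
    by_cases hr : P ^ 2 + Q ^ 2 = 0
    · rw [hr]; positivity
    · have hr0 : 0 < P ^ 2 + Q ^ 2 := lt_of_le_of_ne (by positivity) (Ne.symm hr)
      set R := √(P ^ 2 + Q ^ 2) with hR
      have hR0 : 0 < R := Real.sqrt_pos.2 hr0
      have hR2 : R ^ 2 = P ^ 2 + Q ^ 2 := Real.sq_sqrt hr0.le
      have := main (P / R) (Q / R) (by rw [div_pow, div_pow, ← add_div, hR2, div_self hr])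
      have e : P / R * P + Q / R * Q = R := by
        field_simp; linarith
      rw [e] at this
      rw [← hR2]; exact pow_le_pow_left₀ hR0.le this 2
  have hPe : P = (∑ i, M (x i) (y i)).re - (∑ i, M (x i) (c' * y i + y i * c - c' * y i * c)).re := by
    rw [hP, ← Complex.sub_re, ← Finset.sum_sub_distrib]
    congr 1
    refine Finset.sum_congr rfl fun i _ => ?_
    rw [← map_sub]
    congr 1
    noncomm_ring
  have hPs : P ≤ s := abs_le_of_sq_le_sq' (by nlinarith) hs0 |>.2
  have h7 : Q ^ 2 ≤ 2 * s * (s - P) := by nlinarith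
  refine h7.trans (mul_le_mul_of_nonneg_left ?_ (by positivity))
  linarith

theorem nc_dom1' (D : NCData I J M) {N : ℕ} (x : Fin N → A) (y : Fin N → B)
    (hx : ∀ i, x i ∈ I) (hy : ∀ i, y i ∈ J) (h1 : ∑ i, ‖x i‖ ^ 2 ≤ 1) 
    (hyt : ncUB y 1) {ε : ℝ} (hε : sSup (ncV I J M) ≤ ε + (∑ i, M (x i) (y i)).re)
    (x0 : A) (hx0 : x0 ∈ I) (hx1 : ‖x0‖ ≤ 1)
    {v a b c c' : B} (hw : a * v * b ∈ J) (hv : ‖v‖ ≤ 1) (h0 : 0 ≤ c) (h1c : c ≤ 1)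
    (h0' : 0 ≤ c') (h1' : c' ≤ 1) (hb : star b * b ≤ c) (ha : a * star a ≤ c') :
    ‖M x0 (a * v * b)‖ ^ 2 ≤ 2 * sSup (ncV I J M) *
      (ε + (∑ i, M (x i) (c' * y i + y i * c - c' * y i * c)).re) := by
  obtain ⟨u, hu, hu'⟩ : ∃ u : ℂ, ‖u‖ = 1 ∧ u * M x0 (a * v * b) = ‖M x0 (a * v * b)‖ := by
    by_cases hz : M x0 (a * v * b) = 0
    · exact ⟨1, by simp, by simp [hz]⟩
    · refine ⟨conj (M x0 (a * v * b)) / ‖M x0 (a * v * b)‖, ?_, ?_⟩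
      · rw [norm_div, RCLike.norm_conj, Complex.norm_real, norm_norm,
          div_self (norm_ne_zero_iff.2 hz)]
      · have : (‖M x0 (a * v * b)‖ : ℂ) ≠ 0 := by exact_mod_cast norm_ne_zero_iff.2 hz
        rw [div_mul_eq_mul_div, Complex.conj_mul', sq, mul_div_assoc, div_self this, mul_one]
  have := nc_dom1 D x y hx hy h1 hyt hε (u • x0) (I.smul_mem _ hx0)
    (by rw [norm_smul, hu, one_mul]; exact hx1) hw hv h0 h1c h0' h1' hb ha
  rw [map_smul, ContinuousLinearMap.smul_apply, smul_eq_mul, hu', Complex.ofReal_re] at this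
  exact this

theorem nc_dom (D : NCData I J M) {K : Type*} [Fintype K] (X : K → A) (hX : ∀ j, X j ∈ I)
    (hX1 : ∀ j, ‖X j‖ ≤ 1) (v a b c c' : K → B) (hw : ∀ j, a j * v j * b j ∈ J)
    (hv : ∀ j, ‖v j‖ ≤ 1) (h0 : ∀ j, 0 ≤ c j) (h1c : ∀ j, c j ≤ 1)
    (h0' : ∀ j, 0 ≤ c' j) (h1' : ∀ j, c' j ≤ 1) (hb : ∀ j, star (b j) * b j ≤ c j)
    (ha : ∀ j, a j * star (a j) ≤ c' j) :
    ∑ j, ‖M (X j) (a j * v j * b j)‖ ^ 2 ≤ 8 * (‖∑ j, c' j‖ + ‖∑ j, c j‖) := by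
  set s := sSup (ncV I J M) with hs
  have hs0 : 0 ≤ s := ncS_nonneg D
  have hs2 : s ^ 2 ≤ 2 := by
    have := pow_le_pow_left₀ hs0 (ncS_le D) 2
    rwa [Real.sq_sqrt zero_le_two] at this
  have key : ∀ ε > 0, ∑ j, ‖M (X j) (a j * v j * b j)‖ ^ 2 ≤
      2 * s * (Fintype.card K * ε + s * (2 * (‖∑ j, c' j‖ + ‖∑ j, c j‖))) := by
    intro ε hε
    obtain ⟨r, ⟨N, x, y, hx, hy, h1, hyt, rfl⟩, hr⟩ :=
      exists_lt_of_lt_csSup ⟨0, ncV_zero⟩ (sub_lt_self s hε)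
    have hr' : s ≤ ε + (∑ i, M (x i) (y i)).re := by linarith
    have hj := fun j => nc_dom1' D x y hx hy h1 hyt hr' (X j) (hX j) (hX1 j) (hw j) (hv j) (h0 j)
      (h1c j) (h0' j) (h1' j) (hb j) (ha j)
    refine (Finset.sum_le_sum fun j _ => hj j).trans ?_
    rw [← Finset.mul_sum]
    refine mul_le_mul_of_nonneg_left ?_ (by positivity)
    rw [Finset.sum_add_distrib]
    refine add_le_add (by simp) ?_
    have e : ∑ j, (∑ i, M (x i) (c' j * y i + y i * c j - c' j * y i * c j)).re =
        (∑ i, M (x i) ((∑ j, c' j) * y i)).re + (∑ i, M (x i) (y i * (∑ j, c j))).re +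
        (∑ i, M (x i) (- ∑ j, c' j * y i * c j)).re := by
      rw [← Complex.re_sum, Finset.sum_comm, ← Complex.add_re, ← Complex.add_re,
        ← Finset.sum_add_distrib, ← Finset.sum_add_distrib]
      congr 1
      refine Finset.sum_congr rfl fun i _ => ?_
      rw [← map_sum, ← map_add, ← map_add, Finset.sum_sub_distrib, Finset.sum_add_distrib,
        Finset.sum_mul, Finset.mul_sum, sub_eq_add_neg]
    rw [e]
    have b1 := ncS_hom D x (fun i => (∑ j, c' j) * y i) hx (fun i => D.hJ' _ (hy i) _) h1
      (t := ‖∑ j, c' j‖) (norm_nonneg _) (by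
        intro ζ hζ
        simp only [← mul_smul_comm, ← Finset.mul_sum]
        exact (norm_mul_le _ _).trans (mul_le_of_le_one_right (norm_nonneg _) (hyt ζ hζ)))
    have b2 := ncS_hom D x (fun i => y i * (∑ j, c j)) hx (fun i => D.hJ _ (hy i) _) h1
      (t := ‖∑ j, c j‖) (norm_nonneg _) (by
        intro ζ hζ
        simp only [← smul_mul_assoc, ← Finset.sum_mul]
        exact (norm_mul_le _ _).trans (mul_le_of_le_one_left (norm_nonneg _) (hyt ζ hζ)))
    have b3 := ncS_hom D x (fun i => - ∑ j, c' j * y i * c j) hx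
      (fun i => J.neg_mem (J.sum_mem fun j _ => D.hJ _ (D.hJ' _ (hy i) _) _)) h1
      (t := ‖∑ j, c' j‖ + ‖∑ j, c j‖) (by positivity) (by
        intro ζ hζ
        have e2 : ∑ i, ζ i • (- ∑ j, c' j * y i * c j) =
            - ∑ j, star (c' j) * ((∑ i, ζ i • y i) * c j) := by
          simp only [smul_neg, Finset.sum_neg_distrib, Finset.smul_sum]
          rw [Finset.sum_comm]
          congr 1
          refine Finset.sum_congr rfl fun j _ => ?_
          rw [(IsSelfAdjoint.of_nonneg (h0' j)).star_eq, ← mul_assoc, Finset.mul_sum,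
            Finset.sum_mul]
          simp only [mul_smul_comm, smul_mul_assoc]
        rw [e2, norm_neg]
        have h3 := nc_cs c' (fun j => (∑ i, ζ i • y i) * c j)
        have h4 : ‖∑ j, star (c' j) * c' j‖ ≤ ‖∑ j, c' j‖ := by
          refine nc_mono (nc_sum_nonneg _) (Finset.sum_le_sum fun j _ => ?_)
          rw [(IsSelfAdjoint.of_nonneg (h0' j)).star_eq]
          exact nc_sq_le (h0' j) (h1' j)
        have h5 : ‖∑ j, star ((∑ i, ζ i • y i) * c j) * ((∑ i, ζ i • y i) * c j)‖ ≤ ‖∑ j, c j‖ := by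
          refine nc_mono (nc_sum_nonneg _) (Finset.sum_le_sum fun j _ => ?_)
          refine (nc_conj_le (hyt ζ hζ)).trans ?_
          rw [(IsSelfAdjoint.of_nonneg (h0 j)).star_eq]
          exact nc_sq_le (h0 j) (h1c j)
        have h6 := h3.trans (mul_le_mul h4 h5 (norm_nonneg _) (norm_nonneg _))
        refine abs_le_of_sq_le_sq' (h6.trans ?_) (by positivity) |>.2
        nlinarith [norm_nonneg (∑ j, c' j), norm_nonneg (∑ j, c j)])
    linarith
  have hc : Tendsto (fun ε : ℝ => 2 * s * (Fintype.card K * ε + s * (2 * (‖∑ j, c' j‖ + ‖∑ j, c j‖))))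
      (𝓝[>] 0) (𝓝 (2 * s * (Fintype.card K * 0 + s * (2 * (‖∑ j, c' j‖ + ‖∑ j, c j‖))))) := by
    have : Continuous (fun ε : ℝ =>
      2 * s * (Fintype.card K * ε + s * (2 * (‖∑ j, c' j‖ + ‖∑ j, c j‖)))) := by fun_prop
    exact (this.tendsto 0).mono_left nhdsWithin_le_nhds
  have := ge_of_tendsto hc (by filter_upwards [self_mem_nhdsWithin] with δ hδ using key δ hδ)
  nlinarith [norm_nonneg (∑ j, c' j), norm_nonneg (∑ j, c j)]

end dom

end ncPart5

section ncPart6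
open scoped ComplexConjugate InnerProductSpace
open Topology Filter

section slices
variable {B : Type*} [CStarAlgebra B] [PartialOrder B] [StarOrderedRing B]

theorem nc_spec {T : B} (hT : 0 ≤ T) : spectrum ℝ T ⊆ Set.Ici 0 :=
  fun _ hs => spectrum_nonneg_of_nonneg hT hs

theorem nc_cfc_mul {T : B} (hT : 0 ≤ T) {f g : ℝ → ℝ} (hf : ContinuousOn f (Set.Ici 0))
    (hg : ContinuousOn g (Set.Ici 0)) : cfc f T * cfc g T = cfc (fun s => f s * g s) T :=
  (cfc_mul f g T (hf.mono (nc_spec hT)) (hg.mono (nc_spec hT))).symm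

theorem nc_cfc_mono {T : B} (hT : 0 ≤ T) {f g : ℝ → ℝ} (hf : ContinuousOn f (Set.Ici 0))
    (hg : ContinuousOn g (Set.Ici 0)) (h : ∀ s, 0 ≤ s → f s ≤ g s) : cfc f T ≤ cfc g T :=
  cfc_mono (fun s hs => h s (nc_spec hT hs)) (hf.mono (nc_spec hT)) (hg.mono (nc_spec hT))

theorem nc_cfc_congr {T : B} (hT : 0 ≤ T) {f g : ℝ → ℝ} (h : ∀ s, 0 ≤ s → f s = g s) :
    cfc f T = cfc g T :=
  cfc_congr fun s hs => h s (nc_spec hT hs)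

theorem nc_cfc_one {T : B} (hT : 0 ≤ T) : cfc (fun _ : ℝ => (1:ℝ)) T = 1 :=
  cfc_const_one ℝ T (IsSelfAdjoint.of_nonneg hT)

theorem nc_cfc_id {T : B} (hT : 0 ≤ T) : cfc (fun s : ℝ => s) T = T :=
  cfc_id' ℝ T (IsSelfAdjoint.of_nonneg hT)

theorem nc_cfc_star (f : ℝ → ℝ) (T : B) : star (cfc f T) = cfc f T :=
  (cfc_predicate f T : IsSelfAdjoint _).star_eq

/-- basic function -/
noncomputable def bf (r s : ℝ) : ℝ := r * s / (1 + r * s)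
noncomputable def gf (r s : ℝ) : ℝ := 1 - ((1 + r * s) / (4 + r * s)) ^ 2

theorem bf_cont {r : ℝ} (hr : 0 < r) : ContinuousOn (bf r) (Set.Ici 0) := by
  unfold bf
  refine ContinuousOn.div (by fun_prop) (by fun_prop) fun s hs => ?_
  have : 0 ≤ s := hs
  positivity

theorem gf_cont {r : ℝ} (hr : 0 < r) : ContinuousOn (gf r) (Set.Ici 0) := by
  unfold gf
  refine continuousOn_const.sub (ContinuousOn.pow (ContinuousOn.div (by fun_prop) (by fun_prop) fun s hs => ?_) 2)
  have : 0 ≤ s := hs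
  positivity

theorem bf_nonneg {r s : ℝ} (hr : 0 < r) (hs : 0 ≤ s) : 0 ≤ bf r s := by unfold bf; positivity
theorem bf_le_one {r s : ℝ} (hr : 0 < r) (hs : 0 ≤ s) : bf r s ≤ 1 := by
  unfold bf; rw [div_le_one (by positivity)]; linarith
theorem bf_le {r s : ℝ} (hr : 0 < r) (hs : 0 ≤ s) : bf r s ≤ r * s := by
  unfold bf; exact div_le_self (by positivity) (by have := mul_nonneg hr.le hs; linarith)

theorem bf_tele {r s : ℝ} (hr : 0 < r) (hs : 0 ≤ s) :
    bf r s * bf r s - bf (r / 4) s * bf (r / 4) s = bf r s * gf r s * bf r s := by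
  have h1 : 0 < 1 + r * s := by positivity
  have h2 : 0 < 4 + r * s := by positivity
  have h3 : bf (r / 4) s = r * s / (4 + r * s) := by
    unfold bf
    rw [div_eq_div_iff (by positivity) h2.ne']; ring
  rw [h3]; unfold bf gf
  field_simp

theorem gf_bound {r s : ℝ} (hr : 0 < r) (hs : 0 ≤ s) : r * (s * (gf r s * gf r s)) ≤ 4 := by
  have hu : 0 ≤ r * s := by positivity
  generalize hgen : r * s = u at hu
  have h2 : 0 < 4 + u := by positivity
  have h3 : gf r s = 3 * (5 + 2 * u) / (4 + u) ^ 2 := by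
    unfold gf; rw [hgen]; field_simp; ring
  have : r * (s * (gf r s * gf r s)) = u * (9 * (5 + 2 * u) ^ 2) / (4 + u) ^ 4 := by
    rw [h3, ← hgen]; field_simp; ring
  rw [this, div_le_iff₀ (by positivity)]
  have h4 : (5 + 2 * u) ^ 2 ≤ 4 * (4 + u) ^ 2 := by nlinarith
  have h5 : 9 * u ≤ (4 + u) ^ 2 := by nlinarith [sq_nonneg (u - 1 / 2)]
  calc u * (9 * (5 + 2 * u) ^ 2) = 9 * u * (5 + 2 * u) ^ 2 := by ring
    _ ≤ (4 + u) ^ 2 * (4 * (4 + u) ^ 2) := by gcongr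
    _ = 4 * (4 + u) ^ 4 := by ring

theorem b1_bound {s : ℝ} (hs : 0 ≤ s) :
    s * ((1 - bf 1 s * bf 1 s) * (1 - bf 1 s * bf 1 s)) ≤ 1 := by
  have h3 : 1 - bf 1 s * bf 1 s = (1 + 2 * s) / (1 + s) ^ 2 := by
    unfold bf; field_simp; ring
  rw [h3, div_mul_div_comm, mul_div_assoc', div_le_one (by positivity)]
  have h4 : (1 + 2 * s) * (1 + 2 * s) ≤ 4 * (1 + s) ^ 2 := by nlinarith
  have h5 : 4 * s ≤ (1 + s) ^ 2 := by nlinarith [sq_nonneg (s - 1)]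
  calc s * ((1 + 2 * s) * (1 + 2 * s)) ≤ s * (4 * (1 + s) ^ 2) := by gcongr
    _ = 4 * s * (1 + s) ^ 2 := by ring
    _ ≤ (1 + s) ^ 2 * (1 + s) ^ 2 := by gcongr

noncomputable def bC (r : ℝ) (T : B) : B := cfc (bf r) T

theorem bC_star (r : ℝ) (T : B) : star (bC r T) = bC r T := nc_cfc_star _ _

theorem bC_mul {r : ℝ} (hr : 0 < r) {T : B} (hT : 0 ≤ T) :
    bC r T * bC r T = cfc (fun s => bf r s * bf r s) T := nc_cfc_mul hT (bf_cont hr) (bf_cont hr)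

theorem bC_sq_le_one {r : ℝ} (hr : 0 < r) {T : B} (hT : 0 ≤ T) : bC r T * bC r T ≤ 1 := by
  rw [bC_mul hr hT, ← nc_cfc_one hT]
  refine nc_cfc_mono hT ((bf_cont hr).mul (bf_cont hr)) continuousOn_const fun s hs => ?_
  exact mul_le_one₀ (bf_le_one hr hs) (bf_nonneg hr hs) (bf_le_one hr hs)

theorem bC_sq_nonneg (r : ℝ) (T : B) : 0 ≤ bC r T * bC r T := by
  have := star_mul_self_nonneg (bC r T)
  rwa [bC_star] at this

theorem bC_sq_le {r : ℝ} (hr : 0 < r) {T : B} (hT : 0 ≤ T) :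
    bC r T * bC r T ≤ (r ^ 2) • (T * T) := by
  have e : (r ^ 2) • (T * T) = cfc (fun s : ℝ => r ^ 2 * (s * s)) T := by
    rw [cfc_const_mul (r ^ 2) (fun s : ℝ => s * s) T (by fun_prop)]
    congr 1
    have := nc_cfc_mul hT (f := fun s : ℝ => s) (g := fun s : ℝ => s) (by fun_prop) (by fun_prop)
    rwa [nc_cfc_id hT] at this
  rw [bC_mul hr hT, e]
  refine nc_cfc_mono hT ((bf_cont hr).mul (bf_cont hr)) (by fun_prop) fun s hs => ?_
  calc bf r s * bf r s ≤ (r * s) * (r * s) := by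
        have := bf_nonneg hr hs
        have := bf_le hr hs
        gcongr
    _ = _ := by ring

theorem bC_eq {r : ℝ} (hr : 0 < r) {T : B} (hT : 0 ≤ T) :
    bC r T * (1 + r • T) = r • T ∧ (1 + r • T) * bC r T = r • T ∧ ∃ V, (1 + r • T) * V = 1 := by
  have e : (1 + r • T) = cfc (fun s : ℝ => 1 + r * s) T := by
    rw [cfc_const_add (1:ℝ) (fun s => r * s) T (by fun_prop), cfc_const_mul r (fun s : ℝ => s) T (by fun_prop), nc_cfc_id hT]
    simp
  have e2 : r • T = cfc (fun s : ℝ => r * s) T := by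
    rw [cfc_const_mul r (fun s : ℝ => s) T (by fun_prop), nc_cfc_id hT]
  refine ⟨?_, ?_, cfc (fun s : ℝ => (1 + r * s)⁻¹) T, ?_⟩
  · rw [e, e2, bC, nc_cfc_mul hT (bf_cont hr) (by fun_prop)]
    refine nc_cfc_congr hT fun s hs => ?_
    unfold bf
    have : 0 < 1 + r * s := by positivity
    field_simp
  · rw [e, e2, bC, nc_cfc_mul hT (by fun_prop) (bf_cont hr)]
    refine nc_cfc_congr hT fun s hs => ?_
    unfold bf
    have : 0 < 1 + r * s := by positivity
    field_simp
  · rw [e, nc_cfc_mul hT (by fun_prop), ← nc_cfc_one hT]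
    · refine nc_cfc_congr hT fun s hs => ?_
      have : 0 < 1 + r * s := by positivity
      field_simp
    · refine ContinuousOn.inv₀ (by fun_prop) fun s hs => ?_
      have : 0 ≤ s := hs
      positivity

theorem bC_intertwine {r : ℝ} (hr : 0 < r) (Y : B) :
    Y * bC r (star Y * Y) = bC r (Y * star Y) * Y := by
  obtain ⟨-, h2, V, hV⟩ := bC_eq hr (star_mul_self_nonneg Y)
  obtain ⟨h3, -, -⟩ := bC_eq hr (mul_star_self_nonneg Y)
  obtain ⟨h1, -, -⟩ := bC_eq hr (star_mul_self_nonneg Y)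
  have e : Y * bC r (star Y * Y) * (1 + r • (star Y * Y)) =
      bC r (Y * star Y) * Y * (1 + r • (star Y * Y)) := by
    rw [mul_assoc, h1, mul_assoc]
    have : Y * (1 + r • (star Y * Y)) = (1 + r • (Y * star Y)) * Y := by
      rw [mul_add, add_mul, mul_one, one_mul, mul_smul_comm, smul_mul_assoc, mul_assoc]
    rw [this, ← mul_assoc, h3, mul_smul_comm, smul_mul_assoc, mul_assoc]
  have := congrArg (· * V) e
  simpa only [mul_assoc, hV, mul_one] using this

/-- norm bound -/
theorem nc_Y_cfc (Y : B) {f : ℝ → ℝ} (hf : ContinuousOn f (Set.Ici 0)) {K : ℝ} (hK : 0 ≤ K)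
    (h : ∀ s, 0 ≤ s → s * (f s * f s) ≤ K ^ 2) : ‖Y * cfc f (star Y * Y)‖ ≤ K := by
  have hT := star_mul_self_nonneg Y
  have e : star (Y * cfc f (star Y * Y)) * (Y * cfc f (star Y * Y)) =
      cfc (fun s => s * (f s * f s)) (star Y * Y) := by
    rw [star_mul, nc_cfc_star, mul_assoc, ← mul_assoc (star Y)]
    nth_rw 2 [← nc_cfc_id hT]
    rw [nc_cfc_mul hT (by fun_prop) hf, nc_cfc_mul hT hf (by fun_prop)]
    refine nc_cfc_congr hT fun s hs => by ring
  have h2 : ‖star (Y * cfc f (star Y * Y)) * (Y * cfc f (star Y * Y))‖ ≤ K ^ 2 := by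
    rw [e]
    refine norm_cfc_le (by positivity) fun s hs => ?_
    have hs := nc_spec hT hs
    have hs' : 0 ≤ s := hs
    rw [Real.norm_of_nonneg (mul_nonneg hs' (mul_self_nonneg _))]
    exact h s hs
  rw [CStarRing.norm_star_mul_self, ← sq] at h2
  exact abs_le_of_sq_le_sq' h2 hK |>.2

theorem nc_slice {r : ℝ} (hr : 0 < r) (Y : B) : ∃ v : B, ‖v‖ ≤ 1 ∧
    Y * (bC r (star Y * Y) * bC r (star Y * Y) - bC (r / 4) (star Y * Y) * bC (r / 4) (star Y * Y))
     = (2 / √r) • (bC r (Y * star Y) * v * bC r (star Y * Y)) := by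
  have hT := star_mul_self_nonneg Y
  have hsr : 0 < √r := Real.sqrt_pos.2 hr
  have hr4 : 0 < r / 4 := by positivity
  refine ⟨(√r / 2) • (Y * cfc (gf r) (star Y * Y)), ?_, ?_⟩
  · rw [norm_smul, Real.norm_of_nonneg (by positivity)]
    have := nc_Y_cfc Y (gf_cont hr) (K := 2 / √r) (by positivity) (fun s hs => by
      rw [div_pow, Real.sq_sqrt hr.le, le_div_iff₀ hr]
      have := gf_bound hr hs
      linarith)
    calc _ ≤ √r / 2 * (2 / √r) := by gcongr
      _ = 1 := by field_simp
  · have e : bC r (star Y * Y) * bC r (star Y * Y) - bC (r / 4) (star Y * Y) * bC (r / 4) (star Y * Y)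
        = bC r (star Y * Y) * cfc (gf r) (star Y * Y) * bC r (star Y * Y) := by
      rw [bC_mul hr hT, bC_mul hr4 hT, ← cfc_sub (fun s => bf r s * bf r s) (fun s => bf (r / 4) s * bf (r / 4) s) _
        (((bf_cont hr).mul (bf_cont hr)).mono (nc_spec hT))
        (((bf_cont hr4).mul (bf_cont hr4)).mono (nc_spec hT))]
      rw [bC, nc_cfc_mul hT (bf_cont hr) (gf_cont hr),
        nc_cfc_mul (f := fun s => bf r s * gf r s) hT ((bf_cont hr).mul (gf_cont hr)) (bf_cont hr)]
      exact nc_cfc_congr hT fun s hs => bf_tele hr hs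
    rw [e, mul_smul_comm, smul_mul_assoc, smul_smul]
    have : 2 / √r * (√r / 2) = 1 := by field_simp
    rw [this, one_smul, ← mul_assoc, ← mul_assoc, bC_intertwine hr]
    simp only [mul_assoc]

theorem nc_slice_first (Y : B) :
    ‖Y * (1 - bC 1 (star Y * Y) * bC 1 (star Y * Y))‖ ≤ 1 := by
  have hT := star_mul_self_nonneg Y
  have hc := (bf_cont one_pos).mul (bf_cont one_pos)
  have e : 1 - bC 1 (star Y * Y) * bC 1 (star Y * Y) =
      cfc (fun s => 1 - bf 1 s * bf 1 s) (star Y * Y) := by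
    rw [bC_mul one_pos hT, cfc_sub (fun _ : ℝ => (1:ℝ)) (fun s => bf 1 s * bf 1 s) _ continuousOn_const (hc.mono (nc_spec hT)), nc_cfc_one hT]
  rw [e]
  refine nc_Y_cfc Y (continuousOn_const.sub hc) zero_le_one fun s hs => ?_
  rw [one_pow]
  exact b1_bound hs

end slices

end ncPart6

section ncPart7
open scoped ComplexConjugate InnerProductSpace
open Topology Filter

section final
variable {A : Type*} [CStarAlgebra A] [PartialOrder A] [StarOrderedRing A]
variable {B : Type*} [CStarAlgebra B] [PartialOrder B] [StarOrderedRing B]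
variable {I : Submodule ℂ A} {J : Submodule ℂ B} {M : A →L[ℂ] B →L[ℂ] ℂ}

theorem nc_bsum {Ω : Type*} [Fintype Ω] (T : Ω → B) (hT : ∀ w, 0 ≤ T w) {r m : ℝ} (hr : 0 < r)
    (h1 : ‖∑ w, T w * T w‖ ≤ Fintype.card Ω * m) :
    ‖∑ w, bC r (T w) * bC r (T w)‖ ≤ r ^ 2 * (Fintype.card Ω * m) := by
  have h2 : ∑ w, bC r (T w) * bC r (T w) ≤ (r ^ 2) • ∑ w, T w * T w := by
    rw [Finset.smul_sum]
    exact Finset.sum_le_sum fun w _ => bC_sq_le hr (hT w)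
  have h3 := nc_mono (Finset.sum_nonneg fun w _ => bC_sq_nonneg r (T w)) h2
  rw [norm_smul, Real.norm_of_nonneg (by positivity)] at h3
  exact h3.trans (mul_le_mul_of_nonneg_left h1 (by positivity))

theorem nc_step3a (D : NCData I J M) {Ω : Type*} [Fintype Ω] (X : Ω → A) (Y : Ω → B)
    (hX : ∀ w, X w ∈ I) (hX1 : ∀ w, ‖X w‖ ≤ 1) (hY : ∀ w, Y w ∈ J) {m : ℝ} (hm : 0 ≤ m)
    (h1 : ‖∑ w, star (Y w) * Y w * (star (Y w) * Y w)‖ ≤ Fintype.card Ω * m)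
    (h2 : ‖∑ w, Y w * star (Y w) * (Y w * star (Y w))‖ ≤ Fintype.card Ω * m)
    {r : ℝ} (hr : 0 < r) :
    ‖∑ w, M (X w) (Y w * (bC r (star (Y w) * Y w) * bC r (star (Y w) * Y w) -
      bC (r / 4) (star (Y w) * Y w) * bC (r / 4) (star (Y w) * Y w)))‖ ≤
      8 * (Fintype.card Ω) * (√r * √m) := by
  choose v hv hve using fun w => nc_slice hr (Y w)
  have hsr : 0 < √r := Real.sqrt_pos.2 hr
  have hJ : ∀ w, bC r (Y w * star (Y w)) * v w * bC r (star (Y w) * Y w) ∈ J := by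
    intro w
    have h := J.smul_mem ((((2 / √r)⁻¹ : ℝ)) : ℂ) (D.hJ _ (hY w)
      (bC r (star (Y w) * Y w) * bC r (star (Y w) * Y w) -
      bC (r / 4) (star (Y w) * Y w) * bC (r / 4) (star (Y w) * Y w)))
    rw [hve w, Complex.coe_smul, smul_smul, inv_mul_cancel₀ (by positivity), one_smul] at h
    exact h
  have hd := nc_dom D X hX hX1 v (fun w => bC r (Y w * star (Y w))) (fun w => bC r (star (Y w) * Y w))
    (fun w => bC r (star (Y w) * Y w) * bC r (star (Y w) * Y w))
    (fun w => bC r (Y w * star (Y w)) * bC r (Y w * star (Y w))) hJ hv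
    (fun w => bC_sq_nonneg _ _) (fun w => bC_sq_le_one hr (star_mul_self_nonneg _))
    (fun w => bC_sq_nonneg _ _) (fun w => bC_sq_le_one hr (mul_star_self_nonneg _))
    (fun w => by rw [bC_star]) (fun w => by rw [bC_star])
  have hb1 := nc_bsum (fun w => star (Y w) * Y w) (fun w => star_mul_self_nonneg _) hr h1
  have hb2 := nc_bsum (fun w => Y w * star (Y w)) (fun w => mul_star_self_nonneg _) hr h2
  set u : Ω → ℝ := fun w => ‖M (X w) (bC r (Y w * star (Y w)) * v w * bC r (star (Y w) * Y w))‖ with hu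
  have hd' : ∑ w, u w ^ 2 ≤ 16 * (r ^ 2 * (Fintype.card Ω * m)) := by
    refine hd.trans ?_
    linarith
  have hcs : (∑ w, u w) ^ 2 ≤ Fintype.card Ω * ∑ w, u w ^ 2 := by
    have := sq_sum_le_card_mul_sum_sq (s := Finset.univ) (f := u)
    simpa using this
  have hfin : ∑ w, u w ≤ 4 * r * Fintype.card Ω * √m := by
    refine abs_le_of_sq_le_sq' ?_ (by positivity) |>.2
    have : (4 * r * Fintype.card Ω * √m) ^ 2 = Fintype.card Ω * (16 * (r ^ 2 * (Fintype.card Ω * m))) := by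
      simp only [mul_pow, Real.sq_sqrt hm]; ring
    rw [this]
    exact hcs.trans (mul_le_mul_of_nonneg_left hd' (by positivity))
  calc _ ≤ ∑ w, (2 / √r) * u w := by
        refine (norm_sum_le _ _).trans (Finset.sum_le_sum fun w _ => ?_)
        rw [hve w, ← Complex.coe_smul, map_smul, norm_smul, Complex.norm_real,
          Real.norm_of_nonneg (by positivity)]
    _ = (2 / √r) * ∑ w, u w := by rw [Finset.mul_sum]
    _ ≤ (2 / √r) * (4 * r * Fintype.card Ω * √m) := by gcongr
    _ = 8 * (Fintype.card Ω) * (√r * √m) := by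
      have : r = √r * √r := (Real.mul_self_sqrt hr.le).symm
      rw [div_mul_eq_mul_div, div_eq_iff hsr.ne']
      nth_rw 1 [this]; ring

theorem nc_step3 (D : NCData I J M) {Ω : Type*} [Fintype Ω] (X : Ω → A) (Y : Ω → B)
    (hX : ∀ w, X w ∈ I) (hX1 : ∀ w, ‖X w‖ ≤ 1) (hY : ∀ w, Y w ∈ J) {m : ℝ} (hm : 0 ≤ m)
    (h1 : ‖∑ w, star (Y w) * Y w * (star (Y w) * Y w)‖ ≤ Fintype.card Ω * m)
    (h2 : ‖∑ w, Y w * star (Y w) * (Y w * star (Y w))‖ ≤ Fintype.card Ω * m) :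
    ‖∑ w, M (X w) (Y w)‖ ≤ Fintype.card Ω * (1 + 16 * √m) := by
  let b : ℕ → Ω → B := fun k w => bC ((1 / 4) ^ k) (star (Y w) * Y w) * bC ((1 / 4) ^ k) (star (Y w) * Y w)
  have hrp : ∀ k : ℕ, (0:ℝ) < (1 / 4) ^ k := fun k => by positivity
  have first : ‖∑ w, M (X w) (Y w * (1 - b 0 w))‖ ≤ Fintype.card Ω := by
    refine (norm_sum_le _ _).trans ?_
    calc _ ≤ ∑ w : Ω, (1:ℝ) := by
          refine Finset.sum_le_sum fun w _ => ?_
          refine (D.hM _ (hX w) _ (D.hJ _ (hY w) _)).trans ?_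
          refine mul_le_one₀ (hX1 w) (norm_nonneg _) ?_
          simpa [b] using nc_slice_first (Y w)
      _ = _ := by simp
  have mid : ∀ k, ‖∑ w, M (X w) (Y w * (b k w - b (k + 1) w))‖ ≤
      8 * Fintype.card Ω * √m * (1 / 2) ^ k := by
    intro k
    have := nc_step3a D X Y hX hX1 hY hm h1 h2 (hrp k)
    have e : √((1 / 4 : ℝ) ^ k) = (1 / 2) ^ k := by
      rw [Real.sqrt_eq_iff_eq_sq (by positivity) (by positivity), ← pow_mul, mul_comm, pow_mul]
      norm_num
    rw [e] at this
    have e2 : (1 / 4 : ℝ) ^ k / 4 = (1 / 4) ^ (k + 1) := by rw [pow_succ]; ring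
    rw [e2] at this
    simp only [b]
    linarith
  have last : ∀ k, ‖∑ w, M (X w) (Y w * b k w)‖ ≤
      ((1 / 4) ^ k) ^ 2 * ∑ w, ‖Y w‖ * ‖star (Y w) * Y w * (star (Y w) * Y w)‖ := by
    intro k
    rw [Finset.mul_sum]
    refine (norm_sum_le _ _).trans (Finset.sum_le_sum fun w _ => ?_)
    refine (D.hM _ (hX w) _ (D.hJ _ (hY w) _)).trans ?_
    have h3 := nc_mono (bC_sq_nonneg _ _) (bC_sq_le (hrp k) (star_mul_self_nonneg (Y w)))
    rw [norm_smul, Real.norm_of_nonneg (by positivity)] at h3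
    calc _ ≤ 1 * (‖Y w‖ * ‖b k w‖) := mul_le_mul (hX1 w) (norm_mul_le _ _) (norm_nonneg _) zero_le_one
      _ ≤ 1 * (‖Y w‖ * (((1 / 4) ^ k) ^ 2 * ‖star (Y w) * Y w * (star (Y w) * Y w)‖)) := by
        gcongr
      _ = _ := by ring
  have tele : ∀ k, ‖∑ w, M (X w) (Y w * (1 - b k w))‖ ≤
      Fintype.card Ω + 16 * Fintype.card Ω * √m * (1 - (1 / 2) ^ k) := by
    intro k
    induction k with
    | zero => simpa using first
    | succ k ih =>
      have e : ∑ w, M (X w) (Y w * (1 - b (k + 1) w)) =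
          ∑ w, M (X w) (Y w * (1 - b k w)) + ∑ w, M (X w) (Y w * (b k w - b (k + 1) w)) := by
        rw [← Finset.sum_add_distrib]
        refine Finset.sum_congr rfl fun w _ => ?_
        rw [← map_add, ← mul_add]; congr 2; abel
      rw [e]
      refine (norm_add_le _ _).trans ((add_le_add ih (mid k)).trans (le_of_eq ?_))
      rw [pow_succ]; ring
  have tot : ∀ k : ℕ, ‖∑ w, M (X w) (Y w)‖ ≤ Fintype.card Ω * (1 + 16 * √m) +
      ((1 / 4) ^ k) ^ 2 * ∑ w, ‖Y w‖ * ‖star (Y w) * Y w * (star (Y w) * Y w)‖ := by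
    intro k
    have e : ∑ w, M (X w) (Y w) =
          ∑ w, M (X w) (Y w * (1 - b k w)) + ∑ w, M (X w) (Y w * b k w) := by
      rw [← Finset.sum_add_distrib]
      refine Finset.sum_congr rfl fun w _ => ?_
      rw [← map_add, ← mul_add]; congr 1; simp
    rw [e]
    refine (norm_add_le _ _).trans (add_le_add ((tele k).trans ?_) (last k))
    have : 0 ≤ 16 * Fintype.card Ω * √m * (1 / 2) ^ k := by positivity
    linarith
  have hlim : Tendsto (fun k : ℕ => Fintype.card Ω * (1 + 16 * √m) +
      ((1 / 4 : ℝ) ^ k) ^ 2 * ∑ w, ‖Y w‖ * ‖star (Y w) * Y w * (star (Y w) * Y w)‖) atTop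
      (𝓝 (Fintype.card Ω * (1 + 16 * √m) +
      (0:ℝ) ^ 2 * ∑ w, ‖Y w‖ * ‖star (Y w) * Y w * (star (Y w) * Y w)‖)) := by
    have := tendsto_pow_atTop_nhds_zero_of_lt_one (r := (1 / 4 : ℝ)) (by norm_num) (by norm_num)
    exact tendsto_const_nhds.add ((this.pow 2).mul_const _)
  have := ge_of_tendsto' hlim tot
  simpa using this

theorem nc_step4a (D : NCData I J M) {ι : Type*} [Fintype ι] (x : ι → A) (y : ι → B)
    (hx : ∀ i, x i ∈ I) (hy : ∀ i, y i ∈ J) (hp : ncp y ≤ 2) :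
    ‖∑ i, M (x i) (y i)‖ ^ 2 ≤ 33 ^ 2 * ncp x := by
  classical
  set S := ncStd ι
  refine nc_lemA S I D.hI (fun i => M.flip (y i)) 33 (by norm_num) ?_ x hx
  intro F hF hF1
  have e : ∀ w, ∑ i, conj (S.z i w) * (M.flip (y i)) (F w) = M (F w) (S.cj.mix y w) := by
    intro w; simp [NCSigns.mix]
  simp only [e]
  have a1 := S.cj.fourth_norm y
  have a2 := S.cj.fourth_norm' y
  have hn := S.card_pos
  have b1 := norm_nonneg (∑ i, y i * star (y i))
  have b2 := norm_nonneg (∑ i, star (y i) * y i)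
  unfold ncp at hp
  have := nc_step3 D F (S.cj.mix y) hF hF1 (fun w => J.sum_mem fun i _ => J.smul_mem _ (hy i))
    (m := 4) (by norm_num) (a1.trans (mul_le_mul_of_nonneg_left (by nlinarith) hn.le))
    (a2.trans (mul_le_mul_of_nonneg_left (by nlinarith) hn.le))
  have e4 : √(4:ℝ) = 2 := by rw [show (4:ℝ) = 2 ^ 2 by norm_num, Real.sqrt_sq zero_le_two]
  rw [e4] at this
  norm_num at this ⊢
  exact this

theorem nc_step4 (D : NCData I J M) {ι : Type*} [Fintype ι] (x : ι → A) (y : ι → B)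
    (hx : ∀ i, x i ∈ I) (hy : ∀ i, y i ∈ J) :
    ‖∑ i, M (x i) (y i)‖ ^ 2 ≤ 33 ^ 2 * (ncp x * ncp y) := by
  rcases (ncp_nonneg y).eq_or_lt with h | h
  · have : ∀ i, y i = 0 := fun i => by
      have := nc_le_ncp y i
      rw [← h] at this
      exact norm_eq_zero.1 (pow_eq_zero_iff two_ne_zero |>.1 (le_antisymm this (by positivity)))
    simp [this, ← h]
  · set t := √(ncp y) with ht
    have ht0 : 0 < t := Real.sqrt_pos.2 h
    have ht2 : t ^ 2 = ncp y := Real.sq_sqrt h.le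
    have h1 : ncp (fun i => t⁻¹ • y i) ≤ 2 := by
      rw [ncp_smul, ← ht2, ← mul_pow, inv_mul_cancel₀ ht0.ne']; norm_num
    have := nc_step4a D x (fun i => t⁻¹ • y i) hx (fun i => by
      rw [← Complex.coe_smul]; exact J.smul_mem _ (hy i)) h1
    simp only [← Complex.coe_smul, map_smul, ← Finset.smul_sum] at this
    rw [norm_smul, Complex.norm_real, Real.norm_of_nonneg (by positivity), mul_pow, inv_pow, ht2,
      inv_mul_le_iff₀ h] at this
    linarith


end final

end ncPart7

section ncPart8
open scoped ComplexConjugate InnerProductSpace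
open Topology Filter

section final2
variable {A : Type*} [CStarAlgebra A] [PartialOrder A] [StarOrderedRing A]
variable {B : Type*} [CStarAlgebra B] [PartialOrder B] [StarOrderedRing B]
variable {I : Submodule ℂ A} {J : Submodule ℂ B} {M : A →L[ℂ] B →L[ℂ] ℂ}

theorem nc_step5 (D : NCData I J M) : ∀ (ι : Type) [Fintype ι] (x : ι → A) (y : ι → B),
    (∀ i, x i ∈ I) → (∀ i, y i ∈ J) → ‖∑ i, M (x i) (y i)‖ ^ 2 ≤ ncp x * ncp y := by
  let P : ℝ → Prop := fun κ => ∀ (ι : Type) [Fintype ι] (x : ι → A) (y : ι → B),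
    (∀ i, x i ∈ I) → (∀ i, y i ∈ J) → ‖∑ i, M (x i) (y i)‖ ^ 2 ≤ κ * (ncp x * ncp y)
  have main : P (1 ^ 2) := by
    refine nc_inf_trick P 1 zero_le_one ⟨33 ^ 2, by norm_num, ?_⟩ ?_ ?_ ?_
    · intro ι _ x y hx hy
      exact nc_step4 D x y hx hy
    · intro κ h ι _ x y hx hy
      have hc : Tendsto (fun ε : ℝ => (κ + ε) * (ncp x * ncp y)) (𝓝[>] 0)
          (𝓝 ((κ + 0) * (ncp x * ncp y))) := by
        have : Continuous (fun ε : ℝ => (κ + ε) * (ncp x * ncp y)) := by fun_prop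
        exact (this.tendsto 0).mono_left nhdsWithin_le_nhds
      have := ge_of_tendsto hc
        (by filter_upwards [self_mem_nhdsWithin] with δ hδ using h δ hδ ι x y hx hy)
      simpa using this
    · intro κ κ' h hk ι _ x y hx hy
      exact (h ι x y hx hy).trans
        (mul_le_mul_of_nonneg_right hk (mul_nonneg (ncp_nonneg x) (ncp_nonneg y)))
    · intro κ hκ h ι _ x y hx hy
      classical
      let S := ncStd ι
      let Ω := ι → ZMod 3
      have hn : 0 < (Fintype.card Ω : ℝ) := S.card_pos
      have hn' : (Fintype.card Ω : ℂ) ≠ 0 := S.card_ne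
      have hp := ncp_nonneg x
      have hq := ncp_nonneg y
      have key : ∀ δ > 0, ‖∑ i, M (x i) (y i)‖ ^ 2 ≤
          1 * √(κ * ((ncp x ^ 2 + δ * ncp x) * (ncp y ^ 2 + δ * ncp y))) := by
        intro δ hδ
        have hX : ∀ z w, ncPhi δ (S.mix x w) z ∈ I := fun z w =>
          D.hI _ (I.sum_mem fun i _ => I.smul_mem _ (hx i)) _
        have hY : ∀ z w, ncPhi δ (S.cj.mix y w) z ∈ J := fun z w =>
          D.hJ _ (J.sum_mem fun i _ => J.smul_mem _ (hy i)) _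
        let H : ℂ → ℂ := fun z => (Fintype.card Ω : ℂ)⁻¹ *
          ∑ w : Ω, M (ncPhi δ (S.mix x w) z) (ncPhi δ (S.cj.mix y w) z)
        have hH1 : H 1 = ∑ i, M (x i) (y i) := by
          simp only [H, ncPhi_one, NCSigns.mix, map_sum, map_smul, ContinuousLinearMap.sum_apply,
            ContinuousLinearMap.smul_apply, smul_eq_mul, NCSigns.cj_z]
          have e : ∀ i j, ∑ w : Ω, conj (S.z j w) * (S.z i w * M (x i) (y j)) =
              if j = i then (Fintype.card Ω : ℂ) * M (x i) (y j) else 0 := by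
            intro i j
            have := S.ortho j i
            calc _ = (∑ w : Ω, conj (S.z j w) * S.z i w) * M (x i) (y j) := by
                  rw [Finset.sum_mul]; exact Finset.sum_congr rfl fun w _ => by ring
              _ = _ := by rw [this, ite_mul, zero_mul]
          rw [inv_mul_eq_iff_eq_mul₀ hn', Finset.mul_sum]
          trans ∑ j, ∑ i, ∑ w : Ω, conj (S.z j w) * (S.z i w * M (x i) (y j))
          · rw [Finset.sum_comm]
            refine Finset.sum_congr rfl fun j _ => ?_
            simp only [Finset.mul_sum]
            rw [Finset.sum_comm]
          · simp only [e]
            simp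
        choose K hK using fun w => ncPhi_bdd δ (S.mix x w)
        choose K' hK' using fun w => ncPhi_bdd δ (S.cj.mix y w)
        rw [← hH1]
        refine nc_three H ?_ ((Fintype.card Ω : ℝ)⁻¹ * ∑ w : Ω, |K w| * |K' w|) 1 _ ?_ ?_ ?_
        · have hd : ∀ w, Differentiable ℂ (ncPhi δ (S.mix x w)) := fun w => ncPhi_diff _ _
          have hd' : ∀ w, Differentiable ℂ (ncPhi δ (S.cj.mix y w)) := fun w => ncPhi_diff _ _
          refine (differentiable_const _).mul (Differentiable.fun_sum fun w _ => ?_)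
          exact ((M.differentiable.comp (hd w))).clm_apply (hd' w)
        · intro z h0 h2
          simp only [H]
          rw [norm_mul, norm_inv, Complex.norm_natCast]
          refine mul_le_mul_of_nonneg_left ?_ (by positivity)
          refine (norm_sum_le _ _).trans (Finset.sum_le_sum fun w _ => ?_)
          refine (D.hM _ (hX z w) _ (hY z w)).trans ?_
          exact mul_le_mul ((hK w z h0 h2).trans (le_abs_self _))
            ((hK' w z h0 h2).trans (le_abs_self _)) (norm_nonneg _) (abs_nonneg _)
        · intro z hz
          simp only [H]
          rw [norm_mul, norm_inv, Complex.norm_natCast, inv_mul_le_iff₀ hn]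
          refine (norm_sum_le _ _).trans ?_
          refine (Finset.sum_le_card_nsmul _ _ 1 fun w _ => ?_).trans (by simp [Ω])
          refine (D.hM _ (hX z w) _ (hY z w)).trans ?_
          exact mul_le_one₀ (ncPhi_zero hδ _ z hz) (norm_nonneg _) (ncPhi_zero hδ _ z hz)
        · intro z hz
          refine Real.le_sqrt_of_sq_le ?_
          simp only [H]
          rw [norm_mul, norm_inv, Complex.norm_natCast, mul_pow, inv_pow,
            inv_mul_le_iff₀ (by positivity)]
          have h0 := h Ω (fun w => ncPhi δ (S.mix x w) z) (fun w => ncPhi δ (S.cj.mix y w) z)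
            (hX z) (hY z)
          have h1 := ncp_phi S x hδ z hz
          have h2 := ncp_phi S.cj y hδ z hz
          refine h0.trans ((mul_le_mul_of_nonneg_left
            (mul_le_mul h1 h2 (ncp_nonneg _) (by positivity)) hκ).trans (le_of_eq ?_))
          ring
      have hc : Tendsto (fun δ : ℝ => 1 * √(κ * ((ncp x ^ 2 + δ * ncp x) * (ncp y ^ 2 + δ * ncp y))))
          (𝓝[>] 0) (𝓝 (1 * √(κ * ((ncp x ^ 2 + 0 * ncp x) * (ncp y ^ 2 + 0 * ncp y))))) := by
        have : Continuous (fun δ : ℝ =>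
          1 * √(κ * ((ncp x ^ 2 + δ * ncp x) * (ncp y ^ 2 + δ * ncp y)))) := by fun_prop
        exact (this.tendsto 0).mono_left nhdsWithin_le_nhds
      have := ge_of_tendsto hc (by filter_upwards [self_mem_nhdsWithin] with δ hδ using key δ hδ)
      have e : κ * ((ncp x ^ 2 + 0 * ncp x) * (ncp y ^ 2 + 0 * ncp y)) =
          κ * (ncp x * ncp y) ^ 2 := by ring
      rwa [e, Real.sqrt_mul hκ, Real.sqrt_sq (by positivity), ← mul_assoc] at this
  intro ι _ x y hx hy
  have := main ι x y hx hy
  simpa using this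

end final2

end ncPart8

section ncPart9
open scoped ComplexConjugate InnerProductSpace
open Topology Filter

section unit
variable {A : Type*} [NonUnitalCStarAlgebra A] {B : Type*} [NonUnitalCStarAlgebra B]

noncomputable def ncSnd (A : Type*) [NonUnitalCStarAlgebra A] : Unitization ℂ A →L[ℂ] A where
  toFun x := x.snd
  map_add' _ _ := rfl
  map_smul' _ _ := rfl
  cont := Unitization.continuous_snd

noncomputable def ncKer (A : Type*) [NonUnitalCStarAlgebra A] : Submodule ℂ (Unitization ℂ A) where
  carrier := {x | x.fst = 0}
  add_mem' {x y} hx hy := by simp_all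
  zero_mem' := by simp
  smul_mem' c x hx := by simp_all

theorem ncKer_norm (x : Unitization ℂ A) (hx : x ∈ ncKer A) : ‖ncSnd A x‖ = ‖x‖ := by
  have : x = (x.snd : Unitization ℂ A) := by
    ext
    · exact (show x.fst = 0 from hx)
    · simp
  conv_rhs => rw [this]
  rw [Unitization.norm_inr]; rfl

theorem nc_ncp_inr {N : ℕ} (x : Fin N → A) :
    ncp (fun i => (x i : Unitization ℂ A)) =
      ‖∑ i, x i * star (x i)‖ + ‖∑ i, star (x i) * x i‖ := by
  have h : ∀ f : Fin N → A, ‖∑ i, (f i : Unitization ℂ A)‖ = ‖∑ i, f i‖ := by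
    intro f
    rw [← Unitization.norm_inr (𝕜 := ℂ) (∑ i, f i)]
    congr 1
    exact (map_sum (Unitization.inrNonUnitalAlgHom ℂ A) f _).symm
  unfold ncp
  simp only [← Unitization.inr_star, ← Unitization.inr_mul, h]

theorem nc_main (M : A →ₗ[ℂ] B →ₗ[ℂ] ℂ) (hM : ∀ (x : A) (y : B), ‖M x y‖ ≤ ‖x‖ * ‖y‖)
    (N : ℕ) (x : Fin N → A) (y : Fin N → B)
    (hx : ‖∑ i, x i * star (x i)‖ + ‖∑ i, star (x i) * x i‖ ≤ 2)
    (hy : ‖∑ i, y i * star (y i)‖ + ‖∑ i, star (y i) * y i‖ ≤ 2) :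
    ‖∑ i, M (x i) (y i)‖ ≤ 2 := by
  letI := CStarAlgebra.spectralOrder (Unitization ℂ A)
  letI := CStarAlgebra.spectralOrder (Unitization ℂ B)
  haveI := CStarAlgebra.spectralOrderedRing (Unitization ℂ A)
  haveI := CStarAlgebra.spectralOrderedRing (Unitization ℂ B)
  let M1 : A →L[ℂ] B →L[ℂ] ℂ := LinearMap.mkContinuous₂ M 1 (by simpa using hM)
  let M2 : Unitization ℂ A →L[ℂ] Unitization ℂ B →L[ℂ] ℂ := M1.bilinearComp (ncSnd A) (ncSnd B)
  have hM2 : ∀ a b, M2 a b = M (ncSnd A a) (ncSnd B b) := fun a b => rfl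
  have D : NCData (ncKer A) (ncKer B) M2 := {
    hI := by
      intro x hx a
      have : x.fst = 0 := hx
      show (x * a).fst = 0
      simp [this]
    hJ := by
      intro x hx a
      have : x.fst = 0 := hx
      show (x * a).fst = 0
      simp [this]
    hJ' := by
      intro x hx a
      have : x.fst = 0 := hx
      show (a * x).fst = 0
      simp [this]
    hM := by
      intro x hx y hy
      rw [hM2, ← ncKer_norm x hx, ← ncKer_norm y hy]
      exact hM _ _ }
  have h := nc_step5 D (Fin N) (fun i => (x i : Unitization ℂ A)) (fun i => (y i : Unitization ℂ B))
    (fun i => Unitization.fst_inr _ _) (fun i => Unitization.fst_inr _ _)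
  rw [nc_ncp_inr, nc_ncp_inr] at h
  have h2 : ‖∑ i, M (x i) (y i)‖ ^ 2 ≤ 2 * 2 :=
    h.trans (mul_le_mul hx hy (by positivity) zero_le_two)
  nlinarith [norm_nonneg (∑ i, M (x i) (y i))]

end unit

end ncPart9


/-- non-commutative Grothendieck inequality: if `M` is a bilinear form of
norm at most one on a pair of C*-algebras, then for all finite sequences `(xᵢ)`, `(yᵢ)`
with `‖Σ xᵢxᵢ*‖ + ‖Σ xᵢ*xᵢ‖ ≤ 2` and `‖Σ yᵢyᵢ*‖ + ‖Σ yᵢ*yᵢ‖ ≤ 2`, one has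
`|Σᵢ M(xᵢ, yᵢ)| ≤ 2`. -/
theorem stmt8
    {A B : Type*}
    [NonUnitalNormedRing A] [StarRing A] [CStarRing A] [CompleteSpace A]
    [NormedSpace ℂ A] [IsScalarTower ℂ A A] [SMulCommClass ℂ A A] [StarModule ℂ A]
    [NonUnitalNormedRing B] [StarRing B] [CStarRing B] [CompleteSpace B]
    [NormedSpace ℂ B] [IsScalarTower ℂ B B] [SMulCommClass ℂ B B] [StarModule ℂ B]
    (M : A →ₗ[ℂ] B →ₗ[ℂ] ℂ)
    (hM : ∀ (x : A) (y : B), ‖M x y‖ ≤ ‖x‖ * ‖y‖) :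
    ∀ (N : ℕ) (x : Fin N → A) (y : Fin N → B),
      ‖∑ i, x i * star (x i)‖ + ‖∑ i, star (x i) * x i‖ ≤ 2 →
      ‖∑ i, y i * star (y i)‖ + ‖∑ i, star (y i) * y i‖ ≤ 2 →
      ‖∑ i, M (x i) (y i)‖ ≤ 2 := by
  letI : NonUnitalCStarAlgebra A := {}
  letI : NonUnitalCStarAlgebra B := {}
  intro N x y hx hy
  exact nc_main M hM N x y hx hy
end

section
/- (Large violations not attainable with maximally entangled states.) There exist a universal constant C > 0 and, for every integer n ≥ 2, a Bell functional M with 2^{n²} inputs and n outputs per party such that ω*_n(M) ≥ √n / log n while ω^{me}(M) ≤ C, where ω^{me}(M) is the supremum of the value over strategies using a maximally entangled state of any finite dimension. -/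
open scoped ComplexOrder

/-- The quantum value of the Bell functional `M`, restricted to strategies using a
state of local dimension at most `d` (with arbitrary POVM measurements). -/
noncomputable def bellQValDim {nx ny na nb : ℕ} (d : ℕ)
    (M : Fin nx → Fin ny → Fin na → Fin nb → ℝ) : ℝ :=
  sSup {r : ℝ | ∃ (k : ℕ) (ψ : Fin k × Fin k → ℂ)
      (A : Fin nx → Fin na → Matrix (Fin k) (Fin k) ℂ)
      (B : Fin ny → Fin nb → Matrix (Fin k) (Fin k) ℂ),
    1 ≤ k ∧ k ≤ d ∧ (∑ p, norm (ψ p) ^ 2 = 1) ∧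
    (∀ x a, (A x a).PosSemidef) ∧ (∀ x, ∑ a, A x a = 1) ∧
    (∀ y b, (B y b).PosSemidef) ∧ (∀ y, ∑ b, B y b = 1) ∧
    r = norm (∑ x, ∑ y, ∑ a, ∑ b, (M x y a b : ℂ) *
          ∑ p : Fin k × Fin k, ∑ q : Fin k × Fin k,
            (starRingEnd ℂ) (ψ p) * (A x a p.1 q.1 * B y b p.2 q.2) * ψ q)}

/-- The quantum value of the Bell functional `M`, restricted to strategies using a
maximally entangled state `ψ_k = k^{-1/2} Σ_i |i⟩|i⟩` of arbitrary finite dimension. -/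
noncomputable def bellMEVal {nx ny na nb : ℕ}
    (M : Fin nx → Fin ny → Fin na → Fin nb → ℝ) : ℝ :=
  sSup {r : ℝ | ∃ (k : ℕ)
      (A : Fin nx → Fin na → Matrix (Fin k) (Fin k) ℂ)
      (B : Fin ny → Fin nb → Matrix (Fin k) (Fin k) ℂ),
    1 ≤ k ∧
    (∀ x a, (A x a).PosSemidef) ∧ (∀ x, ∑ a, A x a = 1) ∧
    (∀ y b, (B y b).PosSemidef) ∧ (∀ y, ∑ b, B y b = 1) ∧
    r = norm (∑ x, ∑ y, ∑ a, ∑ b, (M x y a b : ℂ) *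
          ∑ p : Fin k × Fin k, ∑ q : Fin k × Fin k,
            (starRingEnd ℂ) (if p.1 = p.2 then (((Real.sqrt k)⁻¹ : ℝ) : ℂ) else 0) *
              (A x a p.1 q.1 * B y b p.2 q.2) *
              (if q.1 = q.2 then (((Real.sqrt k)⁻¹ : ℝ) : ℂ) else 0))}

section blMain

open Matrix


lemma bl_diag {ι : Type*} [Fintype ι] [DecidableEq ι] {A : Matrix ι ι ℂ} (hA : A.IsHermitian) :
    ∃ (U : Matrix ι ι ℂ) (s : ι → ℝ), U * Uᴴ = 1 ∧ Uᴴ * U = 1 ∧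
      A = U * diagonal (fun i => (s i : ℂ)) * Uᴴ := by
  refine ⟨hA.eigenvectorUnitary, hA.eigenvalues, ?_, ?_, ?_⟩
  · exact Unitary.mul_star_self_of_mem hA.eigenvectorUnitary.2
  · exact Unitary.star_mul_self_of_mem hA.eigenvectorUnitary.2
  · have := hA.spectral_theorem
    rw [Unitary.conjStarAlgAut_apply] at this
    exact this

lemma bl_pow {ι : Type*} [Fintype ι] [DecidableEq ι] {A U : Matrix ι ι ℂ} {s : ι → ℝ}
    (h1 : U * Uᴴ = 1) (h2 : Uᴴ * U = 1) (h : A = U * diagonal (fun i => (s i : ℂ)) * Uᴴ) (q : ℕ) :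
    A ^ q = U * diagonal (fun i => ((s i ^ q : ℝ) : ℂ)) * Uᴴ := by
  induction q with
  | zero => simp [h1]
  | succ q ih =>
    have : A ^ q * A = U * diagonal (fun i => ((s i ^ q : ℝ) : ℂ)) * (Uᴴ * U) *
        diagonal (fun i => (s i : ℂ)) * Uᴴ := by
      rw [ih, h]; simp only [Matrix.mul_assoc]
    rw [pow_succ, this, h2, Matrix.mul_one, Matrix.mul_assoc U, diagonal_mul_diagonal]
    simp [pow_succ]

/-- `tr (A H^q)` for `A` psd. -/
lemma bl_spec1 {ι : Type*} [Fintype ι] [DecidableEq ι] {A H : Matrix ι ι ℂ} (hA : A.PosSemidef)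
    (hH : H.IsHermitian) : ∃ (w s : ι → ℝ), (∀ i, 0 ≤ w i) ∧
      ∀ q, (A * H ^ q).trace.re = ∑ i, w i * s i ^ q := by
  obtain ⟨U, s, h1, h2, h⟩ := bl_diag hH
  refine ⟨fun i => ((Uᴴ * A * U) i i).re, s, fun i => ?_, fun q => ?_⟩
  · have := (hA.conjTranspose_mul_mul_same U).diag_nonneg (i := i)
    exact (Complex.le_def.1 this).1
  · rw [bl_pow h1 h2 h q, ← Matrix.mul_assoc, ← Matrix.mul_assoc, Matrix.trace_mul_comm,
      ← Matrix.mul_assoc, ← Matrix.mul_assoc]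
    simp only [Matrix.trace, Matrix.diag, Matrix.mul_diagonal, Complex.re_sum,
      Complex.re_mul_ofReal]

/-- `tr (H A^q H B^s)`. -/
lemma bl_spec2 {ι : Type*} [Fintype ι] [DecidableEq ι] {A B H : Matrix ι ι ℂ} (hA : A.IsHermitian)
    (hB : B.IsHermitian) (hH : H.IsHermitian) :
    ∃ (w : ι → ι → ℝ) (α β : ι → ℝ), (∀ i j, 0 ≤ w i j) ∧
      ∀ q s, (H * A ^ q * H * B ^ s).trace.re = ∑ i, ∑ j, w i j * (α i ^ q * β j ^ s) := by
  obtain ⟨U, α, h1, h2, h⟩ := bl_diag hA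
  obtain ⟨V, β, h1', h2', h'⟩ := bl_diag hB
  refine ⟨fun i j => ‖(Uᴴ * H * V) i j‖ ^ 2, α, β, fun i j => by positivity, fun q s => ?_⟩
  rw [bl_pow h1 h2 h q, bl_pow h1' h2' h' s]
  have e : H * (U * diagonal (fun i => ((α i ^ q : ℝ) : ℂ)) * Uᴴ) * H *
      (V * diagonal (fun i => ((β i ^ s : ℝ) : ℂ)) * Vᴴ)
      = (H * U * diagonal (fun i => ((α i ^ q : ℝ) : ℂ))) * ((Uᴴ * H * V) *
        diagonal (fun i => ((β i ^ s : ℝ) : ℂ)) * Vᴴ) := by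
    simp only [Matrix.mul_assoc]
  have e2 : ((Uᴴ * H * V) * diagonal (fun i => ((β i ^ s : ℝ) : ℂ)) * Vᴴ) *
      (H * U * diagonal (fun i => ((α i ^ q : ℝ) : ℂ))) =
      ((Uᴴ * H * V) * diagonal (fun i => ((β i ^ s : ℝ) : ℂ))) * ((Uᴴ * H * V)ᴴ *
        diagonal (fun i => ((α i ^ q : ℝ) : ℂ))) := by
    simp only [Matrix.mul_assoc, conjTranspose_mul, conjTranspose_conjTranspose, hH.eq]
  rw [e, Matrix.trace_mul_comm, e2]
  simp only [Matrix.trace, Matrix.diag]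
  rw [Complex.re_sum]
  refine Finset.sum_congr rfl fun i _ => ?_
  rw [Matrix.mul_apply, Complex.re_sum]
  refine Finset.sum_congr rfl fun j _ => ?_
  rw [Matrix.mul_diagonal, Matrix.mul_diagonal, conjTranspose_apply]
  generalize (Uᴴ * H * V) i j = z
  have : z * ((β j ^ s : ℝ) : ℂ) * (star z * ((α i ^ q : ℝ) : ℂ)) =
      (z * star z) * ((α i ^ q * β j ^ s : ℝ) : ℂ) := by push_cast; ring
  rw [this, Complex.re_mul_ofReal]
  congr 1
  have := Complex.mul_conj' z
  rw [Complex.star_def, this]; norm_cast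

lemma bl_scalar (a b : ℝ) (r q : ℕ) (hr : Even r) (hq : q ≤ r) :
    a ^ q * b ^ (r - q) + a ^ (r - q) * b ^ q ≤ a ^ r + b ^ r := by
  have h1 : a ^ q * b ^ (r - q) ≤ |a| ^ q * |b| ^ (r - q) := by
    rw [← abs_pow, ← abs_pow, ← abs_mul]; exact le_abs_self _
  have h2 : a ^ (r - q) * b ^ q ≤ |a| ^ (r - q) * |b| ^ q := by
    rw [← abs_pow, ← abs_pow, ← abs_mul]; exact le_abs_self _
  have h3 : a ^ r = |a| ^ q * |a| ^ (r - q) := by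
    rw [← pow_add, Nat.add_sub_cancel' hq, hr.pow_abs]
  have h4 : b ^ r = |b| ^ q * |b| ^ (r - q) := by
    rw [← pow_add, Nat.add_sub_cancel' hq, hr.pow_abs]
  have h5 : 0 ≤ (|a| ^ q - |b| ^ q) * (|a| ^ (r - q) - |b| ^ (r - q)) := by
    rcases le_total |a| |b| with h | h
    · exact mul_nonneg_of_nonpos_of_nonpos (sub_nonpos.2 (by gcongr)) (sub_nonpos.2 (by gcongr))
    · exact mul_nonneg (sub_nonneg.2 (by gcongr)) (sub_nonneg.2 (by gcongr))
  rw [h3, h4]; linarith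

lemma bl_scalar_sum (a b : ℝ) (r : ℕ) (hr : Even r) :
    ∑ q ∈ Finset.range (r + 1), a ^ q * b ^ (r - q) ≤ (r + 1) / 2 * (a ^ r + b ^ r) := by
  have h1 : ∑ q ∈ Finset.range (r + 1), a ^ q * b ^ (r - q)
      = ∑ q ∈ Finset.range (r + 1), a ^ (r - q) * b ^ q := by
    rw [← Finset.sum_range_reflect]
    refine Finset.sum_congr rfl fun q hq => ?_
    have : q ≤ r := by simpa [Nat.lt_succ_iff] using hq
    congr 2 <;> omega
  have h2 : ∑ q ∈ Finset.range (r + 1), (a ^ q * b ^ (r - q) + a ^ (r - q) * b ^ q) ≤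
      ∑ q ∈ Finset.range (r + 1), (a ^ r + b ^ r) :=
    Finset.sum_le_sum fun q hq => bl_scalar a b r q hr (by simpa [Nat.lt_succ_iff] using hq)
  rw [Finset.sum_add_distrib, ← h1] at h2
  simp at h2
  linarith

lemma bl_trace_ineq {ι : Type*} [Fintype ι] [DecidableEq ι] {A B H : Matrix ι ι ℂ}
    (hA : A.IsHermitian) (hB : B.IsHermitian) (hH : H.IsHermitian) (r : ℕ) (hr : Even r) :
    ∑ q ∈ Finset.range (r + 1), (H * A ^ q * H * B ^ (r - q)).trace.re ≤
      (r + 1) / 2 * ((H * H * A ^ r).trace.re + (H * H * B ^ r).trace.re) := by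
  obtain ⟨w, α, β, hw, h⟩ := bl_spec2 hA hB hH
  have e1 : (H * H * A ^ r).trace.re = ∑ i, ∑ j, w i j * α i ^ r := by
    have := h r 0
    simp only [pow_zero, mul_one] at this
    rw [← this, Matrix.trace_mul_cycle, Matrix.trace_mul_cycle]
  have e2 : (H * H * B ^ r).trace.re = ∑ i, ∑ j, w i j * β j ^ r := by
    have := h 0 r
    simp only [pow_zero, Matrix.mul_one, one_mul] at this
    exact this
  rw [e1, e2, Finset.sum_congr rfl fun q _ => h q (r - q), Finset.sum_comm,
    ← Finset.sum_add_distrib, Finset.mul_sum]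
  refine Finset.sum_le_sum fun i _ => ?_
  rw [Finset.sum_comm, ← Finset.sum_add_distrib, Finset.mul_sum]
  refine Finset.sum_le_sum fun j _ => ?_
  rw [← Finset.mul_sum]
  nlinarith [mul_le_mul_of_nonneg_left (bl_scalar_sum (α i) (β j) r hr) (hw i j)]

lemma bl_telescope {R : Type*} [Ring R] (x y : R) (r : ℕ) :
    x ^ r - y ^ r = ∑ q ∈ Finset.range r, x ^ q * (x - y) * y ^ (r - 1 - q) := by
  induction r with
  | zero => simp
  | succ r ih =>
    rw [Finset.sum_range_succ]
    have : ∑ q ∈ Finset.range r, x ^ q * (x - y) * y ^ (r + 1 - 1 - q) = (x ^ r - y ^ r) * y := by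
      rw [ih, Finset.sum_mul]
      refine Finset.sum_congr rfl fun q hq => ?_
      have : q < r := by simpa using hq
      have e : r + 1 - 1 - q = (r - 1 - q) + 1 := by omega
      rw [e, pow_succ, ← mul_assoc]
    rw [this]; simp [pow_succ]; noncomm_ring

def blSg (b : Bool) : ℝ := if b then 1 else -1

lemma blSg_sq (b : Bool) : blSg b * blSg b = 1 := by cases b <;> simp [blSg]

def blFlip {κ : Type*} [DecidableEq κ] (k : κ) (x : κ → Bool) : κ → Bool :=
  Function.update x k (!x k)

lemma blFlip_invol {κ : Type*} [DecidableEq κ] (k : κ) : Function.Involutive (blFlip k) := by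
  intro x; funext l
  by_cases h : l = k
  · subst h; simp [blFlip]
  · simp [blFlip, h]

lemma blFlip_sum {κ : Type*} [Fintype κ] [DecidableEq κ] (k : κ) (f : (κ → Bool) → ℝ) :
    ∑ x, f (blFlip k x) = ∑ x, f x :=
  Equiv.sum_comp (blFlip_invol k).toPerm f

/-- Rademacher sum with matrix coefficients. -/
noncomputable def blRad {κ ι : Type*} [Fintype κ] (H : κ → Matrix ι ι ℂ) (x : κ → Bool) :
    Matrix ι ι ℂ := ∑ k, blSg (x k) • H k

lemma blRad_herm {κ ι : Type*} [Fintype κ] {H : κ → Matrix ι ι ℂ}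
    (hH : ∀ k, (H k).IsHermitian) (x : κ → Bool) : (blRad H x).IsHermitian := by
  simp only [blRad, Matrix.IsHermitian, conjTranspose_sum, conjTranspose_smul, (hH _).eq,
    star_trivial]

lemma blRad_flip {κ ι : Type*} [Fintype κ] [DecidableEq κ] (H : κ → Matrix ι ι ℂ) (x : κ → Bool)
    (k : κ) : blRad H x - blRad H (blFlip k x) = (2 * blSg (x k)) • H k := by
  simp only [blRad]
  rw [← Finset.sum_sub_distrib, Finset.sum_eq_single k]
  · rw [← sub_smul]; congr 1
    simp only [blFlip, Function.update_self]
    cases x k <;> simp [blSg] <;> norm_num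
  · intro l _ hl
    simp [blFlip, hl]
  · simp

lemma bl_re_smul {ι : Type*} [Fintype ι] (r : ℝ) (M : Matrix ι ι ℂ) :
    (r • M).trace.re = r * M.trace.re := by
  rw [trace_smul, Complex.smul_re, smul_eq_mul]

lemma bl_khin_step {κ ι : Type*} [Fintype κ] [DecidableEq κ] [Fintype ι] [DecidableEq ι]
    {H : κ → Matrix ι ι ℂ} (hH : ∀ k, (H k).IsHermitian) {c : ℝ}
    (hS : (c • (1 : Matrix ι ι ℂ) - ∑ k, H k * H k).PosSemidef) (p : ℕ) :
    ∑ x, (blRad H x ^ (2 * (p + 1))).trace.re ≤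
      (2 * p + 1) * c * ∑ x, (blRad H x ^ (2 * p)).trace.re := by
  have h1 : ∀ x, (blRad H x ^ (2 * (p + 1))).trace.re =
      ∑ k, blSg (x k) * (H k * blRad H x ^ (2 * p + 1)).trace.re := by
    intro x
    have : blRad H x ^ (2 * (p + 1)) = blRad H x * blRad H x ^ (2 * p + 1) := by
      rw [← pow_succ']; congr 1
    rw [this]
    conv_lhs => rw [blRad, Finset.sum_mul, trace_sum, Complex.re_sum]
    refine Finset.sum_congr rfl fun k _ => ?_
    rw [smul_mul_assoc, bl_re_smul]; rfl
  have h2 : ∀ k, ∑ x, blSg (x k) * (H k * blRad H x ^ (2 * p + 1)).trace.re ≤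
      (2 * p + 1) * ∑ x, (H k * H k * blRad H x ^ (2 * p)).trace.re := by
    intro k
    have e1 : ∑ x, blSg (x k) * (H k * blRad H x ^ (2 * p + 1)).trace.re =
        ∑ x, - blSg (x k) * (H k * blRad H (blFlip k x) ^ (2 * p + 1)).trace.re := by
      rw [← blFlip_sum k]
      refine Finset.sum_congr rfl fun x _ => ?_
      congr 1
      simp only [blFlip, Function.update_self]
      cases x k <;> simp [blSg]
    have e2 : ∀ x, blSg (x k) * (H k * blRad H x ^ (2 * p + 1)).trace.re +
        - blSg (x k) * (H k * blRad H (blFlip k x) ^ (2 * p + 1)).trace.re =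
        2 * ∑ q ∈ Finset.range (2 * p + 1),
          (H k * blRad H x ^ q * H k * blRad H (blFlip k x) ^ (2 * p - q)).trace.re := by
      intro x
      have : H k * blRad H x ^ (2 * p + 1) - H k * blRad H (blFlip k x) ^ (2 * p + 1) =
          (2 * blSg (x k)) • ∑ q ∈ Finset.range (2 * p + 1),
          (H k * blRad H x ^ q * H k * blRad H (blFlip k x) ^ (2 * p - q)) := by
        rw [← mul_sub, bl_telescope, blRad_flip, Finset.mul_sum, Finset.smul_sum]
        refine Finset.sum_congr rfl fun q _ => ?_
        simp only [mul_smul_comm, smul_mul_assoc, Matrix.mul_assoc, Nat.add_sub_cancel]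
      have h := congrArg (fun M => M.trace.re) this
      simp only [trace_sub, Complex.sub_re] at h
      rw [bl_re_smul, trace_sum, Complex.re_sum] at h
      have := blSg_sq (x k)
      linear_combination blSg (x k) * h + 2 * (∑ q ∈ Finset.range (2 * p + 1),
          (H k * blRad H x ^ q * H k * blRad H (blFlip k x) ^ (2 * p - q)).trace.re) * this
    have e3 : 2 * ∑ x, blSg (x k) * (H k * blRad H x ^ (2 * p + 1)).trace.re ≤
        ∑ x, ((2 * p + 1) * ((H k * H k * blRad H x ^ (2 * p)).trace.re +
          (H k * H k * blRad H (blFlip k x) ^ (2 * p)).trace.re)) := by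
      rw [two_mul]
      nth_rewrite 2 [e1]
      rw [← Finset.sum_add_distrib]
      refine Finset.sum_le_sum fun x _ => ?_
      rw [e2]
      have := bl_trace_ineq (blRad_herm hH x) (blRad_herm hH (blFlip k x)) (hH k) (2 * p)
        (even_two_mul p)
      push_cast at this
      linarith
    rw [← Finset.mul_sum, Finset.sum_add_distrib,
      blFlip_sum k (fun x => (H k * H k * blRad H x ^ (2 * p)).trace.re)] at e3
    linarith
  calc ∑ x, (blRad H x ^ (2 * (p + 1))).trace.re
      = ∑ k, ∑ x, blSg (x k) * (H k * blRad H x ^ (2 * p + 1)).trace.re := by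
        rw [Finset.sum_congr rfl fun x _ => h1 x, Finset.sum_comm]
    _ ≤ ∑ k, (2 * p + 1) * ∑ x, (H k * H k * blRad H x ^ (2 * p)).trace.re :=
        Finset.sum_le_sum fun k _ => h2 k
    _ = (2 * p + 1) * ∑ x, ((∑ k, H k * H k) * blRad H x ^ (2 * p)).trace.re := by
        rw [← Finset.mul_sum, Finset.sum_comm]
        congr 1
        refine Finset.sum_congr rfl fun x _ => ?_
        rw [Finset.sum_mul, trace_sum, Complex.re_sum]
    _ ≤ (2 * p + 1) * ∑ x, c * (blRad H x ^ (2 * p)).trace.re := by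
        gcongr with x
        obtain ⟨w, s, hw, h⟩ := bl_spec1 hS (blRad_herm hH x)
        have h' := h (2 * p)
        have : 0 ≤ ∑ i, w i * s i ^ (2 * p) :=
          Finset.sum_nonneg fun i _ => mul_nonneg (hw i) ((even_two_mul p).pow_nonneg _)
        rw [← h', sub_mul, trace_sub, Complex.sub_re, smul_mul_assoc, one_mul, bl_re_smul] at this
        linarith
    _ = _ := by rw [← Finset.mul_sum]; ring

lemma bl_khin {κ ι : Type*} [Fintype κ] [DecidableEq κ] [Fintype ι] [DecidableEq ι]
    {H : κ → Matrix ι ι ℂ} (hH : ∀ k, (H k).IsHermitian)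
    (hS : ((4 : ℝ) • (1 : Matrix ι ι ℂ) - ∑ k, H k * H k).PosSemidef) (p q : ℕ) (hq : q ≤ p) :
    ∑ x, (blRad H x ^ (2 * q)).trace.re ≤
      (8 * p : ℝ) ^ q * (Fintype.card (κ → Bool) * Fintype.card ι) := by
  induction q with
  | zero => simp
  | succ q ih =>
    have h0 : (0 : ℝ) ≤ (8 * p : ℝ) ^ q * (Fintype.card (κ → Bool) * Fintype.card ι) := by positivity
    have hqp : (q : ℝ) + 1 ≤ p := by exact_mod_cast hq
    calc _ ≤ (2 * q + 1) * 4 * ∑ x, (blRad H x ^ (2 * q)).trace.re := bl_khin_step hH hS q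
      _ ≤ (2 * q + 1) * 4 * ((8 * p : ℝ) ^ q * (Fintype.card (κ → Bool) * Fintype.card ι)) := by
        gcongr; exact ih (by omega)
      _ ≤ (8 * p) * ((8 * p : ℝ) ^ q * (Fintype.card (κ → Bool) * Fintype.card ι)) := by
        exact mul_le_mul_of_nonneg_right (by linarith) h0
      _ = _ := by ring

/-- The maximal inequality: a POVM tested against squares of Rademacher sums. -/
lemma bl_max {κ ι α : Type*} [Fintype κ] [DecidableEq κ] [Fintype ι] [DecidableEq ι] [Fintype α]
    {c : κ → α → ℝ} (hc : ∀ k a, c k a ^ 2 ≤ 1)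
    {H : κ → Matrix ι ι ℂ} (hH : ∀ k, (H k).IsHermitian)
    (hS : ((4 : ℝ) • (1 : Matrix ι ι ℂ) - ∑ k, H k * H k).PosSemidef) (p : ℕ) (hp : 1 ≤ p)
    (hα : Fintype.card α ≤ 2 ^ p)
    (A : (κ → Bool) → α → Matrix ι ι ℂ) (hA : ∀ x a, (A x a).PosSemidef)
    (hA1 : ∀ x, ∑ a, A x a = 1) :
    ∑ x, ∑ a, (A x a * blRad (fun k => c k a • H k) x ^ 2).trace.re ≤
      32 * p * (Fintype.card (κ → Bool) * Fintype.card ι) := by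
  set N : ℝ := (Fintype.card (κ → Bool) * Fintype.card ι) with hN
  have hN0 : 0 ≤ N := by positivity
  have hp0 : (1 : ℝ) ≤ p := by exact_mod_cast hp
  have hHa : ∀ a k, (c k a • H k).IsHermitian := fun a k => by
    simp only [Matrix.IsHermitian, conjTranspose_smul, (hH _).eq, star_trivial]
  have hSa : ∀ a, ((4 : ℝ) • (1 : Matrix ι ι ℂ) -
      ∑ k, (c k a • H k) * (c k a • H k)).PosSemidef := by
    intro a
    have : (4 : ℝ) • (1 : Matrix ι ι ℂ) - ∑ k, (c k a • H k) * (c k a • H k) =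
        ((4 : ℝ) • (1 : Matrix ι ι ℂ) - ∑ k, H k * H k) +
          ∑ k, (1 - c k a ^ 2) • ((H k)ᴴ * H k) := by
      rw [sub_add, ← Finset.sum_sub_distrib]
      congr 1
      refine Finset.sum_congr rfl fun k _ => ?_
      rw [(hH k).eq, sub_smul, one_smul, sub_sub_cancel, smul_mul_smul_comm, sq]
    rw [this]
    refine hS.add (posSemidef_sum _ fun k _ => ?_)
    exact (posSemidef_conjTranspose_mul_self _).smul (sub_nonneg.2 (hc k a))
  have hl : (0 : ℝ) < (16 * p) ^ (p - 1) := by positivity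
  have hle1 : ∀ x a, (1 - A x a).PosSemidef := by
    classical
    intro x a
    rw [← hA1 x, ← Finset.add_sum_erase _ _ (Finset.mem_univ a), add_sub_cancel_left]
    exact posSemidef_sum _ fun b _ => hA x b
  have key : ∀ x a, (A x a * blRad (fun k => c k a • H k) x ^ 2).trace.re ≤
      16 * p * (A x a).trace.re +
        ((16 * p : ℝ) ^ (p - 1))⁻¹ * (blRad (fun k => c k a • H k) x ^ (2 * p)).trace.re := by
    intro x a
    set R := blRad (fun k => c k a • H k) x
    have hR : R.IsHermitian := blRad_herm (hHa a) x
    have k1 : (A x a * R ^ (2 * p)).trace.re ≤ (R ^ (2 * p)).trace.re := by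
      obtain ⟨w, s, hw, h⟩ := bl_spec1 (hle1 x a) hR
      have : 0 ≤ ∑ i, w i * s i ^ (2 * p) :=
        Finset.sum_nonneg fun i _ => mul_nonneg (hw i) ((even_two_mul p).pow_nonneg _)
      rw [← h, sub_mul, trace_sub, Complex.sub_re, one_mul] at this
      linarith
    have k2 : (A x a * R ^ 2).trace.re ≤ 16 * p * (A x a).trace.re +
        ((16 * p : ℝ) ^ (p - 1))⁻¹ * (A x a * R ^ (2 * p)).trace.re := by
      obtain ⟨w, s, hw, h⟩ := bl_spec1 (hA x a) hR
      have h0 := h 0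
      simp only [pow_zero, mul_one] at h0
      rw [h 2, h (2 * p), h0, Finset.mul_sum, Finset.mul_sum, ← Finset.sum_add_distrib]
      refine Finset.sum_le_sum fun i _ => ?_
      have : s i ^ 2 ≤ 16 * p + ((16 * p : ℝ) ^ (p - 1))⁻¹ * s i ^ (2 * p) := by
        rcases le_total (s i ^ 2) (16 * p) with h | h
        · have : 0 ≤ ((16 * p : ℝ) ^ (p - 1))⁻¹ * s i ^ (2 * p) :=
            mul_nonneg (by positivity) ((even_two_mul p).pow_nonneg _)
          linarith
        · have e : s i ^ (2 * p) = (s i ^ 2) ^ (p - 1) * s i ^ 2 := by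
            rw [← pow_succ, ← pow_mul]; congr 2; omega
          have : s i ^ 2 ≤ ((16 * p : ℝ) ^ (p - 1))⁻¹ * s i ^ (2 * p) := by
            rw [e, ← mul_assoc]
            refine le_mul_of_one_le_left (by positivity) ?_
            rw [inv_mul_eq_div, one_le_div hl]
            gcongr
          have : (0 : ℝ) ≤ 16 * p := by positivity
          linarith
      nlinarith [hw i, mul_le_mul_of_nonneg_left this (hw i)]
    refine k2.trans ?_
    gcongr
  calc ∑ x, ∑ a, (A x a * blRad (fun k => c k a • H k) x ^ 2).trace.re
      ≤ ∑ x, ∑ a, (16 * p * (A x a).trace.re +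
        ((16 * p : ℝ) ^ (p - 1))⁻¹ * (blRad (fun k => c k a • H k) x ^ (2 * p)).trace.re) := by
        gcongr with x _ a; exact key x a
    _ = 16 * p * ∑ x : κ → Bool, (∑ a, A x a).trace.re + ((16 * p : ℝ) ^ (p - 1))⁻¹ *
        ∑ a, ∑ x, (blRad (fun k => c k a • H k) x ^ (2 * p)).trace.re := by
        simp only [Finset.sum_add_distrib, ← Finset.mul_sum, trace_sum, Complex.re_sum]
        congr 2
        rw [Finset.sum_comm]
    _ ≤ 16 * p * N + ((16 * p : ℝ) ^ (p - 1))⁻¹ * ∑ a : α, ((8 * p : ℝ) ^ p * N) := by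
        gcongr with a
        · simp [hA1, hN]
        · exact bl_khin (hHa a) (hSa a) p p le_rfl
    _ ≤ 16 * p * N + ((16 * p : ℝ) ^ (p - 1))⁻¹ * (2 ^ p * ((8 * p : ℝ) ^ p * N)) := by
        rw [Finset.sum_const, nsmul_eq_mul, Finset.card_univ]
        gcongr
        exact_mod_cast hα
    _ = 32 * p * N := by
        have : (2 : ℝ) ^ p * (8 * p) ^ p = (16 * p) ^ (p - 1) * (16 * p) := by
          rw [← mul_pow, ← pow_succ, Nat.sub_add_cancel hp]; ring
        rw [← mul_assoc (2 ^ p), this]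
        field_simp; ring

noncomputable def blX {κ ι α : Type*} [Fintype κ] [DecidableEq κ] [Fintype α] (c : κ → α → ℝ)
    (A : (κ → Bool) → α → Matrix ι ι ℂ) (k : κ) : Matrix ι ι ℂ :=
  ((Fintype.card (κ → Bool) : ℝ)⁻¹) • ∑ x, ∑ a, (blSg (x k) * c k a) • A x a

lemma blX_herm {κ ι α : Type*} [Fintype κ] [DecidableEq κ] [Fintype α] {c : κ → α → ℝ}
    {A : (κ → Bool) → α → Matrix ι ι ℂ} (hA : ∀ x a, (A x a).IsHermitian) (k : κ) :
    (blX c A k).IsHermitian := by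
  simp only [blX, Matrix.IsHermitian, conjTranspose_sum, conjTranspose_smul, (hA _ _).eq,
    star_trivial]

lemma blX_pair {κ ι α : Type*} [Fintype κ] [DecidableEq κ] [Fintype α] [Fintype ι] (c : κ → α → ℝ)
    (A : (κ → Bool) → α → Matrix ι ι ℂ) (V : κ → Matrix ι ι ℂ) :
    ∑ k, (blX c A k * V k).trace.re = ((Fintype.card (κ → Bool) : ℝ)⁻¹) *
      ∑ x, ∑ a, (A x a * blRad (fun k => c k a • V k) x).trace.re := by
  have : ∀ k, (blX c A k * V k).trace.re = ((Fintype.card (κ → Bool) : ℝ)⁻¹) *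
      ∑ x, ∑ a, (blSg (x k) * c k a) * (A x a * V k).trace.re := by
    intro k
    simp only [blX, smul_mul_assoc, bl_re_smul, Finset.sum_mul, trace_sum, Complex.re_sum]
  rw [Finset.sum_congr rfl fun k _ => this k, ← Finset.mul_sum, Finset.sum_comm]
  congr 1
  refine Finset.sum_congr rfl fun x _ => ?_
  rw [Finset.sum_comm]
  refine Finset.sum_congr rfl fun a _ => ?_
  simp only [blRad, Finset.mul_sum, mul_smul_comm, smul_smul, trace_sum, Complex.re_sum, bl_re_smul]

lemma bl_psd_H {κ ι : Type*} [Fintype κ] [Fintype ι] [DecidableEq ι]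
    (E : κ → Matrix ι ι ℂ)
    (h1 : ((1 : Matrix ι ι ℂ) - ∑ k, (E k)ᴴ * E k).PosSemidef)
    (h2 : ((1 : Matrix ι ι ℂ) - ∑ k, E k * (E k)ᴴ).PosSemidef) :
    ((4 : ℝ) • (1 : Matrix ι ι ℂ) - ∑ k, (E k + (E k)ᴴ) * (E k + (E k)ᴴ)).PosSemidef := by
  have : (4 : ℝ) • (1 : Matrix ι ι ℂ) - ∑ k, (E k + (E k)ᴴ) * (E k + (E k)ᴴ) =
      (2 : ℝ) • ((1 : Matrix ι ι ℂ) - ∑ k, (E k)ᴴ * E k) +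
      (2 : ℝ) • ((1 : Matrix ι ι ℂ) - ∑ k, E k * (E k)ᴴ) +
      ∑ k, (E k - (E k)ᴴ) * (E k - (E k)ᴴ)ᴴ := by
    have : ∀ k, (E k - (E k)ᴴ) * (E k - (E k)ᴴ)ᴴ = (2 : ℝ) • ((E k)ᴴ * E k) +
        (2 : ℝ) • (E k * (E k)ᴴ) - (E k + (E k)ᴴ) * (E k + (E k)ᴴ) := by
      intro k
      rw [conjTranspose_sub, conjTranspose_conjTranspose, two_smul, two_smul]
      noncomm_ring
    simp only [this, Finset.sum_sub_distrib, Finset.sum_add_distrib, smul_sub, Finset.smul_sum]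
    have : (4 : ℝ) • (1 : Matrix ι ι ℂ) = (2 : ℝ) • 1 + (2 : ℝ) • 1 := by
      rw [← add_smul]; norm_num
    rw [this]; abel
  rw [this]
  refine ((h1.smul (by norm_num)).add (h2.smul (by norm_num))).add (posSemidef_sum _ fun k _ => ?_)
  exact posSemidef_self_mul_conjTranspose _

lemma bl_step {κ ι α : Type*} [Fintype κ] [DecidableEq κ] [Fintype ι] [DecidableEq ι] [Fintype α]
    {c : κ → α → ℝ} (hc : ∀ k a, c k a ^ 2 ≤ 1) (p : ℕ) (hp : 1 ≤ p)
    (hα : Fintype.card α ≤ 2 ^ p)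
    (A : (κ → Bool) → α → Matrix ι ι ℂ) (hA : ∀ x a, (A x a).PosSemidef)
    (hA1 : ∀ x, ∑ a, A x a = 1) (s : ι → ℝ)
    (hs : ∑ k, blX c A k * blX c A k = diagonal (fun i => (s i : ℂ))) (L : ℝ) (hL : 0 < L) :
    ∑ k, (blX c A k * blX c A k).trace.re ≤
      ∑ k, (blX c A k * (diagonal (fun i => if L < s i then (1 : ℂ) else 0) * blX c A k *
        diagonal (fun i => if L < s i then (1 : ℂ) else 0))).trace.re +
      (1 / 12) * ∑ i, max (s i) L + 384 * p * Fintype.card ι := by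
  set X := blX c A with hX
  have hXh : ∀ k, (X k)ᴴ = X k := fun k => (blX_herm (fun x a => (hA x a).isHermitian) k).eq
  set N : ℝ := ((Fintype.card (κ → Bool) : ℕ) : ℝ) with hN
  have hNpos : 0 < N := by simp [hN]
  set d : ι → ℝ := fun i => Real.sqrt (max (s i) L) with hd
  have hdpos : ∀ i, 0 < d i := fun i => Real.sqrt_pos.2 (lt_max_of_lt_right hL)
  have hd2 : ∀ i, d i ^ 2 = max (s i) L := fun i =>
    Real.sq_sqrt (le_max_of_le_right hL.le)
  have hdL : ∀ i, Real.sqrt L ≤ d i := fun i => Real.sqrt_le_sqrt (le_max_right _ _)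
  have hsL : 0 < Real.sqrt L := Real.sqrt_pos.2 hL
  have hsL2 : Real.sqrt L ^ 2 = L := Real.sq_sqrt hL.le
  set P : ι → ℝ := fun i => if L < s i then 0 else 1 with hP
  set h : ι → ℝ := fun i => if L < s i then (Real.sqrt L + d i)⁻¹ else (4 * Real.sqrt L)⁻¹ with hh
  have hhpos : ∀ i, 0 < h i := fun i => by
    simp only [hh]; have := hdpos i; split_ifs <;> positivity
  have hhL : ∀ i, h i ^ 2 * L ≤ 1 := fun i => by
    have : h i * Real.sqrt L ≤ 1 := by
      have := hdpos i
      simp only [hh]; split_ifs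
      · rw [inv_mul_le_iff₀ (by positivity)]; linarith
      · rw [inv_mul_le_iff₀ (by positivity)]; linarith
    have h0 : 0 ≤ h i * Real.sqrt L := mul_nonneg (hhpos i).le hsL.le
    calc h i ^ 2 * L = (h i * Real.sqrt L) ^ 2 := by rw [mul_pow, hsL2]
      _ ≤ 1 := pow_le_one₀ h0 this
  have hhs : ∀ i, h i ^ 2 * s i ≤ 1 := fun i => by
    by_cases hi : L < s i
    · have h1 : h i * d i ≤ 1 := by
        have := hdpos i
        simp only [hh, hi, if_true]
        rw [inv_mul_le_iff₀ (by positivity)]; linarith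
      have h0 : 0 ≤ h i * d i := mul_nonneg (hhpos i).le (hdpos i).le
      calc h i ^ 2 * s i ≤ h i ^ 2 * d i ^ 2 := by
            rw [hd2]; gcongr; exact le_max_left _ _
        _ = (h i * d i) ^ 2 := by ring
        _ ≤ 1 := pow_le_one₀ h0 h1
    · exact (mul_le_mul_of_nonneg_left (not_lt.1 hi) (sq_nonneg _)).trans (hhL i)
  let dg : (ι → ℝ) → Matrix ι ι ℂ := fun f => diagonal (fun i => (f i : ℂ))
  have dgh : ∀ f, (dg f)ᴴ = dg f := fun f => by
    simp only [dg, diagonal_conjTranspose]; congr 1; funext i; simp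
  have dgm : ∀ f g, dg f * dg g = dg (fun i => f i * g i) := fun f g => by
    simp only [dg, diagonal_mul_diagonal]; congr 1; funext i; simp
  have dgpsd : ∀ f : ι → ℝ, (∀ i, 0 ≤ f i) → (dg f).PosSemidef := fun f hf =>
    PosSemidef.diagonal fun i => by simpa using hf i
  have dgadd : ∀ f g, dg f + dg g = dg (fun i => f i + g i) := fun f g => by
    simp only [dg, diagonal_add]; congr 1; funext i; simp
  have dg1 : dg (fun _ => 1) = 1 := by simp [dg]
  have dgs : ∑ k, X k * X k = dg s := hs
  let E : κ → Matrix ι ι ℂ := fun k => dg P * X k * dg h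
  have hEh : ∀ k, (E k)ᴴ = dg h * X k * dg P := fun k => by
    simp only [E, conjTranspose_mul, dgh, hXh, Matrix.mul_assoc]
  let H : κ → Matrix ι ι ℂ := fun k => E k + (E k)ᴴ
  have hH : ∀ k, (H k).IsHermitian := fun k => by
    simp only [H, Matrix.IsHermitian, conjTranspose_add, conjTranspose_conjTranspose, add_comm]
  have h1 : ((1 : Matrix ι ι ℂ) - ∑ k, (E k)ᴴ * E k).PosSemidef := by
    have e : (1 : Matrix ι ι ℂ) - ∑ k, (E k)ᴴ * E k = dg (fun i => 1 - h i ^ 2 * s i) +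
        ∑ k, (dg (fun i => 1 - P i) * X k * dg h)ᴴ * (dg (fun i => 1 - P i) * X k * dg h) := by
      have e1 : ∀ k, (dg (fun i => 1 - P i) * X k * dg h)ᴴ * (dg (fun i => 1 - P i) * X k * dg h) =
          dg h * (X k * X k) * dg h - (E k)ᴴ * E k := by
        intro k
        have a1 : dg (fun i => 1 - P i) * dg (fun i => 1 - P i) = 1 - dg P * dg P := by
          rw [eq_sub_iff_add_eq, dgm, dgm, dgadd, ← dg1]
          congr 1; funext i; simp only [hP]; split_ifs <;> norm_num
        have a2 : (dg (fun i => 1 - P i) * X k * dg h)ᴴ * (dg (fun i => 1 - P i) * X k * dg h) =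
          dg h * X k * (dg (fun i => 1 - P i) * dg (fun i => 1 - P i)) * X k * dg h := by
          simp only [conjTranspose_mul, dgh, hXh, Matrix.mul_assoc]
        rw [a2, a1, hEh]; simp only [E]; noncomm_ring
      have e2 : ∑ k, dg h * (X k * X k) * dg h = dg (fun i => h i ^ 2 * s i) := by
        rw [← Finset.sum_mul, ← Finset.mul_sum, dgs, dgm, dgm]; congr 1; funext i; ring
      rw [Finset.sum_congr rfl fun k _ => e1 k, Finset.sum_sub_distrib, e2, ← add_sub_assoc, dgadd,
        ← dg1]
      simp
    rw [e]
    refine (dgpsd _ fun i => sub_nonneg.2 (hhs i)).add (posSemidef_sum _ fun k _ => ?_)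
    exact posSemidef_conjTranspose_mul_self _
  have h2 : ((1 : Matrix ι ι ℂ) - ∑ k, E k * (E k)ᴴ).PosSemidef := by
    let g : ι → ℝ := fun i => Real.sqrt (L⁻¹ - h i ^ 2)
    have hg : ∀ i, g i * g i = L⁻¹ - h i * h i := fun i => by
      simp only [g]
      rw [Real.mul_self_sqrt, sq]
      rw [sub_nonneg, le_inv_comm₀ (pow_pos (hhpos i) 2) hL, le_inv_comm₀ hL (pow_pos (hhpos i) 2),
        ← one_div, le_div_iff₀ hL]
      exact hhL i
    have e : (1 : Matrix ι ι ℂ) - ∑ k, E k * (E k)ᴴ = dg (fun i => 1 - L⁻¹ * (P i * s i * P i)) +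
        ∑ k, (dg P * X k * dg g) * (dg P * X k * dg g)ᴴ := by
      have e1 : ∀ k, (dg P * X k * dg g) * (dg P * X k * dg g)ᴴ =
          dg (fun i => L⁻¹ * P i) * (X k * X k) * dg P - E k * (E k)ᴴ := by
        intro k
        have a1 : dg g * dg g = dg (fun _ => L⁻¹) - dg h * dg h := by
          rw [eq_sub_iff_add_eq, dgm, dgm, dgadd]
          congr 1; funext i; rw [hg]; ring
        have a2 : (dg P * X k * dg g) * (dg P * X k * dg g)ᴴ =
          dg P * X k * (dg g * dg g) * X k * dg P := by
          simp only [conjTranspose_mul, dgh, hXh, Matrix.mul_assoc]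
        have a3 : dg (fun _ => L⁻¹) = ((L⁻¹ : ℝ) : ℂ) • (1 : Matrix ι ι ℂ) := by
          simp only [dg, smul_one_eq_diagonal]
        have a4 : dg (fun i => L⁻¹ * P i) = ((L⁻¹ : ℝ) : ℂ) • dg P := by
          ext i j; by_cases hij : i = j <;> simp [dg, hij]
        rw [a2, a1, hEh, a3, a4]; simp only [E, mul_sub, sub_mul, mul_smul_comm, smul_mul_assoc,
          mul_one, Matrix.mul_assoc]
      have e2 : ∑ k, dg (fun i => L⁻¹ * P i) * (X k * X k) * dg P =
          dg (fun i => L⁻¹ * (P i * s i * P i)) := by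
        rw [← Finset.sum_mul, ← Finset.mul_sum, dgs, dgm, dgm]; congr 1; funext i; ring
      rw [Finset.sum_congr rfl fun k _ => e1 k, Finset.sum_sub_distrib, e2, ← add_sub_assoc, dgadd,
        ← dg1]
      simp
    rw [e]
    refine (dgpsd _ fun i => sub_nonneg.2 ?_).add (posSemidef_sum _ fun k _ => ?_)
    · rw [inv_mul_le_iff₀ hL, mul_one]
      simp only [hP]
      split_ifs with hi
      · simpa using hL.le
      · simpa using hi
    · exact posSemidef_self_mul_conjTranspose _
  have hS := bl_psd_H E h1 h2
  have hB := bl_max hc hH hS p hp hα A hA hA1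
  -- decomposition of X
  let Pq : Matrix ι ι ℂ := diagonal (fun i => if L < s i then (1 : ℂ) else 0)
  have hdec : ∀ k, X k = Pq * X k * Pq + (H k * dg d + dg d * H k) := by
    intro k
    ext i j
    have hcj : star (X k j i) = X k i j := by
      rw [← conjTranspose_apply, hXh]
    have hh' : H k i j = X k i j * ((P i * h j + h i * P j : ℝ) : ℂ) := by
      simp only [H, Matrix.add_apply, hEh]
      simp only [E, dg, Matrix.mul_diagonal, Matrix.diagonal_mul]
      push_cast; ring
    simp only [Matrix.add_apply, Pq, dg, Matrix.mul_diagonal, Matrix.diagonal_mul, hh']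
    have key : (if L < s i then (1 : ℝ) else 0) * (if L < s j then (1 : ℝ) else 0) +
        (P i * h j + h i * P j) * (d i + d j) = 1 := by
      have hdi := hdpos i
      have hdj := hdpos j
      have dP : ∀ i, ¬ L < s i → d i = Real.sqrt L := fun i hi => by
        simp only [hd]; rw [max_eq_right (not_lt.1 hi)]
      simp only [hP, hh]
      by_cases hi : L < s i <;> by_cases hj : L < s j <;> simp only [hi, hj, if_true, if_false]
      · ring
      · rw [dP j hj]; field_simp; ring
      · rw [dP i hi]; field_simp; ring
      · rw [dP j hj, dP i hi]; field_simp; ring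
    have key' := congrArg (fun r : ℝ => (r : ℂ)) key
    split_ifs at key' ⊢ <;> push_cast at key' ⊢ <;> linear_combination (-(X k i j)) * key'
  -- quadratic bound
  have hquad : ∀ x a, (A x a * blRad (fun k => c k a • (H k * dg d + dg d * H k)) x).trace.re ≤
      (1 / 12) * (A x a * dg (fun i => max (s i) L)).trace.re +
        12 * (A x a * blRad (fun k => c k a • H k) x ^ 2).trace.re := by
    intro x a
    set R := blRad (fun k => c k a • H k) x with hR
    have e1 : blRad (fun k => c k a • (H k * dg d + dg d * H k)) x = R * dg d + dg d * R := by
      simp only [hR, blRad, Finset.sum_mul, Finset.mul_sum, ← Finset.sum_add_distrib,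
        smul_mul_assoc, mul_smul_comm, smul_add]
    have hRh : Rᴴ = R := (blRad_herm (fun k => by
      simp only [Matrix.IsHermitian, conjTranspose_smul, (hH _).eq, star_trivial]) x).eq
    have e2 : dg d * dg d = dg (fun i => max (s i) L) := by
      rw [dgm]; congr 1; funext i; rw [← sq, hd2]
    let Y := dg d - (12 : ℝ) • R
    have hY : Yᴴ = Y := by
      simp only [Y, conjTranspose_sub, conjTranspose_smul, dgh, hRh, star_trivial]
    have e3 : 0 ≤ (A x a * Y ^ 2).trace.re := by
      obtain ⟨w, t, hw, ht⟩ := bl_spec1 (hA x a) hY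
      rw [ht 2]; exact Finset.sum_nonneg fun i _ => mul_nonneg (hw i) (sq_nonneg _)
    have e4 : A x a * Y ^ 2 = A x a * dg (fun i => max (s i) L) -
        (12 : ℝ) • (A x a * (R * dg d + dg d * R)) + (144 : ℝ) • (A x a * R ^ 2) := by
      simp only [Y, sq, sub_mul, mul_sub, smul_mul_assoc, mul_smul_comm, e2, mul_add]
      module
    rw [e4, trace_add, trace_sub, Complex.add_re, Complex.sub_re, bl_re_smul, bl_re_smul] at e3
    rw [e1]; linarith
  have hmain : ∑ k, (X k * X k).trace.re = ∑ k, (X k * (Pq * X k * Pq)).trace.re +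
      ∑ k, (X k * (H k * dg d + dg d * H k)).trace.re := by
    rw [← Finset.sum_add_distrib]
    refine Finset.sum_congr rfl fun k _ => ?_
    rw [← Complex.add_re, ← trace_add, ← mul_add, ← hdec]
  rw [hmain, add_assoc]
  refine add_le_add le_rfl ?_
  rw [hX, blX_pair, ← hN, inv_mul_le_iff₀ hNpos]
  calc _ ≤ ∑ x, ∑ a, ((1 / 12) * (A x a * dg (fun i => max (s i) L)).trace.re +
        12 * (A x a * blRad (fun k => c k a • H k) x ^ 2).trace.re) := by
        gcongr with x _ a; exact hquad x a
    _ = (1 / 12) * ∑ x : κ → Bool, ((∑ a, A x a) * dg (fun i => max (s i) L)).trace.re +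
        12 * ∑ x, ∑ a, (A x a * blRad (fun k => c k a • H k) x ^ 2).trace.re := by
        simp only [Finset.sum_add_distrib, ← Finset.mul_sum, trace_sum, Complex.re_sum,
          Finset.sum_mul]
    _ ≤ (1 / 12) * ∑ x : κ → Bool, ∑ i, max (s i) L + 12 * (32 * p * (N * Fintype.card ι)) := by
        gcongr with x
        rw [hA1, one_mul]
        simp [dg, trace, Complex.re_sum]
    _ = _ := by
        rw [Finset.sum_const, nsmul_eq_mul, Finset.card_univ]
        ring

lemma blX_conj {κ ι α : Type*} [Fintype κ] [DecidableEq κ] [Fintype ι] [Fintype α] (c : κ → α → ℝ)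
    (A : (κ → Bool) → α → Matrix ι ι ℂ) (U V : Matrix ι ι ℂ) (k : κ) :
    blX c (fun x a => U * A x a * V) k = U * blX c A k * V := by
  simp only [blX, Finset.mul_sum, Finset.sum_mul, mul_smul_comm, smul_mul_assoc]

lemma blX_submatrix {κ ι ι' α : Type*} [Fintype κ] [DecidableEq κ] [Fintype α]
    (c : κ → α → ℝ) (A : (κ → Bool) → α → Matrix ι ι ℂ) (f : ι' → ι) (k : κ) :
    blX c (fun x a => (A x a).submatrix f f) k = (blX c A k).submatrix f f := by
  ext i j
  simp only [blX, Matrix.smul_apply, Matrix.sum_apply, submatrix_apply]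

lemma bl_trace_sub {ι : Type} [Fintype ι] [DecidableEq ι] (q : ι → Prop) [DecidablePred q]
    (X : Matrix ι ι ℂ) :
    (X * (diagonal (fun i => if q i then (1 : ℂ) else 0) * X *
        diagonal (fun i => if q i then (1 : ℂ) else 0))).trace =
      (X.submatrix (Subtype.val : {i // q i} → ι) (Subtype.val : {i // q i} → ι) *
        X.submatrix (Subtype.val : {i // q i} → ι) (Subtype.val : {i // q i} → ι)).trace := by
  have hsub : ∀ f : ι → ℂ, ∑ i : {i // q i}, f i = ∑ i, if q i then f i else 0 := by
    intro f
    rw [← Finset.sum_filter]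
    exact (Finset.sum_subtype _ (by simp) f).symm
  simp only [Matrix.trace, Matrix.diag]
  have e1 : ∀ i : {i // q i}, (X.submatrix (Subtype.val : {i // q i} → ι) (Subtype.val : {i // q i} → ι) *
        X.submatrix (Subtype.val : {i // q i} → ι) (Subtype.val : {i // q i} → ι)) i i =
      ∑ j, if q j then X i j * X j i else 0 := by
    intro i
    rw [Matrix.mul_apply, ← hsub (fun j => X i j * X j i)]
    rfl
  rw [Finset.sum_congr rfl fun i _ => e1 i,
    hsub (fun i => ∑ j, if q j then X i j * X j i else 0)]
  refine Finset.sum_congr rfl fun i _ => ?_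
  rw [Matrix.mul_apply]
  simp only [Matrix.mul_diagonal, Matrix.diagonal_mul]
  split_ifs with hi
  · refine Finset.sum_congr rfl fun j _ => ?_
    split_ifs <;> simp
  · simp

theorem bl_upper {κ α : Type} [Fintype κ] [DecidableEq κ] [Fintype α]
    {c : κ → α → ℝ} (hc : ∀ k a, c k a ^ 2 ≤ 1) (p : ℕ) (hp : 1 ≤ p)
    (hα : Fintype.card α ≤ 2 ^ p) (d : ℕ) :
    ∀ (ι : Type) [Fintype ι] [DecidableEq ι], Fintype.card ι = d →
    ∀ (A : (κ → Bool) → α → Matrix ι ι ℂ), (∀ x a, (A x a).PosSemidef) →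
    (∀ x, ∑ a, A x a = 1) →
    ∑ k, (blX c A k * blX c A k).trace.re ≤ 1536 * p * d := by
  induction d using Nat.strong_induction_on with
  | _ d ih =>
  intro ι _ _ hcard A hA hA1
  by_contra hcon
  push Not at hcon
  have hXh : ∀ k, (blX c A k)ᴴ = blX c A k :=
    fun k => (blX_herm (fun x a => (hA x a).isHermitian) k).eq
  have hSh : (∑ k, blX c A k * blX c A k).IsHermitian := by
    simp only [Matrix.IsHermitian, conjTranspose_sum, conjTranspose_mul, hXh]
  obtain ⟨U, s, h1, h2, hU⟩ := bl_diag hSh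
  set A' : (κ → Bool) → α → Matrix ι ι ℂ := fun x a => Uᴴ * A x a * U with hA'
  have hX' : ∀ k, blX c A' k = Uᴴ * blX c A k * U := fun k => blX_conj c A Uᴴ U k
  have hXX : ∀ k, blX c A' k * blX c A' k = Uᴴ * (blX c A k * blX c A k) * U := fun k => by
    rw [hX']
    calc _ = Uᴴ * blX c A k * (U * Uᴴ) * blX c A k * U := by simp only [Matrix.mul_assoc]
      _ = _ := by rw [h1, Matrix.mul_one]; simp only [Matrix.mul_assoc]
  have hs : ∑ k, blX c A' k * blX c A' k = diagonal (fun i => (s i : ℂ)) := by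
    rw [Finset.sum_congr rfl fun k _ => hXX k, ← Finset.sum_mul, ← Finset.mul_sum, hU]
    calc _ = (Uᴴ * U) * diagonal (fun i => (s i : ℂ)) * (Uᴴ * U) := by
          simp only [Matrix.mul_assoc]
      _ = _ := by rw [h2, Matrix.one_mul, Matrix.mul_one]
  have hA'p : ∀ x a, (A' x a).PosSemidef := fun x a => (hA x a).conjTranspose_mul_mul_same U
  have hA'1 : ∀ x, ∑ a, A' x a = 1 := fun x => by
    simp only [hA']
    rw [← Finset.sum_mul, ← Finset.mul_sum, hA1, Matrix.mul_one, h2]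
  have hF : ∑ k, (blX c A k * blX c A k).trace.re = ∑ k, (blX c A' k * blX c A' k).trace.re := by
    refine Finset.sum_congr rfl fun k _ => ?_
    rw [hXX, Matrix.trace_mul_cycle, h1, Matrix.one_mul]
  have hFs : ∑ k, (blX c A' k * blX c A' k).trace.re = ∑ i, s i := by
    rw [← Complex.re_sum, ← trace_sum, hs]; simp [trace, Complex.re_sum]
  have hs0 : ∀ i, 0 ≤ s i := by
    intro i
    have : (∑ k, blX c A' k * blX c A' k).PosSemidef := by
      refine posSemidef_sum _ fun k _ => ?_
      have h := (blX_herm (c := c) (fun x a => (hA'p x a).isHermitian) k).eq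
      have h' := posSemidef_conjTranspose_mul_self (blX c A' k)
      rwa [h] at h'
    rw [hs] at this
    have := this.diag_nonneg (i := i)
    simpa using this
  rw [hF, hFs] at hcon
  set F := ∑ i, s i with hFdef
  have hp0 : (1 : ℝ) ≤ p := by exact_mod_cast hp
  have hF0 : 0 < F := lt_of_le_of_lt (by positivity) hcon
  have hd : 0 < d := by
    rcases Nat.eq_zero_or_pos d with h | h
    · exfalso
      have : IsEmpty ι := Fintype.card_eq_zero_iff.1 (hcard.trans h)
      simp [hFdef] at hF0
    · exact h
  have hd' : (0 : ℝ) < d := by exact_mod_cast hd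
  set L := 2 * F / d with hL
  have hL0 : 0 < L := by positivity
  have hstep := bl_step hc p hp hα A' hA'p hA'1 s hs L hL0
  rw [hFs] at hstep
  set q := Fintype.card {i // L < s i} with hq
  have hqd : (q : ℝ) * 2 ≤ d := by
    have : (q : ℝ) * L ≤ F := by
      rw [hq, Fintype.card_subtype, ← nsmul_eq_mul, ← Finset.sum_const]
      calc _ ≤ ∑ i ∈ Finset.univ.filter (fun i => L < s i), s i := by
            refine Finset.sum_le_sum fun i hi => ?_
            exact (Finset.mem_filter.1 hi).2.le
        _ ≤ F := Finset.sum_le_univ_sum_of_nonneg hs0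
    rw [hL, mul_div_assoc', div_le_iff₀ hd'] at this
    have h3 : F * ((q : ℝ) * 2) ≤ F * d := by linarith
    exact le_of_mul_le_mul_left h3 hF0
  have hqlt : q < d := by
    have : (q : ℝ) < d := by
      have : (0 : ℝ) ≤ q := by positivity
      linarith
    exact_mod_cast this
  have hQ := ih q hqlt {i // L < s i} hq.symm
    (fun x a => (A' x a).submatrix (Subtype.val : {i // L < s i} → ι) (Subtype.val : {i // L < s i} → ι))
    (fun x a => (hA'p x a).submatrix _) (fun x => by
      have := congrArg (fun M => M.submatrix (Subtype.val : {i // L < s i} → ι) (Subtype.val : {i // L < s i} → ι)) (hA'1 x)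
      rw [submatrix_one _ Subtype.val_injective] at this
      rw [← this]
      ext i j; simp [Matrix.sum_apply])
  have e : ∀ k, (blX c A' k * (diagonal (fun i => if L < s i then (1 : ℂ) else 0) * blX c A' k *
        diagonal (fun i => if L < s i then (1 : ℂ) else 0))).trace.re =
      (blX c (fun x a => (A' x a).submatrix (Subtype.val : {i // L < s i} → ι) (Subtype.val : {i // L < s i} → ι)) k *
       blX c (fun x a => (A' x a).submatrix (Subtype.val : {i // L < s i} → ι) (Subtype.val : {i // L < s i} → ι)) k).trace.re
      := fun k => by
    rw [blX_submatrix, bl_trace_sub (fun i => L < s i)]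
  rw [Finset.sum_congr rfl fun k _ => e k] at hstep
  have hmax : ∑ i, max (s i) L ≤ 3 * F := by
    calc _ ≤ ∑ i, (s i + L) := by
          refine Finset.sum_le_sum fun i _ => max_le ?_ ?_
          · linarith
          · linarith [hs0 i]
      _ = F + d * L := by
          rw [Finset.sum_add_distrib, Finset.sum_const, nsmul_eq_mul, Finset.card_univ, hcard]
      _ = 3 * F := by rw [hL]; field_simp; ring
  rw [hcard] at hstep
  have : 1536 * (p : ℝ) * q ≤ 1536 * p * d / 2 := by nlinarith
  linarith

theorem bl_upper_me {κ α : Type} [Fintype κ] [DecidableEq κ] [Fintype α]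
    {c : κ → α → ℝ} (hc : ∀ k a, c k a ^ 2 ≤ 1) (p : ℕ) (hp : 1 ≤ p)
    (hα : Fintype.card α ≤ 2 ^ p) (d : ℕ) (A B : (κ → Bool) → α → Matrix (Fin d) (Fin d) ℂ)
    (hA : ∀ x a, (A x a).PosSemidef) (hA1 : ∀ x, ∑ a, A x a = 1)
    (hB : ∀ x a, (B x a).PosSemidef) (hB1 : ∀ x, ∑ a, B x a = 1) :
    ‖∑ k, ∑ i, ∑ j, blX c A k i j * blX c B k i j‖ ≤ 1536 * p * d := by
  have hfro : ∀ A : (κ → Bool) → α → Matrix (Fin d) (Fin d) ℂ, (∀ x a, (A x a).PosSemidef) →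
      (∀ x, ∑ a, A x a = 1) → ∑ k, ∑ i, ∑ j, ‖blX c A k i j‖ ^ 2 ≤ 1536 * p * d := by
    intro A hA hA1
    refine le_of_eq_of_le ?_ (bl_upper hc p hp hα d (Fin d) (by simp) A hA hA1)
    refine Finset.sum_congr rfl fun k _ => ?_
    simp only [trace, diag, Matrix.mul_apply, Complex.re_sum]
    refine Finset.sum_congr rfl fun i _ => Finset.sum_congr rfl fun j _ => ?_
    have h := (blX_herm (c := c) (fun x a => (hA x a).isHermitian) k).apply j i
    rw [← h, Complex.star_def, Complex.mul_conj']
    norm_cast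
  calc _ ≤ ∑ k, ∑ i, ∑ j, (‖blX c A k i j‖ ^ 2 / 2 + ‖blX c B k i j‖ ^ 2 / 2) := by
        refine (norm_sum_le _ _).trans (Finset.sum_le_sum fun k _ => ?_)
        refine (norm_sum_le _ _).trans (Finset.sum_le_sum fun i _ => ?_)
        refine (norm_sum_le _ _).trans (Finset.sum_le_sum fun j _ => ?_)
        rw [norm_mul]
        nlinarith [sq_nonneg (‖blX c A k i j‖ - ‖blX c B k i j‖)]
    _ = (∑ k, ∑ i, ∑ j, ‖blX c A k i j‖ ^ 2) / 2 + (∑ k, ∑ i, ∑ j, ‖blX c B k i j‖ ^ 2) / 2 := by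
        simp only [Finset.sum_add_distrib, Finset.sum_div]
    _ ≤ _ := by linarith [hfro A hA hA1, hfro B hB hB1]

section blE

lemma bl_sum5 {α β γ δ σ : Type*} [Fintype α] [Fintype β] [Fintype γ] [Fintype δ] [Fintype σ]
    (f : α → β → γ → δ → σ → ℂ) :
    ∑ x, ∑ y, ∑ a, ∑ b, ∑ s, f x y a b s = ∑ s, ∑ x, ∑ y, ∑ a, ∑ b, f x y a b s := by
  symm
  rw [Finset.sum_comm]
  refine Finset.sum_congr rfl fun x _ => ?_
  rw [Finset.sum_comm]
  refine Finset.sum_congr rfl fun y _ => ?_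
  rw [Finset.sum_comm]
  refine Finset.sum_congr rfl fun a _ => ?_
  rw [Finset.sum_comm]

lemma bl_sum4 {α β γ δ : Type*} [Fintype α] [Fintype β] [Fintype γ] [Fintype δ]
    (f : α → γ → ℂ) (g : β → δ → ℂ) :
    (∑ x, ∑ a, f x a) * (∑ y, ∑ b, g y b) = ∑ x, ∑ y, ∑ a, ∑ b, f x a * g y b := by
  rw [Finset.sum_mul_sum]
  refine Finset.sum_congr rfl fun x _ => Finset.sum_congr rfl fun y _ => ?_
  rw [Finset.sum_mul_sum]

noncomputable def blM {κ α X : Type*} [Fintype κ] [DecidableEq κ] (c : κ → α → ℝ)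
    (e : X ≃ (κ → Bool)) (t : ℝ) (x y : X) (a b : α) : ℝ :=
  t * ∑ k, ((Fintype.card (κ → Bool) : ℝ)⁻¹ * (blSg (e x k) * c k a)) *
    ((Fintype.card (κ → Bool) : ℝ)⁻¹ * (blSg (e y k) * c k b))

lemma blX_entry {κ α X ι : Type*} [Fintype κ] [DecidableEq κ] [Fintype α] [Fintype X]
    (c : κ → α → ℝ) (e : X ≃ (κ → Bool)) (A : X → α → Matrix ι ι ℂ) (k : κ) (i j : ι) :
    blX c (fun z a => A (e.symm z) a) k i j = ∑ x, ∑ a,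
      (((Fintype.card (κ → Bool) : ℝ)⁻¹ * (blSg (e x k) * c k a) : ℝ) : ℂ) * A x a i j := by
  rw [← Equiv.sum_comp e.symm]
  simp only [blX, Matrix.smul_apply, Matrix.sum_apply, Equiv.apply_symm_apply, Finset.smul_sum,
    Complex.real_smul]
  refine Finset.sum_congr rfl fun x _ => Finset.sum_congr rfl fun a _ => ?_
  push_cast; ring

lemma bl_value {κ α X : Type*} [Fintype κ] [DecidableEq κ] [Fintype α] [Fintype X]
    (c : κ → α → ℝ) (e : X ≃ (κ → Bool)) (t : ℝ) {d : ℕ} (A B : X → α → Matrix (Fin d) (Fin d) ℂ)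
    (ψ : Fin d × Fin d → ℂ) :
    ∑ x, ∑ y, ∑ a, ∑ b, (blM c e t x y a b : ℂ) *
          ∑ p : Fin d × Fin d, ∑ q : Fin d × Fin d,
            (starRingEnd ℂ) (ψ p) * (A x a p.1 q.1 * B y b p.2 q.2) * ψ q =
    t * ∑ k, ∑ p : Fin d × Fin d, ∑ q : Fin d × Fin d,
      (starRingEnd ℂ) (ψ p) * (blX c (fun z a => A (e.symm z) a) k p.1 q.1 *
        blX c (fun z a => B (e.symm z) a) k p.2 q.2) * ψ q := by
  simp only [blX_entry, bl_sum4]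
  simp only [blM, Finset.mul_sum, Finset.sum_mul, Complex.ofReal_mul, Complex.ofReal_sum]
  rw [bl_sum5]
  rw [Finset.sum_comm (s := (Finset.univ : Finset κ))]
  refine Finset.sum_congr rfl fun p _ => ?_
  rw [bl_sum5]
  rw [Finset.sum_comm (s := (Finset.univ : Finset κ))]
  refine Finset.sum_congr rfl fun q _ => ?_
  rw [bl_sum5]
  refine Finset.sum_congr rfl fun k _ => Finset.sum_congr rfl fun x _ =>
    Finset.sum_congr rfl fun y _ => Finset.sum_congr rfl fun a _ =>
    Finset.sum_congr rfl fun b _ => ?_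
  ring

lemma bl_diagval {d : ℕ} (φ : Fin d → ℝ) (X Y : Matrix (Fin d) (Fin d) ℂ) :
    ∑ p : Fin d × Fin d, ∑ q : Fin d × Fin d,
      (starRingEnd ℂ) (if p.1 = p.2 then (φ p.1 : ℂ) else 0) * (X p.1 q.1 * Y p.2 q.2) *
        (if q.1 = q.2 then (φ q.1 : ℂ) else 0) =
    ∑ i, ∑ j, (φ i : ℂ) * φ j * (X i j * Y i j) := by
  simp only [Fintype.sum_prod_type, apply_ite (starRingEnd ℂ), Complex.conj_ofReal, map_zero,
    ite_mul, mul_ite, zero_mul, mul_zero, Finset.sum_ite_eq, Finset.mem_univ, if_true,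
    Finset.sum_const_zero]
  refine Finset.sum_congr rfl fun i _ => ?_
  rw [Finset.sum_comm]
  refine Finset.sum_congr rfl fun j _ => ?_
  rw [Finset.sum_ite_eq]
  simp only [Finset.mem_univ, if_true]
  ring

open scoped MatrixOrder Matrix.Norms.L2Operator in
lemma bl_sqrt {ι : Type*} [Fintype ι] [DecidableEq ι] {A : Matrix ι ι ℂ} (hA : A.PosSemidef) :
    ∃ C : Matrix ι ι ℂ, A = Cᴴ * C :=
  CStarAlgebra.nonneg_iff_eq_star_mul_self.mp hA.nonneg

lemma bl_entry_le {d n : ℕ} (A : Fin n → Matrix (Fin d) (Fin d) ℂ)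
    (hA : ∀ a, (A a).PosSemidef) (hA1 : ∑ a, A a = 1) (a : Fin n) (i j : Fin d) :
    ‖A a i j‖ ≤ 1 := by
  have hd : ∀ i, (A a i i).re ≤ 1 := by
    intro i
    have h0 : ∀ b, 0 ≤ (A b i i).re := fun b => by
      have := (hA b).diag_nonneg (i := i)
      exact (Complex.nonneg_iff.1 this).1
    have h1 : ∑ b, (A b i i).re = 1 := by
      have := congrFun (congrFun hA1 i) i
      rw [Matrix.sum_apply] at this
      rw [← Complex.re_sum, this]; simp
    rw [← h1]
    exact Finset.single_le_sum (f := fun b => (A b i i).re) (fun b _ => h0 b) (Finset.mem_univ a)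
  obtain ⟨C, hC⟩ := bl_sqrt (hA a)
  have he : ∀ i, (A a i i).re = ∑ l, ‖C l i‖ ^ 2 := by
    intro i
    rw [hC, Matrix.mul_apply, Complex.re_sum]
    refine Finset.sum_congr rfl fun l _ => ?_
    rw [conjTranspose_apply, Complex.star_def, Complex.conj_mul']
    norm_cast
  have : ‖A a i j‖ ≤ ∑ l, (‖C l i‖ ^ 2 / 2 + ‖C l j‖ ^ 2 / 2) := by
    rw [hC, Matrix.mul_apply]
    refine (norm_sum_le _ _).trans (Finset.sum_le_sum fun l _ => ?_)
    rw [norm_mul, conjTranspose_apply, norm_star]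
    nlinarith [sq_nonneg (‖C l i‖ - ‖C l j‖)]
  rw [Finset.sum_add_distrib, ← Finset.sum_div, ← Finset.sum_div, ← he, ← he] at this
  linarith [hd i, hd j]

lemma bl_had (r : ℕ) : ∃ u : Fin (2 ^ r) → Fin (2 ^ r) → ℝ, (∀ k a, u k a * u k a = 1) ∧
    ∀ k l, ∑ a, u k a * u l a = if k = l then (2 : ℝ) ^ r else 0 := by
  have e : Fin (2 ^ r) ≃ (Fin r → Bool) := Fintype.equivOfCardEq (by simp)
  refine ⟨fun k a => ∏ i, if e k i && e a i then -1 else 1, fun k a => ?_, fun k l => ?_⟩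
  · rw [← Finset.prod_mul_distrib]
    exact Finset.prod_eq_one fun i _ => by split_ifs <;> norm_num
  · rw [← Equiv.sum_comp e.symm]
    simp only [Equiv.apply_symm_apply, ← Finset.prod_mul_distrib]
    have := Finset.prod_univ_sum (fun _ : Fin r => (Finset.univ : Finset Bool))
      (fun i b => (if e k i && b then (-1 : ℝ) else 1) * (if e l i && b then (-1 : ℝ) else 1))
    rw [Fintype.piFinset_univ] at this
    rw [← this]
    split_ifs with h
    · subst h
      rw [Finset.prod_congr rfl (g := fun _ => (2 : ℝ)), Finset.prod_const]
      · simp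
      · intro i _
        cases e k i <;> simp <;> norm_num
    · have : ∃ i, e k i ≠ e l i := by
        by_contra hh
        push Not at hh
        exact h (e.injective (funext hh))
      obtain ⟨i, hi⟩ := this
      refine Finset.prod_eq_zero (Finset.mem_univ i) ?_
      revert hi
      cases e k i <;> cases e l i <;> simp

lemma bl_finsum {M : Type*} [AddCommMonoid M] {m n : ℕ} (h : m + 1 ≤ n) (f : Fin n → M)
    (hf : ∀ a : Fin n, m < a.1 → f a = 0) :
    ∑ a, f a = ∑ a : Fin m, f ⟨a.1, by omega⟩ + f ⟨m, by omega⟩ := by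
  obtain ⟨t, rfl⟩ := Nat.exists_eq_add_of_le h
  rw [Fin.sum_univ_add, Fin.sum_univ_castSucc]
  rw [Finset.sum_eq_zero (s := (Finset.univ : Finset (Fin t))), add_zero]
  · rfl
  · intro i _
    apply hf
    simp; omega

lemma bl_bdd {nx ny na nb : ℕ} (d : ℕ) (M : Fin nx → Fin ny → Fin na → Fin nb → ℝ) :
    BddAbove {r : ℝ | ∃ (k : ℕ) (ψ : Fin k × Fin k → ℂ)
      (A : Fin nx → Fin na → Matrix (Fin k) (Fin k) ℂ)
      (B : Fin ny → Fin nb → Matrix (Fin k) (Fin k) ℂ),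
    1 ≤ k ∧ k ≤ d ∧ (∑ p, norm (ψ p) ^ 2 = 1) ∧
    (∀ x a, (A x a).PosSemidef) ∧ (∀ x, ∑ a, A x a = 1) ∧
    (∀ y b, (B y b).PosSemidef) ∧ (∀ y, ∑ b, B y b = 1) ∧
    r = norm (∑ x, ∑ y, ∑ a, ∑ b, (M x y a b : ℂ) *
          ∑ p : Fin k × Fin k, ∑ q : Fin k × Fin k,
            (starRingEnd ℂ) (ψ p) * (A x a p.1 q.1 * B y b p.2 q.2) * ψ q)} := by
  refine ⟨∑ x, ∑ y, ∑ a, ∑ b, |M x y a b| * ((d : ℝ) ^ 2 * (d : ℝ) ^ 2), ?_⟩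
  rintro r ⟨k, ψ, A, B, hk, hkd, hψ, hA, hA1, hB, hB1, rfl⟩
  refine (norm_sum_le _ _).trans (Finset.sum_le_sum fun x _ => ?_)
  refine (norm_sum_le _ _).trans (Finset.sum_le_sum fun y _ => ?_)
  refine (norm_sum_le _ _).trans (Finset.sum_le_sum fun a _ => ?_)
  refine (norm_sum_le _ _).trans (Finset.sum_le_sum fun b _ => ?_)
  rw [norm_mul, Complex.norm_real, Real.norm_eq_abs]
  refine mul_le_mul_of_nonneg_left ?_ (abs_nonneg _)
  have hψ1 : ∀ p, ‖ψ p‖ ≤ 1 := by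
    intro p
    have : ‖ψ p‖ ^ 2 ≤ 1 := by
      rw [← hψ]
      exact Finset.single_le_sum (f := fun p => ‖ψ p‖ ^ 2) (fun p _ => by positivity)
        (Finset.mem_univ p)
    nlinarith [norm_nonneg (ψ p)]
  have hkd' : (k : ℝ) ≤ d := by exact_mod_cast hkd
  calc _ ≤ ∑ p : Fin k × Fin k, ∑ q : Fin k × Fin k, (1 : ℝ) := by
        refine (norm_sum_le _ _).trans (Finset.sum_le_sum fun p _ => ?_)
        refine (norm_sum_le _ _).trans (Finset.sum_le_sum fun q _ => ?_)
        rw [norm_mul, norm_mul, norm_mul, RCLike.norm_conj]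
        have h1 := bl_entry_le (A x) (hA x) (hA1 x) a p.1 q.1
        have h2 := bl_entry_le (B y) (hB y) (hB1 y) b p.2 q.2
        have h3 : ‖A x a p.1 q.1‖ * ‖B y b p.2 q.2‖ ≤ 1 := mul_le_one₀ h1 (norm_nonneg _) h2
        have h4 : ‖ψ p‖ * (‖A x a p.1 q.1‖ * ‖B y b p.2 q.2‖) ≤ 1 :=
          mul_le_one₀ (hψ1 p) (by positivity) h3
        exact mul_le_one₀ h4 (norm_nonneg _) (hψ1 q)
    _ = (k : ℝ) ^ 2 * (k : ℝ) ^ 2 := by simp; ring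
    _ ≤ _ := by gcongr

/-- rank one building block -/
noncomputable def blP {m : ℕ} (v : Fin (m + 1) → ℝ) : Matrix (Fin (m + 1)) (Fin (m + 1)) ℂ :=
  Matrix.of fun i j => (((2 * m : ℝ)⁻¹ * (v i * v j) : ℝ) : ℂ)

lemma blP_psd {m : ℕ} (v : Fin (m + 1) → ℝ) : (blP v).PosSemidef := by
  have h := (posSemidef_vecMulVec_self_star (fun i => (v i : ℂ))).smul
    (show (0 : ℝ) ≤ (2 * m : ℝ)⁻¹ by positivity)
  convert h using 1
  ext i j
  simp [blP, vecMulVec_apply]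

noncomputable def blV {m : ℕ} (ε : ℝ) (s : Fin m → ℝ) : Fin (m + 1) → ℝ :=
  Fin.cons 1 (fun k => ε * s k)

noncomputable def blA {m n : ℕ} (s : Fin m → Fin m → ℝ) (a : Fin n) :
    Matrix (Fin (m + 1)) (Fin (m + 1)) ℂ :=
  if h : a.1 < m then blP (blV 1 (s ⟨a.1, h⟩))
  else if a.1 = m then ∑ b, blP (blV (-1) (s b)) else 0

lemma blA_psd {m n : ℕ} (s : Fin m → Fin m → ℝ) (a : Fin n) : (blA s a).PosSemidef := by
  unfold blA
  split_ifs
  · exact blP_psd _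
  · exact posSemidef_sum _ fun b _ => blP_psd _
  · exact PosSemidef.zero

lemma blA_sum {m n : ℕ} (hm : 0 < m) (h : m + 1 ≤ n) (s : Fin m → Fin m → ℝ)
    (hs : ∀ k l, ∑ a, s a k * s a l = if k = l then (m : ℝ) else 0) :
    ∑ a : Fin n, blA s a = 1 := by
  have hm' : (m : ℝ) ≠ 0 := by positivity
  rw [bl_finsum h]
  · have e1 : ∀ a : Fin m, blA s (⟨a.1, by omega⟩ : Fin n) = blP (blV 1 (s a)) := by
      intro a; simp [blA]
    have e2 : blA s (⟨m, by omega⟩ : Fin n) = ∑ b, blP (blV (-1) (s b)) := by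
      simp [blA]
    rw [Finset.sum_congr rfl fun a _ => e1 a, e2, ← Finset.sum_add_distrib]
    ext i j
    rw [Matrix.sum_apply]
    simp only [blP, Matrix.add_apply, Matrix.of_apply]
    simp only [← Complex.ofReal_add, ← Complex.ofReal_sum, ← mul_add]
    rw [← Finset.mul_sum]
    have key : ∑ a, (blV 1 (s a) i * blV 1 (s a) j + blV (-1) (s a) i * blV (-1) (s a) j) =
        (2 * m : ℝ) * if i = j then 1 else 0 := by
      refine Fin.cases ?_ (fun k => ?_) i <;> refine Fin.cases ?_ (fun l => ?_) j
      · simp [blV]; ring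
      · simp [blV, (Fin.succ_ne_zero l).symm]
      · simp [blV]
      · simp only [blV, Fin.cons_succ, Fin.succ_inj]
        have : ∀ a, 1 * s a k * (1 * s a l) + -1 * s a k * (-1 * s a l) = 2 * (s a k * s a l) :=
          fun a => by ring
        rw [Finset.sum_congr rfl fun a _ => this a, ← Finset.mul_sum, hs]
        split_ifs <;> simp
    rw [key, Matrix.one_apply]
    split_ifs
    · rw [mul_one, inv_mul_cancel₀ (by simpa using hm')]; simp
    · simp
  · intro a ha
    simp [blA, ha.not_gt, ha.ne']

end blE

section blF

lemma blA_im {m n : ℕ} (s : Fin m → Fin m → ℝ) (a : Fin n) (i j : Fin (m + 1)) :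
    (blA s a i j).im = 0 := by
  unfold blA
  split_ifs
  · simp only [blP, Matrix.of_apply, Complex.ofReal_im]
  · simp only [Matrix.sum_apply, blP, Matrix.of_apply, Complex.im_sum, Complex.ofReal_im,
      Finset.sum_const_zero]
  · simp

noncomputable def blC {m : ℕ} (n N : ℕ) (u : Fin m → Fin m → ℝ) (k : Fin N) (a : Fin n) : ℝ :=
  if h : k.1 < m ∧ a.1 < m then u ⟨k.1, h.1⟩ ⟨a.1, h.2⟩ else 0

lemma bl_lower {n m : ℕ} (hm : 0 < m) (h : m + 1 ≤ n)
    (u : Fin m → Fin m → ℝ) (hu1 : ∀ k a, u k a * u k a = 1)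
    (hu2 : ∀ k l, ∑ a, u k a * u l a = if k = l then (m : ℝ) else 0)
    (e : Fin (2 ^ n ^ 2) ≃ (Fin (n ^ 2) → Bool)) (t : ℝ) (ht : 0 ≤ t) :
    t * (Real.sqrt m / 8) ≤ bellQValDim n (blM (blC n (n ^ 2) u) e t) := by
  have hm' : (0 : ℝ) < m := by exact_mod_cast hm
  have hmn : m ≤ n ^ 2 := by nlinarith
  set c := blC n (n ^ 2) u with hc
  set ik : Fin m → Fin (n ^ 2) := fun k => ⟨k.1, by omega⟩ with hik
  have hikinj : Function.Injective ik := by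
    intro k l hkl
    simpa [hik, Fin.ext_iff] using hkl
  set s : Fin (2 ^ n ^ 2) → Fin m → Fin m → ℝ := fun x a k => blSg (e x (ik k)) * u k a with hs
  set A : Fin (2 ^ n ^ 2) → Fin n → Matrix (Fin (m + 1)) (Fin (m + 1)) ℂ := fun x a => blA (s x) a
    with hA
  set φ : Fin (m + 1) → ℝ := Fin.cons (Real.sqrt 2)⁻¹ (fun _ => (Real.sqrt (2 * m))⁻¹) with hφ
  have hφ0 : ∀ i, 0 ≤ φ i := by
    intro i
    refine Fin.cases ?_ (fun k => ?_) i <;> simp [hφ]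
  have hA1 : ∀ x, ∑ a, A x a = 1 := by
    intro x
    refine blA_sum hm h (s x) fun k l => ?_
    simp only [hs]
    have : ∀ a, blSg (e x (ik k)) * u k a * (blSg (e x (ik l)) * u l a) =
      (blSg (e x (ik k)) * blSg (e x (ik l))) * (u k a * u l a) := fun a => by ring
    rw [Finset.sum_congr rfl fun a _ => this a, ← Finset.mul_sum, hu2]
    split_ifs with hkl
    · subst hkl; rw [blSg_sq, one_mul]
    · simp
  set X := blX c (fun z a => A (e.symm z) a) with hX
  have hXim : ∀ k i j, (X k i j).im = 0 := by
    intro k i j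
    rw [hX, blX_entry]
    simp only [Complex.im_sum, Complex.im_ofReal_mul, hA, blA_im, mul_zero, Finset.sum_const_zero]
  have hXre : ∀ k i j, X k i j = ((X k i j).re : ℂ) := fun k i j =>
    Complex.ext rfl (by simp [hXim])
  have hXk : ∀ k : Fin m, (X (ik k) 0 k.succ).re = 1 / 2 := by
    intro k
    rw [hX, blX_entry]
    simp only [Complex.re_sum, Complex.re_ofReal_mul]
    have e1 : ∀ x, ∑ a, (Fintype.card (Fin (n ^ 2) → Bool) : ℝ)⁻¹ * (blSg (e x (ik k)) * c (ik k) a) *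
        (A x a 0 k.succ).re = (Fintype.card (Fin (n ^ 2) → Bool) : ℝ)⁻¹ * (1 / 2) := by
      intro x
      rw [bl_finsum h]
      · have e2 : ∀ a : Fin m, (Fintype.card (Fin (n ^ 2) → Bool) : ℝ)⁻¹ * (blSg (e x (ik k)) *
            c (ik k) ⟨a.1, by omega⟩) * (A x ⟨a.1, by omega⟩ 0 k.succ).re =
            (Fintype.card (Fin (n ^ 2) → Bool) : ℝ)⁻¹ * (2 * m : ℝ)⁻¹ := by
          intro a
          have f1 : c (ik k) ⟨a.1, by omega⟩ = u k a := by simp [hc, blC, hik]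
          have f2 : (A x ⟨a.1, by omega⟩ 0 k.succ).re =
              (2 * m : ℝ)⁻¹ * (blSg (e x (ik k)) * u k a) := by
            simp only [hA, blA, a.2, dite_true, blP, Matrix.of_apply, Complex.ofReal_re, blV,
              Fin.cons_zero, Fin.cons_succ, hs]
            ring
          rw [f1, f2]
          have g1 := blSg_sq (e x (ik k))
          have g2 := hu1 k a
          calc _ = (Fintype.card (Fin (n ^ 2) → Bool) : ℝ)⁻¹ * (2 * m : ℝ)⁻¹ *
              ((blSg (e x (ik k)) * blSg (e x (ik k))) * (u k a * u k a)) := by ring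
            _ = _ := by rw [g1, g2]; ring
        have e3 : c (ik k) ⟨m, by omega⟩ = 0 := by simp [hc, blC]
        rw [Finset.sum_congr rfl fun a _ => e2 a, e3]
        simp only [Finset.sum_const, Finset.card_univ, Fintype.card_fin, nsmul_eq_mul]
        field_simp
        ring
      · intro a ha
        have : c (ik k) a = 0 := by simp [hc, blC, ha.le]
        rw [this]; ring
    rw [Finset.sum_congr rfl fun x _ => e1 x]
    simp
  refine le_trans ?_ (le_csSup (bl_bdd n _)
    ⟨m + 1, fun p => if p.1 = p.2 then (φ p.1 : ℂ) else 0, A, A, by omega, h, ?_,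
      fun x a => blA_psd _ _, hA1, fun x a => blA_psd _ _, hA1, rfl⟩)
  · rw [bl_value]
    simp only [bl_diagval]
    have e4 : (t : ℂ) * ∑ k, ∑ i, ∑ j, (φ i : ℂ) * φ j * (X k i j * X k i j) =
        ((t * ∑ k, ∑ i, ∑ j, φ i * φ j * ((X k i j).re * (X k i j).re) : ℝ) : ℂ) := by
      push_cast
      simp only [← hXre]
    rw [← hX, e4, Complex.norm_real, Real.norm_eq_abs]
    refine le_trans ?_ (le_abs_self _)
    refine mul_le_mul_of_nonneg_left ?_ ht
    have hnn : ∀ k i j, 0 ≤ φ i * φ j * ((X k i j).re * (X k i j).re) := fun k i j =>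
      mul_nonneg (mul_nonneg (hφ0 i) (hφ0 j)) (mul_self_nonneg _)
    calc Real.sqrt m / 8 = ∑ k : Fin m, (Real.sqrt 2)⁻¹ * (Real.sqrt (2 * m))⁻¹ * (1 / 2 * (1 / 2)) := by
          simp only [Finset.sum_const, Finset.card_univ, Fintype.card_fin, nsmul_eq_mul]
          rw [Real.sqrt_mul (by norm_num)]
          have h2 : Real.sqrt 2 * Real.sqrt 2 = 2 := Real.mul_self_sqrt (by norm_num)
          have h3 : Real.sqrt m * Real.sqrt m = m := Real.mul_self_sqrt hm'.le
          have h4 : 0 < Real.sqrt m := Real.sqrt_pos.2 hm'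
          have h5 : 0 < Real.sqrt 2 := Real.sqrt_pos.2 (by norm_num)
          rw [mul_inv, ← mul_assoc (Real.sqrt 2)⁻¹, ← mul_inv, h2]
          rw [div_eq_iff (by norm_num)]
          field_simp
          nlinarith
      _ = ∑ k : Fin m, φ 0 * φ k.succ * ((X (ik k) 0 k.succ).re * (X (ik k) 0 k.succ).re) := by
          refine Finset.sum_congr rfl fun k _ => ?_
          rw [hXk]; simp [hφ]
      _ ≤ ∑ k : Fin m, ∑ i, ∑ j, φ i * φ j * ((X (ik k) i j).re * (X (ik k) i j).re) := by
          refine Finset.sum_le_sum fun k _ => ?_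
          refine le_trans ?_ (Finset.single_le_sum (f := fun i => ∑ j, φ i * φ j *
            ((X (ik k) i j).re * (X (ik k) i j).re))
            (fun i _ => Finset.sum_nonneg fun j _ => hnn _ _ _) (Finset.mem_univ 0))
          exact Finset.single_le_sum (f := fun j => φ 0 * φ j *
            ((X (ik k) 0 j).re * (X (ik k) 0 j).re)) (fun j _ => hnn _ _ _)
            (Finset.mem_univ k.succ)
      _ = ∑ k ∈ Finset.univ.image ik, ∑ i, ∑ j, φ i * φ j * ((X k i j).re * (X k i j).re) := by
          rw [Finset.sum_image (fun k _ l _ hkl => hikinj hkl)]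
      _ ≤ _ := Finset.sum_le_univ_sum_of_nonneg fun k =>
          Finset.sum_nonneg fun i _ => Finset.sum_nonneg fun j _ => hnn _ _ _
  · rw [Fintype.sum_prod_type]
    have : ∀ i j : Fin (m + 1), ‖(if i = j then (φ i : ℂ) else 0)‖ ^ 2 =
        if i = j then φ i ^ 2 else 0 := by
      intro i j
      split_ifs <;> simp
    simp only [this, Finset.sum_ite_eq, Finset.mem_univ, if_true]
    rw [Fin.sum_univ_succ]
    simp only [hφ, Fin.cons_zero, Fin.cons_succ, Finset.sum_const, Finset.card_univ,
      Fintype.card_fin, nsmul_eq_mul, inv_pow]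
    rw [Real.sq_sqrt (by norm_num), Real.sq_sqrt (by positivity)]
    field_simp
    norm_num

lemma bl_me_le {n : ℕ} (p : ℕ) (hp : 1 ≤ p) (hnp : n ≤ 2 ^ p)
    (c : Fin (n ^ 2) → Fin n → ℝ) (hc : ∀ k a, c k a ^ 2 ≤ 1)
    (e : Fin (2 ^ n ^ 2) ≃ (Fin (n ^ 2) → Bool)) (t : ℝ) (ht : 0 ≤ t) :
    bellMEVal (blM c e t) ≤ t * (1536 * p) := by
  refine Real.sSup_le ?_ (by positivity)
  rintro r ⟨d, A, B, hd, hA, hA1, hB, hB1, rfl⟩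
  have hd' : (0 : ℝ) < d := by exact_mod_cast hd
  have h1 := bl_value c e t A B (fun p => if p.1 = p.2 then (((Real.sqrt d)⁻¹ : ℝ) : ℂ) else 0)
  rw [h1]
  have h2 := bl_diagval (fun _ : Fin d => (Real.sqrt d)⁻¹)
  simp only [h2]
  have h3 := bl_upper_me hc p hp (by simpa using hnp) d (fun z a => A (e.symm z) a)
    (fun z a => B (e.symm z) a) (fun _ _ => hA _ _) (fun _ => hA1 _) (fun _ _ => hB _ _)
    (fun _ => hB1 _)
  simp only [← Finset.mul_sum]
  rw [norm_mul, norm_mul, norm_mul, Complex.norm_real, Complex.norm_real, Real.norm_eq_abs,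
    Real.norm_eq_abs, abs_of_nonneg ht, abs_of_nonneg (by positivity), ← mul_inv,
    Real.mul_self_sqrt hd'.le]
  refine mul_le_mul_of_nonneg_left ?_ ht
  rw [inv_mul_le_iff₀ hd']
  linarith

end blF

end blMain

/-- large violations not attainable with maximally entangled states:
there are a universal `C > 0` and, for each `n ≥ 2`, a Bell functional with `2^{n²}`
inputs and `n` outputs per party whose quantum value in local dimension `n` is at least
`√n / log n`, while its value over maximally entangled states of any dimension is at
most `C`. -/
theorem stmt9 :
    ∃ C : ℝ, 0 < C ∧
      ∀ n : ℕ, 2 ≤ n →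
        ∃ M : Fin (2 ^ n ^ 2) → Fin (2 ^ n ^ 2) → Fin n → Fin n → ℝ,
          Real.sqrt n / Real.log n ≤ bellQValDim n M ∧
          bellMEVal M ≤ C := by
  refine ⟨16 * 1536 * (2 / Real.log 2), by have := Real.log_pos one_lt_two; positivity, fun n hn => ?_⟩
  have hl2 : 0 < Real.log 2 := Real.log_pos one_lt_two
  have hn1 : (1 : ℝ) < n := by exact_mod_cast hn
  have hln : 0 < Real.log n := Real.log_pos hn1
  have e : Fin (2 ^ n ^ 2) ≃ (Fin (n ^ 2) → Bool) := Fintype.equivOfCardEq (by simp)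
  have hm1 : 2 ^ Nat.log 2 (n - 1) ≤ n - 1 := Nat.pow_log_le_self 2 (by omega)
  have hm2 : n - 1 < 2 ^ (Nat.log 2 (n - 1) + 1) := Nat.lt_pow_succ_log_self (by norm_num) _
  set r := Nat.log 2 (n - 1) with hr
  obtain ⟨u, hu1, hu2⟩ := bl_had r
  have hm0 : 0 < 2 ^ r := by positivity
  have hn2 : n ≤ 2 * 2 ^ r := by rw [pow_succ] at hm2; omega
  have hcast : (((2 ^ r : ℕ)) : ℝ) = (2 : ℝ) ^ r := by push_cast; rfl
  have ht : 0 ≤ 16 / Real.log n := by positivity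
  refine ⟨blM (blC n (n ^ 2) u) e (16 / Real.log n), ?_, ?_⟩
  · refine le_trans ?_ (bl_lower hm0 (by omega) u hu1 (fun k l => by rw [hu2, hcast]) e _ ht)
    have hs : Real.sqrt n ≤ 2 * Real.sqrt ((2 ^ r : ℕ) : ℝ) := by
      rw [Real.sqrt_le_left (by positivity), mul_pow, Real.sq_sqrt (by positivity)]
      have : (n : ℝ) ≤ 2 * ((2 ^ r : ℕ) : ℝ) := by exact_mod_cast hn2
      have h0 : (0 : ℝ) ≤ ((2 ^ r : ℕ) : ℝ) := by positivity
      linarith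
    rw [div_mul_eq_mul_div, div_le_div_iff_of_pos_right hln]
    linarith
  · refine (bl_me_le (r + 1) (by omega) (by rw [pow_succ]; omega) _ ?_ e _ ht).trans ?_
    · intro k a
      unfold blC
      split_ifs
      · rw [sq, hu1]
      · norm_num
    · have h1 : (r : ℝ) * Real.log 2 ≤ Real.log n := by
        rw [← Real.log_pow]
        refine Real.log_le_log (by positivity) ?_
        rw [← hcast]
        exact_mod_cast hm1.trans (Nat.sub_le _ _)
      have h2 : Real.log 2 ≤ Real.log n := Real.log_le_log (by norm_num) (by exact_mod_cast hn)
      have h3 : ((r + 1 : ℕ) : ℝ) ≤ 2 / Real.log 2 * Real.log n := by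
        rw [div_mul_eq_mul_div, le_div_iff₀ hl2]
        push_cast
        linarith
      calc 16 / Real.log n * (1536 * ((r + 1 : ℕ) : ℝ)) ≤
          16 / Real.log n * (1536 * (2 / Real.log 2 * Real.log n)) := by gcongr
        _ = _ := by field_simp
end
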